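/- arXiv:1711.06847 — 7 statements merged into one kernel-verified Lean document; each statement's English description precedes it below -/
import Mathlib

section
/- Let k ≥ 2 and let (M_1, …, M_k) be a unitary harmonious k-tuple of positive integers, and set L = ω(M_1) + ⋯ + ω(M_k). Then M_1 ⋯ M_k ≤ k^{−k} · (2^{2^L} − 2^{2^{L−1}}). -/
/-- `usigma n` is the sum of all unitary divisors of `n`, i.e. divisors `d ∣ n`
with `gcd (d, n / d) = 1`. -/
def usigma (n : ℕ) : ℕ := ∑ d ∈ n.divisors.filter (fun d => Nat.gcd d (n / d) = 1), d

lemma log_tangent {m n : ℝ} (hm : 1 < m) (hn : 1 < n) :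
    (n - 1)⁻¹ * (Real.log n - Real.log m) ≤
      Real.log (1 - 1 / n) - Real.log (1 - 1 / m) := by
  have hm0 : 0 < m - 1 := by linarith
  have hn0 : 0 < n - 1 := by linarith
  have hn' : 0 < n := by linarith
  have hconc := strictConcaveOn_log_Ioi.concaveOn.2 (Set.mem_Ioi.2 (div_pos hm0 hn0))
    (Set.mem_Ioi.2 one_pos) (div_nonneg hn0.le hn'.le) (one_div_nonneg.2 hn'.le)
    (by field_simp; ring)
  have he : ((n - 1) / n) • ((m - 1) / (n - 1)) + (1 / n) • (1 : ℝ) = m / n := by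
    simp only [smul_eq_mul]; field_simp; ring
  rw [he] at hconc
  simp only [smul_eq_mul, Real.log_one, mul_zero, add_zero] at hconc
  rw [Real.log_div (by linarith) (by linarith), Real.log_div (by linarith) (by linarith)] at hconc
  have h1 : 1 - 1 / n = (n - 1) / n := by field_simp
  have h2 : 1 - 1 / m = (m - 1) / m := by field_simp
  rw [h1, h2, Real.log_div (by linarith) (by linarith), Real.log_div (by linarith) (by linarith),
    inv_mul_le_iff₀ hn0]
  rw [div_mul_eq_mul_div, div_le_iff₀ (by linarith)] at hconc
  linarith

lemma mul_sum_Ico_le_sum_mul {c d : ℕ → ℝ} {t L : ℕ}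
    (hanti : ∀ s, s + 1 < L → c (s + 1) ≤ c s)
    (hd : ∀ s, t < s → s ≤ L → 0 < ∑ j ∈ Finset.Ico t s, d j) {s : ℕ} (hts : t ≤ s) (hs : s < L) :
    c s * ∑ j ∈ Finset.Ico t (s + 1), d j ≤ ∑ j ∈ Finset.Ico t (s + 1), c j * d j := by
  induction s, hts using Nat.le_induction with
  | base => simp
  | succ s hts ih =>
    rw [Finset.sum_Ico_succ_top (b := s + 1) (by lia),
      Finset.sum_Ico_succ_top (b := s + 1) (by lia), mul_add]
    have := ih (by lia)
    have := mul_le_mul_of_nonneg_right (hanti s hs) (hd (s + 1) (by lia) (by lia)).le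
    linarith

/-- The extremal sequence `3, 5, 17, …, 2 ^ 2 ^ (L - 2) + 1, 2 ^ 2 ^ (L - 1)`. -/
def extremalSeq (L j : ℕ) : ℝ := if j + 1 = L then 2 ^ 2 ^ j else 2 ^ 2 ^ j + 1

lemma one_lt_extremalSeq (L j : ℕ) : 1 < extremalSeq L j := by
  have : (1 : ℝ) < 2 ^ 2 ^ j := one_lt_pow₀ one_lt_two (by positivity)
  unfold extremalSeq
  split_ifs <;> linarith

lemma prod_range_extremalSeq {L t : ℕ} (ht : t < L) :
    ∏ j ∈ Finset.range t, extremalSeq L j = 2 ^ 2 ^ t - 1 := by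
  induction t with
  | zero => norm_num
  | succ t ih =>
    rw [Finset.prod_range_succ, ih (by lia), extremalSeq, if_neg (by lia), pow_succ 2 t, pow_mul]
    ring

lemma prod_range_extremalSeq_self {L : ℕ} (hL : 0 < L) :
    ∏ j ∈ Finset.range L, extremalSeq L j = 2 ^ 2 ^ L - 2 ^ 2 ^ (L - 1) := by
  obtain ⟨s, rfl⟩ : ∃ s, L = s + 1 := ⟨L - 1, by lia⟩
  rw [Finset.prod_range_succ, prod_range_extremalSeq (by lia), extremalSeq, if_pos rfl,
    Nat.add_sub_cancel, pow_succ 2 s, pow_mul]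
  ring

lemma prod_Ico_one_sub_extremalSeq {L t : ℕ} (ht : t < L) :
    ∏ j ∈ Finset.Ico t L, (1 - 1 / extremalSeq L j) = 1 - 1 / 2 ^ 2 ^ t := by
  have key : ∀ s, t ≤ s →
      (∏ j ∈ Finset.Ico t s, (1 - 1 / ((2 : ℝ) ^ 2 ^ j + 1))) * (1 - 1 / 2 ^ 2 ^ s) =
        1 - 1 / 2 ^ 2 ^ t := by
    intro s hts
    induction s, hts using Nat.le_induction with
    | base => simp
    | succ s hts ih =>
      rw [← ih, Finset.prod_Ico_succ_top hts, mul_assoc, pow_succ 2 s, pow_mul]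
      congr 1
      have : (0 : ℝ) < 2 ^ 2 ^ s := by positivity
      field_simp
      ring
  obtain ⟨s, rfl⟩ : ∃ s, L = s + 1 := ⟨L - 1, by lia⟩
  rw [← key s (by lia), Finset.prod_Ico_succ_top (by lia)]
  congr 1
  · refine Finset.prod_congr rfl fun j hj => ?_
    rw [extremalSeq, if_neg (by have := Finset.mem_Ico.1 hj; lia)]
  · rw [extremalSeq, if_pos rfl]

/-- A sorted real sequence whose tails satisfy the constraints that hold with equality for
`extremalSeq` has product at most that of `extremalSeq`. -/
lemma prod_le_of_tail_constraints {L : ℕ} (hL : 0 < L) {n : ℕ → ℝ} (h1 : ∀ j < L, 1 < n j)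
    (hmono : ∀ s, s + 1 < L → n s ≤ n (s + 1))
    (hc : ∀ t < L, ∏ j ∈ Finset.Ico t L, (1 - 1 / n j) ≤
      (∏ j ∈ Finset.range t, n j) / (∏ j ∈ Finset.range t, n j + 1)) :
    ∏ j ∈ Finset.range L, n j ≤ 2 ^ 2 ^ L - 2 ^ 2 ^ (L - 1) := by
  rw [← prod_range_extremalSeq_self hL]
  set m := extremalSeq L
  have hm1 : ∀ j, 1 < m j := one_lt_extremalSeq L
  by_contra! hlt
  set Q : ℕ → Prop := fun t => ∏ j ∈ Finset.range t, n j ≤ ∏ j ∈ Finset.range t, m j with hQ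
  have hQ0 : Q 0 := by simp [hQ]
  obtain ⟨t, htL, hQt, hmax⟩ : ∃ t, t < L ∧ Q t ∧ ∀ s, t < s → s ≤ L → ¬ Q s := by
    classical
    have hspec := Nat.findGreatest_spec (P := Q) (Nat.zero_le L) hQ0
    refine ⟨Nat.findGreatest Q L, lt_of_le_of_ne (Nat.findGreatest_le L) ?_, hspec,
      fun s => Nat.findGreatest_is_greatest⟩
    intro h
    rw [h] at hspec
    exact hspec.not_gt hlt
  have hn0 : ∀ s ≤ L, 0 < ∏ j ∈ Finset.range s, n j := fun s hs =>
    Finset.prod_pos fun j hj => by linarith [h1 j (by have := Finset.mem_range.1 hj; lia)]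
  have hlogsum : ∀ {f : ℕ → ℝ}, (∀ j < L, 1 < f j) → ∀ s ≤ L,
      Real.log (∏ j ∈ Finset.range s, f j) = ∑ j ∈ Finset.range s, Real.log (f j) :=
    fun hf s hs => Real.log_prod fun j hj => by
      linarith [hf j (by have := Finset.mem_range.1 hj; lia)]
  have hd : ∀ s, t < s → s ≤ L →
      0 < ∑ j ∈ Finset.Ico t s, (Real.log (n j) - Real.log (m j)) := by
    intro s hts hs
    have hA := Real.log_lt_log (Finset.prod_pos fun j _ => by linarith [hm1 j])
      (not_le.1 (hmax s hts hs))
    have hB := Real.log_le_log (hn0 t htL.le) hQt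
    rw [hlogsum h1 s hs, hlogsum (fun j _ => hm1 j) s hs] at hA
    rw [hlogsum h1 t htL.le, hlogsum (fun j _ => hm1 j) t htL.le] at hB
    rw [Finset.sum_Ico_eq_sub _ hts.le, Finset.sum_sub_distrib, Finset.sum_sub_distrib]
    linarith
  obtain ⟨s, rfl⟩ : ∃ s, L = s + 1 := ⟨L - 1, by lia⟩
  have habel := mul_sum_Ico_le_sum_mul (c := fun j => (n j - 1)⁻¹)
    (fun s hs => inv_anti₀ (by linarith [h1 s (by lia)]) (by linarith [hmono s hs]))
    hd (Nat.lt_succ_iff.1 htL) (Nat.lt_succ_self s)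
  have hpos : 0 < (n s - 1)⁻¹ := inv_pos.2 (by linarith [h1 s (by lia)])
  have hlog : ∑ j ∈ Finset.Ico t (s + 1), (n j - 1)⁻¹ * (Real.log (n j) - Real.log (m j)) ≤
      ∑ j ∈ Finset.Ico t (s + 1), (Real.log (1 - 1 / n j) - Real.log (1 - 1 / m j)) :=
    Finset.sum_le_sum fun j hj => log_tangent (hm1 j) (h1 j (Finset.mem_Ico.1 hj).2)
  have hone : ∀ {x : ℝ}, 1 < x → 0 < 1 - 1 / x := fun hx =>
    sub_pos.2 ((div_lt_one (by linarith)).2 hx)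
  have hn1 : ∀ j ∈ Finset.Ico t (s + 1), 0 < 1 - 1 / n j := fun j hj =>
    hone (h1 j (Finset.mem_Ico.1 hj).2)
  rw [Finset.sum_sub_distrib, ← Real.log_prod fun j hj => (hn1 j hj).ne',
    ← Real.log_prod fun j _ => (hone (hm1 j)).ne'] at hlog
  have hle : ∏ j ∈ Finset.Ico t (s + 1), (1 - 1 / n j) ≤
      ∏ j ∈ Finset.Ico t (s + 1), (1 - 1 / m j) := by
    refine (hc t htL).trans ?_
    rw [prod_Ico_one_sub_extremalSeq htL]
    have hP := hn0 t htL.le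
    have hQt' : ∏ j ∈ Finset.range t, n j ≤ 2 ^ 2 ^ t - 1 :=
      hQt.trans_eq (prod_range_extremalSeq htL)
    rw [div_le_iff₀ (by linarith), one_sub_div (by positivity), div_mul_eq_mul_div,
      le_div_iff₀ (by positivity)]
    linarith
  have := Real.log_le_log (Finset.prod_pos hn1) hle
  have := mul_pos hpos (hd (s + 1) htL le_rfl)
  linarith

lemma usigma_mul {m n : ℕ} (h : m.Coprime n) : usigma (m * n) = usigma m * usigma n := by
  have hiff : ∀ {a b : ℕ}, a ∣ m → b ∣ n →
      (Nat.gcd (a * b) (m * n / (a * b)) = 1 ↔ Nat.gcd a (m / a) = 1 ∧ Nat.gcd b (n / b) = 1) := by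
    intro a b ha hb
    rw [← Nat.div_mul_div_comm ha hb]
    have h1 : Nat.Coprime a (n / b) := h.of_dvd ha (Nat.div_dvd_of_dvd hb)
    have h2 : Nat.Coprime b (m / a) := (h.of_dvd (Nat.div_dvd_of_dvd ha) hb).symm
    change Nat.Coprime _ _ ↔ Nat.Coprime _ _ ∧ Nat.Coprime _ _
    rw [Nat.coprime_mul_iff_left, Nat.coprime_mul_iff_right, Nat.coprime_mul_iff_right]
    tauto
  unfold usigma
  rw [Finset.sum_mul_sum, ← Finset.sum_product']
  symm
  refine Finset.sum_nbij (fun p => p.1 * p.2) ?_ ?_ ?_ fun _ _ => rfl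
  · rintro ⟨a, b⟩ hp
    simp only [Finset.mem_product, Finset.mem_filter, Nat.mem_divisors] at hp ⊢
    obtain ⟨⟨⟨ha, hm⟩, ha'⟩, ⟨hb, hn⟩, hb'⟩ := hp
    exact ⟨⟨mul_dvd_mul ha hb, mul_ne_zero hm hn⟩, (hiff ha hb).2 ⟨ha', hb'⟩⟩
  · refine h.mul_injOn_divisors.mono fun p hp => ?_
    simp only [Finset.coe_product, Set.mem_prod, Finset.mem_coe,
      Finset.mem_filter] at hp ⊢
    exact ⟨hp.1.1, hp.2.1⟩
  · intro d hd
    simp only [Finset.mem_coe, Finset.mem_filter, Nat.mem_divisors] at hd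
    obtain ⟨⟨hd, hmn⟩, hd'⟩ := hd
    obtain ⟨a, b, ha, hb, rfl⟩ := exists_dvd_and_dvd_of_dvd_mul hd
    have := (hiff ha hb).1 hd'
    refine ⟨(a, b), ?_, rfl⟩
    simp [ha, hb, this, left_ne_zero_of_mul hmn, right_ne_zero_of_mul hmn]

lemma usigma_prime_pow {p k : ℕ} (hp : p.Prime) (hk : k ≠ 0) : usigma (p ^ k) = p ^ k + 1 := by
  have hfilter : (p ^ k).divisors.filter (fun d => Nat.gcd d (p ^ k / d) = 1) = {1, p ^ k} := by
    ext d
    simp only [Finset.mem_filter, Finset.mem_insert, Finset.mem_singleton,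
      Nat.mem_divisors_prime_pow hp]
    constructor
    · rintro ⟨⟨j, hj, rfl⟩, hg⟩
      rw [Nat.pow_div hj hp.pos] at hg
      rcases Nat.eq_zero_or_pos j with rfl | hj0
      · simp
      rcases Nat.eq_zero_or_pos (k - j) with h0 | h0
      · right; rw [show j = k by lia]
      · exact absurd (Nat.dvd_gcd (dvd_pow_self p hj0.ne') (dvd_pow_self p h0.ne'))
          (by rw [hg]; exact hp.one_lt.ne' ∘ Nat.dvd_one.1)
    · rintro (rfl | rfl)
      · exact ⟨⟨0, by simp⟩, by simp⟩
      · exact ⟨⟨k, le_rfl, rfl⟩, by rw [Nat.div_self (pow_pos hp.pos k)]; simp⟩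
  rw [usigma, hfilter, Finset.sum_pair (Nat.one_lt_pow hk hp.one_lt).ne, add_comm]

lemma usigma_eq_prod {n : ℕ} (hn : n ≠ 0) :
    usigma n = ∏ p ∈ n.primeFactors, (p ^ n.factorization p + 1) := by
  rw [Nat.multiplicative_factorization usigma (fun _ _ => usigma_mul) (by decide) hn]
  refine Finset.prod_congr rfl fun p hp => usigma_prime_pow (Nat.prime_of_mem_primeFactors hp) ?_
  exact Finsupp.mem_support_iff.1 hp

lemma prod_compl_one_sub_inv_le {ι I : Type*} [Fintype ι] [DecidableEq ι] [Fintype I]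
    [DecidableEq I] (g : I → ι) (n : I → ℕ) (hn : ∀ j, 2 ≤ n j)
    (h : ∑ i, ∏ j, (if g j = i then 1 - 1 / (n j : ℝ) else 1) = 1) {S : Finset I}
    (hS : S ≠ Finset.univ) :
    ∏ j ∈ Sᶜ, (1 - 1 / (n j : ℝ)) ≤ (∏ j ∈ S, (n j : ℝ)) / (∏ j ∈ S, (n j : ℝ) + 1) := by
  set w : ι → I → ℝ := fun i j => if g j = i then 1 - 1 / (n j : ℝ) else 1 with hw
  have hn' : ∀ j, (2 : ℝ) ≤ n j := fun j => by exact_mod_cast hn j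
  have hx0 : ∀ j, 0 < 1 - 1 / (n j : ℝ) := fun j =>
    sub_pos.2 ((div_lt_one (by linarith [hn' j])).2 (by linarith [hn' j]))
  have hx1 : ∀ j, 1 - 1 / (n j : ℝ) < 1 := fun j =>
    sub_lt_self _ (by have := hn' j; positivity)
  have hw0 : ∀ i j, 0 < w i j := fun i j => by
    simp only [hw]; split_ifs <;> simp only [hx0, one_pos]
  have hw1 : ∀ i j, w i j ≤ 1 := fun i j => by
    simp only [hw]; split_ifs <;> simp only [(hx1 j).le, le_rfl]
  have hwx : ∀ i j, 1 - 1 / (n j : ℝ) ≤ w i j := fun i j => by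
    simp only [hw]; split_ifs <;> simp only [(hx1 j).le, le_rfl]
  set P := ∏ j ∈ S, (n j : ℝ) with hP
  set T := ∏ j ∈ Sᶜ, (1 - 1 / (n j : ℝ)) with hT
  set f := ∑ i, ∏ j ∈ S, w i j with hf
  have hP0 : 0 < P := Finset.prod_pos fun j _ => by linarith [hn' j]
  have hpos : ∀ i (A : Finset I), 0 < ∏ j ∈ A, w i j := fun i A => Finset.prod_pos fun j _ => hw0 i j
  have hfT : f * T ≤ 1 := by
    rw [← h, hf, Finset.sum_mul]
    refine Finset.sum_le_sum fun i _ => ?_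
    rw [← Finset.prod_mul_prod_compl S]
    exact mul_le_mul_of_nonneg_left
      (Finset.prod_le_prod (fun j _ => (hx0 j).le) fun j _ => hwx i j) (hpos i S).le
  obtain ⟨j₀, hj₀⟩ : ∃ j, j ∉ S := by
    by_contra! hall
    exact hS (Finset.eq_univ_iff_forall.2 hall)
  have hf1 : 1 < f := by
    rw [← h, hf]
    refine Finset.sum_lt_sum (fun i _ => ?_) ⟨g j₀, Finset.mem_univ _, ?_⟩
    · rw [← Finset.prod_mul_prod_compl S]
      exact mul_le_of_le_one_right (hpos i S).le
        (Finset.prod_le_one (fun j _ => (hw0 i j).le) fun j _ => hw1 i j)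
    · rw [← Finset.prod_mul_prod_compl S]
      refine mul_lt_of_lt_one_right (hpos _ S) ?_
      rw [← Finset.mul_prod_erase _ _ (Finset.mem_compl.2 hj₀)]
      refine mul_lt_one_of_nonneg_of_lt_one_left (hw0 _ _).le ?_
        (Finset.prod_le_one (fun j _ => (hw0 _ j).le) fun j _ => hw1 _ j)
      simpa [hw] using hx1 j₀
  have hf_nat : f * P = ((∑ i, ∏ j ∈ S, (if g j = i then n j - 1 else n j) : ℕ) : ℝ) := by
    rw [hf, Finset.sum_mul, Nat.cast_sum]
    refine Finset.sum_congr rfl fun i _ => ?_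
    rw [hP, ← Finset.prod_mul_distrib, Nat.cast_prod]
    refine Finset.prod_congr rfl fun j _ => ?_
    have := hn' j
    simp only [hw]
    split_ifs
    · rw [Nat.cast_sub (by linarith [hn j]), Nat.cast_one]
      field_simp
    · rw [one_mul]
  have hPnat : P = ((∏ j ∈ S, n j : ℕ) : ℝ) := (Nat.cast_prod _ _).symm
  have hfP : P + 1 ≤ f * P := by
    have hlt : P < f * P := lt_mul_of_one_lt_left hP0 hf1
    rw [hf_nat, hPnat] at hlt ⊢
    exact_mod_cast hlt
  have hT0 : 0 < T := Finset.prod_pos fun j _ => hx0 j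
  rw [le_div_iff₀ (by linarith)]
  nlinarith

theorem prod_le_of_sum_prod_one_sub_inv_eq_one {ι I : Type*} [Fintype ι] [DecidableEq ι]
    [Fintype I] (hι : 2 ≤ Fintype.card ι) (g : I → ι) (n : I → ℕ) (hn : ∀ j, 2 ≤ n j)
    (h : ∑ i, ∏ j, (if g j = i then 1 - 1 / (n j : ℝ) else 1) = 1) :
    ∏ j, (n j : ℝ) ≤ 2 ^ 2 ^ Fintype.card I - 2 ^ 2 ^ (Fintype.card I - 1) := by
  classical
  have : Nonempty I := by
    by_contra hI
    rw [not_nonempty_iff] at hI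
    simp only [Finset.univ_eq_empty, Finset.prod_empty, Finset.sum_const, nsmul_eq_mul,
      mul_one, Finset.card_univ] at h
    rw [Nat.cast_eq_one.1 h] at hι
    lia
  set L := Fintype.card I with hL
  have hL0 : 0 < L := Fintype.card_pos
  let e₀ : Fin L ≃ I := (Fintype.equivFin I).symm
  let e : Fin L ≃ I := (Tuple.sort (n ∘ e₀)).trans e₀
  have hmono : Monotone (n ∘ e) := Tuple.monotone_sort (n ∘ e₀)
  let E : ℕ → I := fun t => if ht : t < L then e ⟨t, ht⟩ else Classical.arbitrary I
  have hE : ∀ {t} (ht : t < L), E t = e ⟨t, ht⟩ := fun ht => dif_pos ht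
  have hinj : Set.InjOn E (Finset.range L) := by
    intro s hs t ht hst
    have hs' := Finset.mem_range.1 hs
    have ht' := Finset.mem_range.1 ht
    rw [hE hs', hE ht'] at hst
    simpa using hst
  have himage : (Finset.range L).image E = Finset.univ := by
    refine Finset.eq_univ_iff_forall.2 fun j => Finset.mem_image.2 ?_
    exact ⟨e.symm j, Finset.mem_range.2 (e.symm j).2, by rw [hE (e.symm j).2]; simp⟩
  have hprod : ∀ (A : Finset ℕ) (f : I → ℝ), A ⊆ Finset.range L →
      ∏ j ∈ A.image E, f j = ∏ t ∈ A, f (E t) := fun A f hA =>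
    Finset.prod_image (hinj.mono (by exact_mod_cast hA))
  have hn' : ∀ j, (2 : ℝ) ≤ n j := fun j => by exact_mod_cast hn j
  rw [← himage, hprod _ _ subset_rfl]
  refine prod_le_of_tail_constraints hL0 (fun t _ => by linarith [hn' (E t)]) (fun s hs => ?_)
    fun t ht => ?_
  · rw [hE hs, hE (by lia)]
    exact_mod_cast hmono (Fin.mk_le_mk.2 (Nat.le_succ s))
  · have hsub : Finset.range t ⊆ Finset.range L := Finset.range_subset_range.2 ht.le
    have hcompl : ((Finset.range t).image E)ᶜ = (Finset.Ico t L).image E := by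
      rw [Finset.compl_eq_univ_sdiff, ← himage, ← Finset.image_sdiff_of_injOn hinj hsub]
      congr 1
      ext s
      simp only [Finset.mem_sdiff, Finset.mem_range, Finset.mem_Ico]
      lia
    have hne : (Finset.range t).image E ≠ Finset.univ := by
      intro hu
      have := Finset.card_image_le (s := Finset.range t) (f := E)
      rw [hu, Finset.card_univ, Finset.card_range] at this
      lia
    have := prod_compl_one_sub_inv_le g n hn h hne
    rwa [hcompl, hprod _ _ (fun s hs => Finset.mem_range.2 (Finset.mem_Ico.1 hs).2),
      hprod _ _ hsub] at this

lemma prod_le_inv_pow_of_sum_eq_one {k : ℕ} (hk : 0 < k) {z : Fin k → ℝ} (hz : ∀ i, 0 ≤ z i)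
    (h : ∑ i, z i = 1) : ∏ i, z i ≤ (k : ℝ) ^ (-(k : ℤ)) := by
  have hk0 : (k : ℝ) ≠ 0 := by positivity
  have hamgm := Real.geom_mean_le_arith_mean_weighted Finset.univ (fun _ => (k : ℝ)⁻¹) z
    (fun _ _ => by positivity) (by simp [hk0]) fun i _ => hz i
  rw [← Finset.mul_sum, h, mul_one, Real.finsetProd_rpow _ _ fun i _ => hz i] at hamgm
  have h0 : 0 ≤ ∏ i, z i := Finset.prod_nonneg fun i _ => hz i
  have := pow_le_pow_left₀ (by positivity) hamgm k
  rwa [Real.rpow_inv_natCast_pow h0 hk.ne', inv_pow, ← zpow_natCast, ← zpow_neg] at this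

theorem amicable_tuples_stmt4 (k : ℕ) (hk : 2 ≤ k) (M : Fin k → ℕ)
    (hpos : ∀ i, 0 < M i)
    (hharm : ∑ i, (M i : ℝ) / (usigma (M i) : ℝ) = 1)
    (L : ℕ) (hL : L = ∑ i, (M i).primeFactors.card) :
    ((∏ i, M i : ℕ) : ℝ) ≤
      (k : ℝ) ^ (-(k : ℤ)) * ((2 : ℝ) ^ (2 ^ L) - (2 : ℝ) ^ (2 ^ (L - 1))) := by
  let n : (Σ i, (M i).primeFactors) → ℕ := fun j => (j.2 : ℕ) ^ (M j.1).factorization j.2 + 1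
  have hn : ∀ j, 2 ≤ n j := fun j =>
    Nat.succ_le_succ (pow_pos (Nat.prime_of_mem_primeFactors j.2.2).pos _)
  have hcard : Fintype.card (Σ i, (M i).primeFactors) = L := by simp [hL]
  have husigma : ∀ i, usigma (M i) = ∏ p : (M i).primeFactors, n ⟨i, p⟩ := fun i => by
    rw [usigma_eq_prod (hpos i).ne', ← Finset.prod_coe_sort]
  have hM : ∀ i, M i = ∏ p : (M i).primeFactors, (p : ℕ) ^ (M i).factorization p := fun i => by
    rw [Finset.prod_coe_sort (M i).primeFactors fun p => p ^ (M i).factorization p]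
    exact (Nat.prod_factorization_pow_eq_self (hpos i).ne').symm
  have hratio : ∀ i, (M i : ℝ) / usigma (M i) =
      ∏ j, (if j.1 = i then 1 - 1 / (n j : ℝ) else 1) := fun i => by
    rw [Fintype.prod_sigma, Finset.prod_eq_single i (fun i' _ hi' => by simp [hi']) (by simp),
      husigma, congrArg (Nat.cast (R := ℝ)) (hM i), Nat.cast_prod, Nat.cast_prod,
      ← Finset.prod_div_distrib]
    refine Finset.prod_congr rfl fun p _ => ?_
    simp only [n, if_true]
    push_cast
    have : (0 : ℝ) < (p : ℝ) ^ (M i).factorization p + 1 := by positivity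
    field_simp
    ring
  have hbound := prod_le_of_sum_prod_one_sub_inv_eq_one (by simpa using hk) Sigma.fst n hn
    (by simpa only [hratio] using hharm)
  rw [hcard, Fintype.prod_sigma] at hbound
  have hsigma : ∏ i, (usigma (M i) : ℝ) = ∏ i, ∏ p, (n ⟨i, p⟩ : ℝ) :=
    Finset.prod_congr rfl fun i _ => by rw [husigma, Nat.cast_prod]
  rw [← hsigma] at hbound
  have hs0 : ∀ i, (0 : ℝ) < usigma (M i) := fun i => by
    rw [husigma]
    exact_mod_cast Finset.prod_pos fun p _ => by linarith [hn ⟨i, p⟩]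
  calc ((∏ i, M i : ℕ) : ℝ) = (∏ i, (M i : ℝ) / usigma (M i)) * ∏ i, (usigma (M i) : ℝ) := by
        rw [← Finset.prod_mul_distrib, Nat.cast_prod]
        exact Finset.prod_congr rfl fun i _ => (div_mul_cancel₀ _ (hs0 i).ne').symm
    _ ≤ _ := mul_le_mul
        (prod_le_inv_pow_of_sum_eq_one (by lia) (fun i => div_nonneg (by positivity) (hs0 i).le)
          hharm)
        hbound (Finset.prod_nonneg fun i _ => (hs0 i).le) (by positivity)
end

section
/- Let 1 < x_1 ≤ x_2 ≤ ⋯ ≤ x_k and 1 < y_1 ≤ y_2 ≤ ⋯ ≤ y_k be real numbers such that ∏_{i=1}^{s} x_i ≤ ∏_{i=1}^{s} y_i for every s with 1 ≤ s ≤ k. Then ∏_{i=1}^{k} (1 − 1/x_i) ≤ ∏_{i=1}^{k} (1 − 1/y_i) and ∏_{i=1}^{k} (1 + 1/x_i) ≥ ∏_{i=1}^{k} (1 + 1/y_i), and in each of the two inequalities equality holds if and only if x_i = y_i for every i. -/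
/-- Abel summation: weighting by an antitone sequence bounded below by `m` a sequence with
nonpositive partial sums. -/
theorem sum_mul_le_mul_sum_of_antitone {k : ℕ} {c d : Fin k → ℝ} {m : ℝ} (hc : Antitone c)
    (hm : ∀ i, m ≤ c i) (hd : ∀ s, ∑ i ∈ Finset.Iic s, d i ≤ 0) :
    ∑ i, c i * d i ≤ m * ∑ i, d i := by
  induction k generalizing m with
  | zero => simp
  | succ k ih =>
    have htotal : ∑ i, d i ≤ 0 := by
      have h := hd (Fin.last k)
      rwa [← Fin.top_eq_last, Finset.Iic_top] at h
    have hinit : ∑ i : Fin k, c i.castSucc * d i.castSucc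
        ≤ c (Fin.last k) * ∑ i : Fin k, d i.castSucc := by
      refine ih (c := fun i => c i.castSucc) (d := fun i => d i.castSucc)
        (fun i j hij => hc (Fin.castSucc_le_castSucc_iff.mpr hij))
        (fun i => hc (Fin.le_last _)) fun s => ?_
      have h := hd s.castSucc
      rwa [← Fin.map_castSuccEmb_Iic, Finset.sum_map] at h
    calc ∑ i, c i * d i ≤ c (Fin.last k) * ∑ i, d i := by
          rw [Fin.sum_univ_castSucc, Fin.sum_univ_castSucc, mul_add]
          linarith
      _ ≤ m * ∑ i, d i := mul_le_mul_of_nonpos_right (hm _) htotal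

/-- Comparison of the sums of `f` along two sequences, the second one monotone, when `f` lies
strictly below its tangents in the variable `log`. -/
theorem sum_le_sum_and_eq_imp_of_lt_tangent {k : ℕ} {x y : Fin k → ℝ} {f c : ℝ → ℝ}
    (hx : ∀ i, 1 < x i) (hy : ∀ i, 1 < y i) (hymono : Monotone y)
    (hprod : ∀ s, ∏ i ∈ Finset.Iic s, x i ≤ ∏ i ∈ Finset.Iic s, y i)
    (hc : AntitoneOn c (Set.Ioi 1)) (hc0 : ∀ b, 1 < b → 0 ≤ c b)
    (hf : ∀ a b, 1 < a → 1 < b → a ≠ b → f a < f b + c b * (Real.log a - Real.log b)) :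
    ∑ i, f (x i) ≤ ∑ i, f (y i) ∧ (∑ i, f (x i) = ∑ i, f (y i) → ∀ i, x i = y i) := by
  have hle (i : Fin k) : f (x i) ≤ f (y i) + c (y i) * (Real.log (x i) - Real.log (y i)) := by
    rcases eq_or_ne (x i) (y i) with h | h
    · simp [h]
    · exact (hf _ _ (hx i) (hy i) h).le
  have habel : ∑ i, c (y i) * (Real.log (x i) - Real.log (y i)) ≤ 0 := by
    refine (sum_mul_le_mul_sum_of_antitone (m := 0)
      (fun i j hij => hc (hy i) (hy j) (hymono hij)) (fun i => hc0 _ (hy i))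
      fun s => ?_).trans_eq (zero_mul _)
    rw [Finset.sum_sub_distrib, ← Real.log_prod fun i _ => (zero_lt_one.trans (hx i)).ne',
      ← Real.log_prod fun i _ => (zero_lt_one.trans (hy i)).ne', sub_nonpos]
    exact Real.log_le_log (Finset.prod_pos fun i _ => zero_lt_one.trans (hx i)) (hprod s)
  have hsplit : ∑ i, (f (y i) + c (y i) * (Real.log (x i) - Real.log (y i)))
      ≤ ∑ i, f (y i) := by
    rw [Finset.sum_add_distrib]
    linarith
  refine ⟨(Finset.sum_le_sum fun i _ => hle i).trans hsplit, fun heq => ?_⟩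
  by_contra! h
  obtain ⟨i, hi⟩ := h
  exact ((Finset.sum_lt_sum (fun i _ => hle i)
    ⟨i, Finset.mem_univ i, hf _ _ (hx i) (hy i) hi⟩).trans_le hsplit).ne heq

theorem mul_log_lt_log_add {w t : ℝ} (hw0 : 0 < w) (hw1 : w < 1) (ht : 0 < t) (ht1 : t ≠ 1) :
    w * Real.log t < Real.log (w * t + (1 - w)) := by
  simpa using strictConcaveOn_log_Ioi.2 (Set.mem_Ioi.mpr ht) (Set.mem_Ioi.mpr one_pos) ht1 hw0
    (sub_pos.mpr hw1) (add_sub_cancel w 1)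

theorem log_one_sub_inv_lt_tangent {a b : ℝ} (ha : 1 < a) (hb : 1 < b) (hab : a ≠ b) :
    Real.log (1 - 1 / a) <
      Real.log (1 - 1 / b) + 1 / (b - 1) * (Real.log a - Real.log b) := by
  have ha0 : 0 < a := by linarith
  have hb0 : 0 < b := by linarith
  have ha1 : 0 < a - 1 := by linarith
  have hb1 : 0 < b - 1 := by linarith
  have h := mul_log_lt_log_add (w := (b - 1) / b) (t := (a - 1) / (b - 1)) (by positivity)
    ((div_lt_one hb0).mpr (by linarith)) (by positivity)
    (fun h => hab (by linarith [(div_eq_one_iff_eq hb1.ne').mp h]))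
  have e : (b - 1) / b * ((a - 1) / (b - 1)) + (1 - (b - 1) / b) = a / b := by
    field_simp
    ring
  rw [e, Real.log_div ha1.ne' hb1.ne', Real.log_div ha0.ne' hb0.ne'] at h
  rw [one_sub_div ha0.ne', one_sub_div hb0.ne', Real.log_div ha1.ne' ha0.ne',
    Real.log_div hb1.ne' hb0.ne']
  rw [div_mul_eq_mul_div, div_lt_iff₀ hb0] at h
  rw [one_div_mul_eq_div, ← sub_lt_iff_lt_add', lt_div_iff₀ hb1]
  linarith

theorem neg_log_one_add_inv_lt_tangent {a b : ℝ} (ha : 0 < a) (hb : 0 < b) (hab : a ≠ b) :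
    -Real.log (1 + 1 / a) <
      -Real.log (1 + 1 / b) + 1 / (b + 1) * (Real.log a - Real.log b) := by
  have ha1 : 0 < a + 1 := by linarith
  have hb1 : 0 < b + 1 := by linarith
  have h := mul_log_lt_log_add (w := b / (b + 1)) (t := a / b) (by positivity)
    ((div_lt_one hb1).mpr (by linarith)) (by positivity)
    (fun h => hab ((div_eq_one_iff_eq hb.ne').mp h))
  have e : b / (b + 1) * (a / b) + (1 - b / (b + 1)) = (a + 1) / (b + 1) := by
    field_simp
    ring
  rw [e, Real.log_div ha1.ne' hb1.ne', Real.log_div ha.ne' hb.ne'] at h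
  rw [one_add_div ha.ne', one_add_div hb.ne', Real.log_div ha1.ne' ha.ne',
    Real.log_div hb1.ne' hb.ne']
  rw [div_mul_eq_mul_div, div_lt_iff₀ hb1] at h
  rw [one_div_mul_eq_div, ← sub_lt_iff_lt_add', lt_div_iff₀ hb1]
  linarith

theorem amicable_tuples_stmt7 (k : ℕ) (x y : Fin k → ℝ)
    (hx1 : ∀ i, 1 < x i) (hxmono : Monotone x)
    (hy1 : ∀ i, 1 < y i) (hymono : Monotone y)
    (hprod : ∀ s : Fin k, ∏ i ∈ Finset.Iic s, x i ≤ ∏ i ∈ Finset.Iic s, y i) :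
    (∏ i, (1 - 1 / x i) ≤ ∏ i, (1 - 1 / y i)) ∧
    (∏ i, (1 + 1 / x i) ≥ ∏ i, (1 + 1 / y i)) ∧
    ((∏ i, (1 - 1 / x i) = ∏ i, (1 - 1 / y i)) ↔ ∀ i, x i = y i) ∧
    ((∏ i, (1 + 1 / x i) = ∏ i, (1 + 1 / y i)) ↔ ∀ i, x i = y i) := by
  have hsub {z : ℝ} (hz : 1 < z) : 0 < 1 - 1 / z :=
    sub_pos.mpr ((div_lt_one (zero_lt_one.trans hz)).mpr hz)
  have hadd {z : ℝ} (hz : 1 < z) : 0 < 1 + 1 / z := by positivity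
  obtain ⟨hle, heq⟩ := sum_le_sum_and_eq_imp_of_lt_tangent (f := fun z => Real.log (1 - 1 / z))
    (c := fun z => 1 / (z - 1)) hx1 hy1 hymono hprod
    (fun a ha b _ hab => one_div_le_one_div_of_le (sub_pos.mpr ha) (sub_le_sub_right hab 1))
    (fun b hb => one_div_nonneg.mpr (sub_pos.mpr hb).le)
    (fun a b ha hb hab => log_one_sub_inv_lt_tangent ha hb hab)
  obtain ⟨hle', heq'⟩ := sum_le_sum_and_eq_imp_of_lt_tangent
    (f := fun z => -Real.log (1 + 1 / z))
    (c := fun z => 1 / (z + 1)) hx1 hy1 hymono hprod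
    (fun a ha b _ hab => one_div_le_one_div_of_le
      (add_pos (zero_lt_one.trans ha) one_pos) (add_le_add_left hab 1))
    (fun b hb => by positivity)
    (fun a b ha hb hab =>
      neg_log_one_add_inv_lt_tangent (zero_lt_one.trans ha) (zero_lt_one.trans hb) hab)
  simp only [Finset.sum_neg_distrib, neg_le_neg_iff, neg_inj] at hle' heq'
  rw [← Real.log_prod fun i _ => (hsub (hx1 i)).ne',
    ← Real.log_prod fun i _ => (hsub (hy1 i)).ne'] at hle heq
  rw [← Real.log_prod fun i _ => (hadd (hx1 i)).ne',
    ← Real.log_prod fun i _ => (hadd (hy1 i)).ne'] at hle' heq'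
  refine ⟨(Real.log_le_log_iff (Finset.prod_pos fun i _ => hsub (hx1 i))
      (Finset.prod_pos fun i _ => hsub (hy1 i))).mp hle,
    (Real.log_le_log_iff (Finset.prod_pos fun i _ => hadd (hy1 i))
      (Finset.prod_pos fun i _ => hadd (hx1 i))).mp hle',
    ⟨fun h => heq (congrArg Real.log h), fun h => by simp only [h]⟩,
    ⟨fun h => heq' (congrArg Real.log h), fun h => by simp only [h]⟩⟩
end

section
/- Let k ≥ 1 and R ≥ 1 be integers, let m_1, …, m_R be integers with 1 < m_1 ≤ m_2 ≤ ⋯ ≤ m_R, let J_1, …, J_k be pairwise disjoint sets whose union is {1, …, R}, and let a_1, …, a_k, b_1, …, b_k ≥ 1 be integers with a_i ≥ b_i for all i. Suppose that ∑_{i=1}^{k} (b_i/a_i) · ∏_{j ∈ J_i} (1 − 1/m_j) ≤ 1 and ∑_{i=1}^{k} (b_i/a_i) · ∏_{j ∈ J_i, j ≤ R−1} (1 − 1/m_j) > 1. Then a · ∏_{j=1}^{R} m_j ≤ F_R(a + 1), where a = a_1 ⋯ a_k. -/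
/-- `F r x = x ^ (2 ^ r) - x ^ (2 ^ (r - 1))` for `r ≥ 1`, and `F 0 x = x - 1`. -/
noncomputable def F (r : ℕ) (x : ℝ) : ℝ :=
  if r = 0 then x - 1 else x ^ (2 ^ r) - x ^ (2 ^ (r - 1))

theorem mul_sum_range_succ_le_of_antitone {c d : ℕ → ℝ} (hc : Antitone c) (r : ℕ)
    (hd : ∀ t ≤ r, 0 ≤ ∑ j ∈ Finset.range t, d j) :
    c r * ∑ j ∈ Finset.range (r + 1), d j ≤ ∑ j ∈ Finset.range (r + 1), c j * d j := by
  induction r with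
  | zero => simp
  | succ r ih =>
    rw [Finset.sum_range_succ, Finset.sum_range_succ (fun j => c j * d j), mul_add]
    have h := ih fun t ht => hd t (ht.trans r.le_succ)
    have := mul_le_mul_of_nonneg_right (hc r.le_succ) (hd (r + 1) le_rfl)
    linarith

/-- The tangent line inequality for the concave function `t ↦ log (1 - exp (-t))`. -/
theorem log_one_sub_inv_le {q n : ℝ} (hq : 1 < q) (hn : 1 < n) :
    (q - 1)⁻¹ * (Real.log q - Real.log n) ≤ Real.log (1 - 1 / q) - Real.log (1 - 1 / n) := by
  have hq0 : 0 < q := by linarith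
  have hn0 : 0 < n := by linarith
  have hq1 : 0 < q - 1 := by linarith
  have hn1 : 0 < n - 1 := by linarith
  have e (x : ℝ) (hx : 0 < x) (hx1 : 0 < x - 1) :
      Real.log (1 - 1 / x) = Real.log (x - 1) - Real.log x := by
    rw [← Real.log_div hx1.ne' hx.ne']
    congr 1
    field_simp
  have hx : (n - 1) / (q - 1) ∈ Set.Ioi (0 : ℝ) := Set.mem_Ioi.2 (by positivity)
  have ha : 0 ≤ (q - 1) / q := by positivity
  have hb : 0 ≤ 1 / q := by positivity
  have h := strictConcaveOn_log_Ioi.concaveOn.2 hx (Set.mem_Ioi.2 one_pos) ha hb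
    (by field_simp; ring)
  have e1 : (q - 1) / q * ((n - 1) / (q - 1)) + 1 / q * 1 = n / q := by field_simp; ring
  simp only [smul_eq_mul, Real.log_one, mul_zero, add_zero] at h
  rw [e1, Real.log_div hn0.ne' hq0.ne', Real.log_div hn1.ne' hq1.ne', div_mul_eq_mul_div,
    div_le_iff₀ hq0] at h
  rw [e q hq0 hq1, e n hn0 hn1, inv_mul_le_iff₀ hq1]
  nlinarith

theorem prod_one_sub_inv_lt_of_prod_lt {q n : ℕ → ℝ} (hq : Monotone q) (hq1 : ∀ j, 1 < q j)
    (hn1 : ∀ j, 1 < n j) (r : ℕ)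
    (hle : ∀ t ≤ r, ∏ j ∈ Finset.range t, n j ≤ ∏ j ∈ Finset.range t, q j)
    (hlt : ∏ j ∈ Finset.range (r + 1), n j < ∏ j ∈ Finset.range (r + 1), q j) :
    ∏ j ∈ Finset.range (r + 1), (1 - 1 / n j) < ∏ j ∈ Finset.range (r + 1), (1 - 1 / q j) := by
  have pos {x : ℕ → ℝ} (hx : ∀ j, 1 < x j) (j : ℕ) : 0 < x j := one_pos.trans (hx j)
  have pos' {x : ℕ → ℝ} (hx : ∀ j, 1 < x j) (j : ℕ) : 0 < 1 - 1 / x j := by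
    rw [sub_pos, div_lt_one (pos hx j)]
    exact hx j
  have logs {x y : ℕ → ℝ} (hx : ∀ j, 0 < x j) (hy : ∀ j, 0 < y j) (t : ℕ) :
      ∑ j ∈ Finset.range t, (Real.log (y j) - Real.log (x j)) =
        Real.log (∏ j ∈ Finset.range t, y j) - Real.log (∏ j ∈ Finset.range t, x j) := by
    rw [Finset.sum_sub_distrib, Real.log_prod fun j _ => (hx j).ne',
      Real.log_prod fun j _ => (hy j).ne']
  have hc : Antitone fun j => (q j - 1)⁻¹ := fun i j hij =>
    inv_anti₀ (sub_pos.2 (hq1 i)) (sub_le_sub_right (hq hij) 1)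
  have h := mul_sum_range_succ_le_of_antitone
    (d := fun j => Real.log (q j) - Real.log (n j)) hc r fun t ht => by
      rw [logs (pos hn1) (pos hq1), sub_nonneg]
      exact Real.log_le_log (Finset.prod_pos fun j _ => pos hn1 j) (hle t ht)
  have h' := Finset.sum_le_sum fun j (_ : j ∈ Finset.range (r + 1)) =>
    log_one_sub_inv_le (hq1 j) (hn1 j)
  have hpos : 0 < (q r - 1)⁻¹ *
      ∑ j ∈ Finset.range (r + 1), (Real.log (q j) - Real.log (n j)) := by
    refine mul_pos (inv_pos.2 (sub_pos.2 (hq1 r))) ?_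
    rw [logs (pos hn1) (pos hq1), sub_pos]
    exact Real.log_lt_log (Finset.prod_pos fun j _ => pos hn1 j) hlt
  rw [logs (pos' hn1) (pos' hq1)] at h'
  exact (Real.log_lt_log_iff (Finset.prod_pos fun j _ => pos' hn1 j)
    (Finset.prod_pos fun j _ => pos' hq1 j)).1 (by linarith)

theorem mul_prod_pow_two_pow_add_one (c : ℝ) (t : ℕ) :
    (c - 1) * ∏ j ∈ Finset.range t, (c ^ 2 ^ j + 1) = c ^ 2 ^ t - 1 := by
  induction t with
  | zero => simp
  | succ t ih =>
    rw [Finset.prod_range_succ, ← mul_assoc, ih, pow_succ, pow_mul]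
    ring

theorem mul_prod_one_sub_inv_pow_two_pow_add_one {c : ℝ} (hc : 0 < c) (t : ℕ) :
    c * (c ^ 2 ^ t - 1) * ∏ j ∈ Finset.range t, (1 - 1 / (c ^ 2 ^ j + 1)) =
      (c - 1) * c ^ 2 ^ t := by
  induction t with
  | zero => simp; ring
  | succ t ih =>
    have hp : 0 < c ^ 2 ^ t := by positivity
    rw [Finset.prod_range_succ, pow_succ, pow_mul]
    have e : c * ((c ^ 2 ^ t) ^ 2 - 1) * ((∏ j ∈ Finset.range t, (1 - 1 / (c ^ 2 ^ j + 1))) *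
        (1 - 1 / (c ^ 2 ^ t + 1))) =
        (c * (c ^ 2 ^ t - 1) * ∏ j ∈ Finset.range t, (1 - 1 / (c ^ 2 ^ j + 1))) *
          c ^ 2 ^ t := by
      field_simp
      ring
    rw [e, ih]
    ring

theorem div_lt_prod_one_sub_inv {A : ℝ} (hA : 0 < A) {q : ℕ → ℝ} (hq : Monotone q)
    (hq1 : ∀ j, 1 < q j) (r : ℕ)
    (hle : ∀ t ≤ r, (A + 1) ^ 2 ^ t ≤ A * ∏ j ∈ Finset.range t, q j + 1)
    (hlt : (A + 1) ^ 2 ^ (r + 1) - (A + 1) ^ 2 ^ r < A * ∏ j ∈ Finset.range (r + 1), q j) :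
    A / (A + 1) < ∏ j ∈ Finset.range (r + 1), (1 - 1 / q j) := by
  set c := A + 1 with hc
  have hc1 : 1 < c := by linarith
  have hc0 : 0 < c := by linarith
  have hcp (j : ℕ) : 1 < c ^ 2 ^ j := one_lt_pow₀ hc1 (by positivity)
  set n : ℕ → ℝ := fun j => if j < r then c ^ 2 ^ j + 1 else c ^ 2 ^ j with hn
  have hnlt (j : ℕ) (hj : j < r) : n j = c ^ 2 ^ j + 1 := if_pos hj
  have hnr : n r = c ^ 2 ^ r := if_neg (lt_irrefl r)
  have hn1 (j : ℕ) : 1 < n j := by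
    have := hcp j
    simp only [hn]
    split_ifs <;> linarith
  have hprod (t : ℕ) (ht : t ≤ r) : A * ∏ j ∈ Finset.range t, n j = c ^ 2 ^ t - 1 := by
    rw [← mul_prod_pow_two_pow_add_one, hc, add_sub_cancel_right]
    congr 1
    exact Finset.prod_congr rfl fun j hj => hnlt j ((Finset.mem_range.1 hj).trans_le ht)
  have hdefect : ∏ j ∈ Finset.range (r + 1), (1 - 1 / n j) = A / c := by
    have h := mul_prod_one_sub_inv_pow_two_pow_add_one hc0 r
    rw [show c - 1 = A by rw [hc]; ring] at h
    rw [Finset.prod_range_succ, hnr, Finset.prod_congr rfl fun j hj => by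
      rw [hnlt j (Finset.mem_range.1 hj)]]
    generalize ∏ j ∈ Finset.range r, (1 - 1 / (c ^ 2 ^ j + 1)) = p at h ⊢
    have : c ^ 2 ^ r ≠ 0 := by positivity
    field_simp
    linarith
  rw [← hdefect]
  refine prod_one_sub_inv_lt_of_prod_lt hq hq1 hn1 r (fun t ht => ?_) ?_
  · have := hle t ht
    have := hprod t ht
    exact le_of_mul_le_mul_left (by linarith) hA
  · refine lt_of_mul_lt_mul_left ?_ hA.le
    rw [Finset.prod_range_succ, ← mul_assoc, hprod r le_rfl, hnr]
    refine lt_of_eq_of_lt ?_ hlt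
    rw [pow_succ, pow_mul]
    ring

theorem mul_prod_le_of_prod_one_sub_inv_le {A : ℝ} (hA : 0 < A) {q : ℕ → ℝ} (hq : Monotone q)
    (hq1 : ∀ j, 1 < q j) (r : ℕ)
    (h : ∀ s ≤ r, (A * ∏ j ∈ Finset.range s, q j + 1) *
      ∏ j ∈ Finset.Ico s (r + 1), (1 - 1 / q j) ≤ A * ∏ j ∈ Finset.range s, q j) :
    A * ∏ j ∈ Finset.range (r + 1), q j ≤ (A + 1) ^ 2 ^ (r + 1) - (A + 1) ^ 2 ^ r := by
  by_contra! hlt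
  classical
  let S := (Finset.range (r + 1)).filter fun s =>
    A * ∏ j ∈ Finset.range s, q j + 1 ≤ (A + 1) ^ 2 ^ s
  obtain ⟨s, hs, hmax⟩ := S.exists_max_image id ⟨0, by simp [S]⟩
  obtain ⟨hsr, hsle⟩ : s < r + 1 ∧ A * ∏ j ∈ Finset.range s, q j + 1 ≤ (A + 1) ^ 2 ^ s := by
    simpa [S] using hs
  obtain ⟨u, rfl⟩ := Nat.exists_eq_add_of_le (Nat.le_of_lt_succ hsr)
  set B := A * ∏ j ∈ Finset.range s, q j with hB
  have hB0 : 0 < B := mul_pos hA (Finset.prod_pos fun j _ => one_pos.trans (hq1 j))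
  have hsplit (t : ℕ) :
      B * ∏ j ∈ Finset.range t, q (s + j) = A * ∏ j ∈ Finset.range (s + t), q j := by
    rw [Finset.prod_range_add, hB, mul_assoc]
  have hpow (t : ℕ) : (B + 1) ^ 2 ^ t ≤ (A + 1) ^ 2 ^ (s + t) := by
    rw [pow_add 2, pow_mul]
    exact pow_le_pow_left₀ (by linarith) hsle _
  have key := div_lt_prod_one_sub_inv hB0 (q := fun j => q (s + j))
    (fun i j hij => hq (Nat.add_le_add_left hij s)) (fun j => hq1 _) u (fun t ht => ?_) ?_
  · have := h s (by omega)
    rw [Finset.prod_Ico_eq_prod_range, show s + u + 1 - s = u + 1 by omega] at this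
    rw [div_lt_iff₀ (by linarith)] at key
    linarith
  · rcases t.eq_zero_or_pos with rfl | ht0
    · simp
    · rw [hsplit]
      refine (hpow t).trans ?_
      by_contra! hcon
      have := hmax (s + t) (by simp only [S, Finset.mem_filter, Finset.mem_range];
                               exact ⟨by omega, hcon.le⟩)
      simp only [id] at this
      omega
  · rw [hsplit]
    refine lt_of_le_of_lt ?_ hlt
    have hfac (x : ℝ) (v : ℕ) : x ^ 2 ^ (v + 1) - x ^ 2 ^ v = x ^ 2 ^ v * (x ^ 2 ^ v - 1) := by
      rw [pow_succ 2, pow_mul]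
      ring
    rw [hfac, hfac]
    have h1 : 1 ≤ (B + 1) ^ 2 ^ u := one_le_pow₀ (by linarith)
    have := hpow u
    exact mul_le_mul this (by linarith) (by linarith) (by linarith)

theorem exists_int_mul_prod_one_sub_inv {ι : Type*} [DecidableEq ι] (m : ι → ℕ)
    (hm : ∀ j, m j ≠ 0) {T S : Finset ι} (hTS : T ⊆ S) :
    ∃ z : ℤ, (∏ j ∈ S, (m j : ℝ)) * ∏ j ∈ T, (1 - 1 / (m j : ℝ)) = z := by
  refine ⟨(∏ j ∈ S \ T, (m j : ℤ)) * ∏ j ∈ T, ((m j : ℤ) - 1), ?_⟩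
  push_cast
  rw [← Finset.prod_sdiff hTS, mul_assoc, ← Finset.prod_mul_distrib]
  congr 1
  refine Finset.prod_congr rfl fun j _ => ?_
  have : (m j : ℝ) ≠ 0 := Nat.cast_ne_zero.2 (hm j)
  field_simp

theorem exists_int_mul_sum_div_mul_prod {κ ι : Type*} [Fintype κ] [DecidableEq κ] [DecidableEq ι]
    (a b : κ → ℕ) (ha : ∀ i, a i ≠ 0) (m : ι → ℕ) (hm : ∀ j, m j ≠ 0)
    {T : κ → Finset ι} {S : Finset ι} (hTS : ∀ i, T i ⊆ S) :
    ∃ z : ℤ, ((∏ i, a i : ℕ) : ℝ) * (∏ j ∈ S, (m j : ℝ)) *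
      ∑ i, (b i : ℝ) / (a i : ℝ) * ∏ j ∈ T i, (1 - 1 / (m j : ℝ)) = z := by
  choose z hz using fun i => exists_int_mul_prod_one_sub_inv m hm (hTS i)
  refine ⟨∑ i, (∏ i' ∈ Finset.univ.erase i, (a i' : ℤ)) * b i * z i, ?_⟩
  push_cast
  rw [Finset.mul_sum]
  refine Finset.sum_congr rfl fun i _ => ?_
  rw [← hz i, ← Finset.mul_prod_erase _ _ (Finset.mem_univ i)]
  have : (a i : ℝ) ≠ 0 := Nat.cast_ne_zero.2 (ha i)
  field_simp

theorem amicable_tuples_stmt8 (k R : ℕ) (hk : 1 ≤ k) (hR : 1 ≤ R)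
    (m : Fin R → ℕ) (hm : ∀ j, 1 < m j) (hmono : Monotone m)
    (J : Fin k → Finset (Fin R))
    (hdisj : ∀ i i', i ≠ i' → Disjoint (J i) (J i'))
    (hunion : Finset.univ.biUnion J = Finset.univ)
    (a b : Fin k → ℕ) (ha : ∀ i, 1 ≤ a i) (hb : ∀ i, 1 ≤ b i) (hba : ∀ i, b i ≤ a i)
    (hA : ∑ i, (b i : ℝ) / (a i : ℝ) * ∏ j ∈ J i, (1 - 1 / (m j : ℝ)) ≤ 1)
    (hB : ∑ i, (b i : ℝ) / (a i : ℝ) *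
        ∏ j ∈ (J i).filter (fun j => j.val + 1 < R), (1 - 1 / (m j : ℝ)) > 1) :
    ((∏ i, a i : ℕ) : ℝ) * ∏ j, (m j : ℝ) ≤ F R (((∏ i, a i : ℕ) : ℝ) + 1) := by
  obtain ⟨r, rfl⟩ := Nat.exists_eq_add_of_le' hR
  have hw (j : Fin (r + 1)) : 0 < 1 - 1 / (m j : ℝ) ∧ 1 - 1 / (m j : ℝ) ≤ 1 := by
    have : (1 : ℝ) < m j := by exact_mod_cast hm j
    have h0 : (0 : ℝ) < m j := by linarith
    refine ⟨?_, ?_⟩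
    · rw [sub_pos, div_lt_one h0]
      exact this
    · rw [sub_le_self_iff]
      positivity
  have hanti {T S : Finset (Fin (r + 1))} (h : T ⊆ S) :
      ∏ j ∈ S, (1 - 1 / (m j : ℝ)) ≤ ∏ j ∈ T, (1 - 1 / (m j : ℝ)) :=
    Finset.prod_le_prod_of_subset_of_le_one h (fun j _ => (hw j).1.le) fun j _ _ => (hw j).2
  have ha0 : 0 < ∏ i, a i := Finset.prod_pos fun i _ => ha i
  set q : ℕ → ℝ := fun j => m ⟨min j r, by omega⟩ with hq
  have hqm (j : Fin (r + 1)) : q j = m j := by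
    simp only [hq]
    congr 2
    exact Fin.ext (min_eq_left (by omega))
  have hqmono : Monotone q := fun i j hij =>
    Nat.cast_le.2 (hmono (Fin.mk_le_mk.2 (min_le_min_right r hij)))
  have hq1 (j : ℕ) : 1 < q j := Nat.one_lt_cast.2 (hm _)
  have hprod (p : ℕ → Prop) [DecidablePred p] (g : ℕ → ℝ) :
      ∏ j ∈ (Finset.range (r + 1)).filter p, g j =
        ∏ j : Fin (r + 1) with p j.val, g j.val := by
    rw [Finset.prod_filter, Finset.prod_filter, Finset.prod_range]
  simp only [← hqm]
  rw [← Finset.prod_range, F, if_neg r.succ_ne_zero, Nat.add_sub_cancel]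
  refine mul_prod_le_of_prod_one_sub_inv_le (Nat.cast_pos.2 ha0) hqmono hq1 r fun s hs => ?_
  have e1 : ∏ j ∈ Finset.range s, q j = ∏ j : Fin (r + 1) with j.val < s, (m j : ℝ) := by
    simp only [← hqm]
    rw [← hprod (· < s)]
    congr 1
    ext j
    simp
    omega
  have e2 : ∏ j ∈ Finset.Ico s (r + 1), (1 - 1 / q j) =
      ∏ j : Fin (r + 1) with ¬ j.val < s, (1 - 1 / (m j : ℝ)) := by
    simp only [← hqm]
    rw [← hprod (fun j => ¬ j < s) fun j => 1 - 1 / q j]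
    congr 1
    ext j
    simp
    omega
  rw [e1, e2]
  set Q := ∏ j : Fin (r + 1) with ¬ j.val < s, (1 - 1 / (m j : ℝ)) with hQ
  have hQ0 : 0 < Q := Finset.prod_pos fun j _ => (hw j).1
  set f := ∑ i, (b i : ℝ) / (a i : ℝ) * ∏ j ∈ J i with j.val < s, (1 - 1 / (m j : ℝ)) with hf
  have hf1 : 1 < f := hB.trans_le <| Finset.sum_le_sum fun i _ =>
    mul_le_mul_of_nonneg_left (hanti (Finset.monotone_filter_right _ fun j _ hj => by
      have : j.val < s := hj
      omega)) (by positivity)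
  have hfQ : f * Q ≤ 1 := by
    refine le_trans ?_ hA
    rw [hf, Finset.sum_mul]
    refine Finset.sum_le_sum fun i _ => ?_
    rw [mul_assoc, ← Finset.prod_filter_mul_prod_filter_not (J i) (fun j => j.val < s)]
    refine mul_le_mul_of_nonneg_left (mul_le_mul_of_nonneg_left
      (hanti (Finset.filter_subset_filter _ (Finset.subset_univ _)))
      (Finset.prod_nonneg fun j _ => (hw j).1.le)) (by positivity)
  have hP0 : 0 < ∏ j : Fin (r + 1) with j.val < s, m j :=
    Finset.prod_pos fun j _ => zero_lt_one.trans (hm j)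
  obtain ⟨z, hz⟩ := exists_int_mul_sum_div_mul_prod a b (fun i => Nat.one_le_iff_ne_zero.1 (ha i)) m
    (fun j => (zero_lt_one.trans (hm j)).ne') (T := fun i => (J i).filter fun j => j.val < s)
    (S := Finset.univ.filter fun j => j.val < s)
    fun i => Finset.filter_subset_filter _ (Finset.subset_univ _)
  rw [← Nat.cast_prod, ← Nat.cast_mul, ← hf] at hz
  rw [← Nat.cast_prod, ← Nat.cast_mul]
  have hpos := Nat.mul_pos ha0 hP0
  generalize (∏ i, a i) * ∏ j : Fin (r + 1) with j.val < s, m j = N at hz hpos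
  have hN : (0 : ℝ) < N := Nat.cast_pos.2 hpos
  have hzN : ((N : ℤ) : ℝ) < z := by
    rw [← hz, Int.cast_natCast]
    exact lt_mul_of_one_lt_right hN hf1
  have hz1 : (N : ℝ) + 1 ≤ N * f := by
    rw [hz]
    exact_mod_cast Int.add_one_le_of_lt (Int.cast_lt.1 hzN)
  calc ((N : ℝ) + 1) * Q ≤ N * f * Q := mul_le_mul_of_nonneg_right hz1 hQ0.le
    _ = N * (f * Q) := mul_assoc _ _ _
    _ ≤ N := mul_le_of_le_one_right hN.le hfQ
end

section
/- Let k ≥ 1 and R ≥ 1 be integers, let m_1, …, m_R be integers with 1 < m_1 ≤ m_2 ≤ ⋯ ≤ m_R, let J_1, …, J_k be pairwise disjoint sets whose union is {1, …, R}, and let a_1, …, a_k, b_1, …, b_k ≥ 1 be integers. Suppose that ∑_{i=1}^{k} (b_i/a_i) · ∏_{j ∈ J_i} (1 − 1/m_j)^{−1} ≥ 1 and ∑_{i=1}^{k} (b_i/a_i) · ∏_{j ∈ J_i, j ≤ R−1} (1 − 1/m_j)^{−1} < 1. Then a · ∏_{j=1}^{R} (m_j − 1) ≤ F_R(a), where a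 = a_1 ⋯ a_k. -/
open Finset in
/-- Abel's inequality: if the partial sums of `d` before the last one are nonnegative and `c` is
antitone, then `∑ c j * d j` is at least the last weight times the full sum of `d`. -/
theorem mul_sum_le_sum_mul_of_antitone {c d : ℕ → ℝ} (hc : Antitone c) (t : ℕ)
    (hd : ∀ s ≤ t, 0 ≤ ∑ j ∈ range s, d j) :
    c t * ∑ j ∈ range (t + 1), d j ≤ ∑ j ∈ range (t + 1), c j * d j := by
  induction t with
  | zero => simp
  | succ t ih =>
    have h1 := ih fun s hs => hd s (by omega)
    have h2 := mul_le_mul_of_nonneg_right (hc (Nat.le_succ t)) (hd (t + 1) le_rfl)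
    rw [sum_range_succ _ (t + 1), sum_range_succ _ (t + 1), mul_add]
    simp only [Nat.succ_eq_add_one] at h2
    linarith

/-- The tangent line inequality for the convex function `u ↦ log (1 + exp (-u))`. -/
theorem log_one_add_inv_tangent {x y : ℝ} (hx : 0 < x) (hy : 0 < y) :
    1 / (x + 1) * (Real.log x - Real.log y) ≤ Real.log (1 + 1 / y) - Real.log (1 + 1 / x) := by
  have hconc := strictConcaveOn_log_Ioi.concaveOn.2
    (show y / x ∈ Set.Ioi 0 from div_pos hy hx) (Set.mem_Ioi.2 one_pos)
    (show 0 ≤ x / (x + 1) by positivity) (show 0 ≤ 1 / (x + 1) by positivity)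
    (by field_simp)
  have hmean : (x / (x + 1)) • (y / x) + (1 / (x + 1)) • (1 : ℝ) = (y + 1) / (x + 1) := by
    simp only [smul_eq_mul]
    field_simp
  rw [hmean, Real.log_div hy.ne' hx.ne', Real.log_div (by positivity) (by positivity),
    Real.log_one, smul_zero, add_zero, smul_eq_mul] at hconc
  have hx1 : 1 + 1 / x = (x + 1) / x := by field_simp
  have hy1 : 1 + 1 / y = (y + 1) / y := by field_simp
  rw [hx1, hy1, Real.log_div (by positivity) hx.ne', Real.log_div (by positivity) hy.ne']
  have hw : x / (x + 1) = 1 - 1 / (x + 1) := by field_simp; ring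
  rw [hw] at hconc
  linarith

open Finset in
/-- If `n` is monotone and its partial products dominate those of `y`, strictly for the last one,
then `∏ (1 + 1 / n j) < ∏ (1 + 1 / y j)`. -/
theorem prod_one_add_inv_lt_of_prod_le {n y : ℕ → ℝ} (hn : ∀ j, 0 < n j) (hy : ∀ j, 0 < y j)
    (hmono : Monotone n) (t : ℕ)
    (hle : ∀ s ≤ t, ∏ j ∈ range s, y j ≤ ∏ j ∈ range s, n j)
    (hlt : ∏ j ∈ range (t + 1), y j < ∏ j ∈ range (t + 1), n j) :
    ∏ j ∈ range (t + 1), (1 + 1 / n j) < ∏ j ∈ range (t + 1), (1 + 1 / y j) := by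
  have hsum : ∀ s, ∑ j ∈ range s, (Real.log (n j) - Real.log (y j))
      = Real.log (∏ j ∈ range s, n j) - Real.log (∏ j ∈ range s, y j) := fun s => by
    rw [sum_sub_distrib, Real.log_prod fun j _ => (hn j).ne', Real.log_prod fun j _ => (hy j).ne']
  have hn1 : ∀ j, 0 < 1 + 1 / n j := fun j => by have := hn j; positivity
  have hy1 : ∀ j, 0 < 1 + 1 / y j := fun j => by have := hy j; positivity
  have hanti : Antitone fun j => 1 / (n j + 1) := fun i j hij =>
    one_div_le_one_div_of_le (by linarith [hn i]) (by linarith [hmono hij])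
  have habel := mul_sum_le_sum_mul_of_antitone (d := fun j => Real.log (n j) - Real.log (y j))
    hanti t fun s hs => by
      rw [hsum]
      exact sub_nonneg.2 (Real.log_le_log (prod_pos fun j _ => hy j) (hle s hs))
  have hpos : 0 < 1 / (n t + 1) * ∑ j ∈ range (t + 1), (Real.log (n j) - Real.log (y j)) := by
    rw [hsum]
    have := hn t
    have := Real.log_lt_log (prod_pos fun j _ => hy j) hlt
    exact mul_pos (by positivity) (by linarith)
  have htan := sum_le_sum fun j (_ : j ∈ range (t + 1)) => log_one_add_inv_tangent (hn j) (hy j)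
  rw [sum_sub_distrib, ← Real.log_prod fun j _ => (hy1 j).ne',
    ← Real.log_prod fun j _ => (hn1 j).ne'] at htan
  exact (Real.log_lt_log_iff (prod_pos fun j _ => hn1 j) (prod_pos fun j _ => hy1 j)).1
    (by linarith)

open Finset in
/-- The extremal sequence for `mul_prod_one_add_inv_lt_one` is `A, A ^ 2, …, A ^ 2 ^ (t - 1),
A ^ 2 ^ t - 1`. -/
theorem mul_prod_one_add_inv_lt_one {n : ℕ → ℝ} (hn : ∀ j, 0 < n j) (hmono : Monotone n)
    {A : ℝ} (hA : 1 ≤ A) (t : ℕ)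
    (hle : ∀ s ≤ t, A ^ 2 ^ s ≤ A * ∏ j ∈ range s, n j)
    (hlt : A ^ 2 ^ (t + 1) - A ^ 2 ^ t < A * ∏ j ∈ range (t + 1), n j) :
    (1 - 1 / A) * ∏ j ∈ range (t + 1), (1 + 1 / n j) < 1 := by
  rcases hA.eq_or_lt with rfl | hA
  · simp
  have hA0 : 0 < A := by linarith
  have hpow : ∀ s, 1 < A ^ 2 ^ s := fun s => one_lt_pow₀ hA (by positivity)
  let y : ℕ → ℝ := fun j => if j < t then A ^ 2 ^ j else A ^ 2 ^ t - 1
  have hy : ∀ j, 0 < y j := fun j => by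
    dsimp only [y]
    split_ifs
    · linarith [hpow j]
    · linarith [hpow t]
  have hyprod : ∀ s ≤ t, A * ∏ j ∈ range s, y j = A ^ 2 ^ s := fun s hs => by
    induction s with
    | zero => simp
    | succ s ih =>
      rw [prod_range_succ, ← mul_assoc, ih (by omega), show y s = A ^ 2 ^ s from if_pos hs]
      ring
  have hyinv : ∀ s ≤ t, (1 - 1 / A) * ∏ j ∈ range s, (1 + 1 / y j) = 1 - 1 / A ^ 2 ^ s :=
    fun s hs => by
      induction s with
      | zero => simp
      | succ s ih =>
        rw [prod_range_succ, ← mul_assoc, ih (by omega), show y s = A ^ 2 ^ s from if_pos hs,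
          pow_succ 2 s, pow_mul]
        have := hpow s
        field_simp
        ring
  have hyt : y t = A ^ 2 ^ t - 1 := if_neg (lt_irrefl t)
  have hextr : (1 - 1 / A) * ∏ j ∈ range (t + 1), (1 + 1 / y j) = 1 := by
    rw [prod_range_succ, ← mul_assoc, hyinv t le_rfl, hyt]
    have h1 := hpow t
    have h2 : A ^ 2 ^ t - 1 ≠ 0 := by linarith
    field_simp
    ring
  have hcomp := prod_one_add_inv_lt_of_prod_le hn hy hmono t
    (fun s hs => le_of_mul_le_mul_left ((hyprod s hs).trans_le (hle s hs)) hA0)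
    (lt_of_mul_lt_mul_left (a := A) (by
      rw [prod_range_succ, ← mul_assoc, hyprod t le_rfl, hyt]
      refine lt_of_eq_of_lt ?_ hlt
      ring) hA0.le)
  refine (mul_lt_mul_of_pos_left hcomp ?_).trans_eq hextr
  rw [sub_pos, div_lt_one hA0]
  exact hA

open Finset in
/-- A sum of fractions that is less than `1` is at most `1` minus the inverse of the product of
the denominators. -/
theorem sum_div_le_one_sub_inv_prod {ι : Type*} [Fintype ι] [DecidableEq ι] {α β : ι → ℕ}
    (hα : ∀ i, 0 < α i) (h : ∑ i, (β i : ℝ) / α i < 1) :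
    ∑ i, (β i : ℝ) / α i ≤ 1 - 1 / ∏ i, (α i : ℝ) := by
  have hα' : ∀ i, (0 : ℝ) < α i := fun i => Nat.cast_pos.2 (hα i)
  have hP : 0 < ∏ i, (α i : ℝ) := prod_pos fun i _ => hα' i
  have hint : (∏ i, (α i : ℝ)) * ∑ i, (β i : ℝ) / α i
      = ((∑ i, β i * ∏ i' ∈ univ.erase i, α i' : ℕ) : ℝ) := by
    push_cast
    rw [mul_sum]
    refine sum_congr rfl fun i _ => ?_
    rw [← mul_prod_erase univ _ (mem_univ i)]
    have := hα' i
    field_simp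
  have hlt : (∏ i, (α i : ℝ)) * ∑ i, (β i : ℝ) / α i < ∏ i, (α i : ℝ) := by
    simpa using mul_lt_mul_of_pos_left h hP
  have hle : (∏ i, (α i : ℝ)) * ∑ i, (β i : ℝ) / α i + 1 ≤ ∏ i, (α i : ℝ) := by
    rw [hint] at hlt ⊢
    exact_mod_cast hlt
  rw [le_sub_iff_add_le, ← mul_le_mul_iff_right₀ hP, mul_add, mul_one_div_cancel hP.ne', mul_one]
  exact hle

theorem inv_one_sub_inv_natCast {m : ℕ} (hm : 1 < m) :
    (1 - 1 / (m : ℝ))⁻¹ = (m : ℝ) / ((m - 1 : ℕ) : ℝ) := by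
  have h : (1 : ℝ) < m := by exact_mod_cast hm
  have h' : (m : ℝ) - 1 ≠ 0 := by linarith
  rw [Nat.cast_sub hm.le, Nat.cast_one]
  field_simp

theorem F_succ_le_F_succ_add {A x : ℝ} (hA : 1 ≤ A) (t l : ℕ) (h : A ≤ x ^ 2 ^ l) :
    A ^ 2 ^ (t + 1) - A ^ 2 ^ t ≤ F (t + 1 + l) x := by
  have h1 : 1 ≤ A ^ 2 ^ t := one_le_pow₀ hA
  have h2 : A ^ 2 ^ t ≤ (x ^ 2 ^ l) ^ 2 ^ t := pow_le_pow_left₀ (by linarith) h _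
  have hF : F (t + 1 + l) x = ((x ^ 2 ^ l) ^ 2 ^ t) ^ 2 - (x ^ 2 ^ l) ^ 2 ^ t := by
    rw [F, if_neg (by omega), show t + 1 + l - 1 = l + t by omega]
    congr 1
    · rw [← pow_mul, ← pow_mul]
      congr 1
      ring
    · rw [← pow_mul, pow_add]
  rw [hF, pow_succ 2 t, pow_mul]
  nlinarith

open Finset in
theorem prod_filter_lt_eq_prod_range {R : ℕ} (f : ℕ → ℝ) {l : ℕ} (hl : l ≤ R) :
    ∏ j : Fin R with j.val < l, f j = ∏ j ∈ range l, f j := by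
  refine prod_nbij (fun j => j.val) (by simp) (fun i _ j _ h => Fin.ext h) ?_ (by simp)
  intro j hj
  have hj' : j < l := by simpa using hj
  exact ⟨⟨j, by omega⟩, by simpa using hj', rfl⟩

theorem amicable_tuples_stmt9 (k R : ℕ) (hk : 1 ≤ k) (hR : 1 ≤ R)
    (m : Fin R → ℕ) (hm : ∀ j, 1 < m j) (hmono : Monotone m)
    (J : Fin k → Finset (Fin R))
    (hdisj : ∀ i i', i ≠ i' → Disjoint (J i) (J i'))
    (hunion : Finset.univ.biUnion J = Finset.univ)
    (a b : Fin k → ℕ) (ha : ∀ i, 1 ≤ a i) (hb : ∀ i, 1 ≤ b i)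
    (hA : ∑ i, (b i : ℝ) / (a i : ℝ) * ∏ j ∈ J i, (1 - 1 / (m j : ℝ))⁻¹ ≥ 1)
    (hB : ∑ i, (b i : ℝ) / (a i : ℝ) *
        ∏ j ∈ (J i).filter (fun j => j.val + 1 < R), (1 - 1 / (m j : ℝ))⁻¹ < 1) :
    ((∏ i, a i : ℕ) : ℝ) * ∏ j, ((m j : ℝ) - 1) ≤ F R ((∏ i, a i : ℕ) : ℝ) := by
  classical
  let N : ℕ → ℝ := fun j => (m ⟨min j (R - 1), by omega⟩ : ℝ) - 1
  have hN : ∀ j : Fin R, N j = (m j : ℝ) - 1 := fun j => by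
    have : (⟨min j.val (R - 1), by omega⟩ : Fin R) = j := Fin.ext (by simp; omega)
    simp only [N, this]
  have hNge : ∀ j, 1 ≤ N j := fun j => by
    have : ((1 + 1 : ℕ) : ℝ) ≤ m ⟨min j (R - 1), by omega⟩ := Nat.cast_le.2 (hm _)
    push_cast at this
    simp only [N]
    linarith
  have hNpos : ∀ j, 0 < N j := fun j => one_pos.trans_le (hNge j)
  have hNmono : Monotone N := fun i j hij => by
    have : m ⟨min i (R - 1), by omega⟩ ≤ m ⟨min j (R - 1), by omega⟩ :=
      hmono (Fin.mk_le_mk.2 (by omega))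
    simpa only [N, sub_le_sub_iff_right, Nat.cast_le] using this
  have hg : ∀ j : Fin R, (1 - 1 / (m j : ℝ))⁻¹ = 1 + 1 / N j := fun j => by
    have h0 := hNpos j
    rw [hN] at h0 ⊢
    have hm0 : (m j : ℝ) ≠ 0 := by linarith
    have hm1 : (m j : ℝ) - 1 ≠ 0 := h0.ne'
    field_simp
    ring
  have hg1 : ∀ j, 1 ≤ 1 + 1 / N j := fun j => by
    have := hNpos j
    have : 0 ≤ 1 / N j := by positivity
    linarith
  set x : ℝ := ((∏ i, a i : ℕ) : ℝ) with hx
  have hx1 : 1 ≤ x := by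
    rw [hx]
    exact_mod_cast Nat.succ_le_of_lt (Finset.prod_pos fun i _ => ha i)
  have hfull : ∏ j, ((m j : ℝ) - 1) = ∏ j ∈ Finset.range R, N j := by
    rw [← Fin.prod_univ_eq_prod_range]
    exact Finset.prod_congr rfl fun j _ => (hN j).symm
  -- the last index below `R` at which the partial product does not exceed its target
  obtain ⟨l, hlR, hl, hmax⟩ : ∃ l < R, x * ∏ j ∈ Finset.range l, N j ≤ x ^ 2 ^ l ∧
      ∀ s, l < s → s < R → x ^ 2 ^ s < x * ∏ j ∈ Finset.range s, N j := by
    let p : ℕ → Prop := fun l => x * ∏ j ∈ Finset.range l, N j ≤ x ^ 2 ^ l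
    have hp0 : p 0 := by simp [p]
    have hspec : p (Nat.findGreatest p (R - 1)) := Nat.findGreatest_spec (Nat.zero_le _) hp0
    have hle := Nat.findGreatest_le (P := p) (R - 1)
    refine ⟨Nat.findGreatest p (R - 1), by omega, hspec, fun s hs hsR => ?_⟩
    exact not_le.1 (Nat.findGreatest_is_greatest hs (by omega))
  obtain ⟨t, rfl⟩ : ∃ t, R = t + 1 + l := ⟨R - l - 1, by omega⟩
  set A : ℝ := x * ∏ j ∈ Finset.range l, N j with hAdef
  have hA1 : 1 ≤ A := one_le_mul_of_one_le_of_one_le hx1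
    (Finset.one_le_prod fun j _ => hNge j)
  have hsplit : ∀ s, x * ∏ j ∈ Finset.range (l + s), N j
      = A * ∏ j ∈ Finset.range s, N (l + j) := fun s => by
    rw [Finset.prod_range_add, ← mul_assoc]
  by_contra! hcon
  rw [hfull, add_comm (t + 1) l, hsplit, add_comm l (t + 1)] at hcon
  have hcore := mul_prod_one_add_inv_lt_one (fun j => hNpos (l + j))
    (fun i j hij => hNmono (by omega : l + i ≤ l + j)) hA1 t
    (fun s hs => by
      rcases Nat.eq_zero_or_pos s with rfl | hs0
      · simp
      rw [← hsplit]
      refine le_trans ?_ (hmax (l + s) (by omega) (by omega)).le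
      rw [pow_add, pow_mul]
      exact pow_le_pow_left₀ (by linarith) hl _)
    ((F_succ_le_F_succ_add hA1 t l hl).trans_lt hcon)
  have hS : ∑ i, (b i : ℝ) / (a i : ℝ) *
      ∏ j ∈ (J i).filter (fun j => j.val < l), (1 + 1 / N j) ≤ 1 - 1 / A := by
    have hα : ∀ i, 0 < a i * ∏ j ∈ (J i).filter (fun j => j.val < l), (m j - 1) := fun i =>
      Nat.mul_pos (ha i) (Finset.prod_pos fun j _ => Nat.sub_pos_of_lt (hm j))
    have hterm : ∀ i, (b i : ℝ) / (a i : ℝ) *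
        ∏ j ∈ (J i).filter (fun j => j.val < l), (1 + 1 / N j)
        = ((b i * ∏ j ∈ (J i).filter (fun j => j.val < l), m j : ℕ) : ℝ) /
          ((a i * ∏ j ∈ (J i).filter (fun j => j.val < l), (m j - 1) : ℕ) : ℝ) := fun i => by
      rw [Finset.prod_congr rfl fun j _ => (hg j).symm.trans (inv_one_sub_inv_natCast (hm j)),
        Finset.prod_div_distrib, div_mul_div_comm]
      push_cast
      rfl
    have hprod : ∏ i, ((a i * ∏ j ∈ (J i).filter (fun j => j.val < l), (m j - 1) : ℕ) : ℝ)
        = A := by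
      have hcast : ∀ j, ((m j - 1 : ℕ) : ℝ) = N j := fun j => by
        rw [hN, Nat.cast_sub (hm j).le, Nat.cast_one]
      simp only [Nat.cast_mul, Nat.cast_prod, hcast]
      rw [Finset.prod_mul_distrib, hAdef, hx, Nat.cast_prod,
        ← prod_filter_lt_eq_prod_range N (by omega : l ≤ t + 1 + l), ← hunion,
        Finset.filter_biUnion, Finset.prod_biUnion]
      exact fun i _ i' _ hne => Finset.disjoint_filter_filter (hdisj i i' hne)
    have hlt : ∑ i, (b i : ℝ) / (a i : ℝ) *
        ∏ j ∈ (J i).filter (fun j => j.val < l), (1 + 1 / N j) < 1 := by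
      refine lt_of_le_of_lt (Finset.sum_le_sum fun i _ => ?_) hB
      refine mul_le_mul_of_nonneg_left ?_ (by positivity)
      rw [Finset.prod_congr rfl fun j _ => hg j]
      exact Finset.prod_le_prod_of_subset_of_one_le
        (Finset.monotone_filter_right _ fun j _ (hj : j.val < l) => by omega)
        (fun j _ => zero_le_one.trans (hg1 j)) fun j _ _ => hg1 j
    simp only [hterm] at hlt ⊢
    rw [← hprod]
    exact sum_div_le_one_sub_inv_prod hα hlt
  have hT : ∀ i, ∏ j ∈ (J i).filter (fun j => ¬ j.val < l), (1 + 1 / N j)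
      ≤ ∏ j ∈ Finset.range (t + 1), (1 + 1 / N (l + j)) := fun i => by
    have hIco := Finset.prod_Ico_eq_prod_range (fun j => 1 + 1 / N j) l (t + 1 + l)
    rw [Nat.add_sub_cancel] at hIco
    rw [← hIco,
      ← Finset.prod_image (f := fun j : ℕ => 1 + 1 / N j) (g := Fin.val) Fin.val_injective.injOn]
    refine Finset.prod_le_prod_of_subset_of_one_le (fun j hj => ?_)
      (fun j _ => zero_le_one.trans (hg1 j)) fun j _ _ => hg1 j
    obtain ⟨j, hjJ, rfl⟩ := Finset.mem_image.1 hj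
    have := (Finset.mem_filter.1 hjJ).2
    exact Finset.mem_Ico.2 (by omega)
  have hQ : 0 < ∏ j ∈ Finset.range (t + 1), (1 + 1 / N (l + j)) :=
    Finset.prod_pos fun j _ => one_pos.trans_le (hg1 _)
  refine absurd hA (not_le.2 (lt_of_le_of_lt ?_ hcore))
  refine le_trans ?_ (mul_le_mul_of_nonneg_right hS hQ.le)
  rw [Finset.sum_mul]
  refine Finset.sum_le_sum fun i _ => ?_
  rw [Finset.prod_congr rfl fun j _ => hg j,
    ← Finset.prod_filter_mul_prod_filter_not (J i) (fun j => j.val < l), mul_assoc]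
  refine mul_le_mul_of_nonneg_left ?_ (by positivity)
  exact mul_le_mul_of_nonneg_left (hT i)
    (Finset.prod_nonneg fun j _ => zero_le_one.trans (hg1 _))
end

section
/- Let k ≥ 2, let (M_1, …, M_k) be an anarchy harmonious k-tuple, and suppose decompositions M_i = U_i·V_i with gcd(U_i, V_i) = 1 are given such that U := U_1 ⋯ U_k > 1. Then for every set S of prime factors of U, one has ∑_{i=1}^{k} (V_i/σ(V_i)) · ∏_{p ∣ U_i, p ∈ S} (1 − 1/p) ≠ 1. -/
/-- `sigma n` is the sum of all positive divisors of `n`. -/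
def sigma (n : ℕ) : ℕ := ∑ d ∈ n.divisors, d

theorem sigma_pos {n : ℕ} (hn : 0 < n) : 0 < sigma n :=
  Finset.sum_pos (fun _ hd => Nat.pos_of_mem_divisors hd) ⟨1, Nat.one_mem_divisors.2 hn.ne'⟩

theorem sigma_mul_of_coprime {m n : ℕ} (h : m.Coprime n) : sigma (m * n) = sigma m * sigma n :=
  h.sum_divisors_mul

theorem le_sigma {n : ℕ} (hn : 0 < n) : n ≤ sigma n :=
  Finset.single_le_sum (f := fun d => d) (fun _ _ => Nat.zero_le _)
    (Nat.mem_divisors_self n hn.ne')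

theorem lt_sigma {n : ℕ} (hn : 1 < n) : n < sigma n :=
  Finset.single_lt_sum (f := fun d => d) (i := n) (j := 1) hn.ne
    (Nat.mem_divisors_self n (by lia)) (Nat.one_mem_divisors.2 (by lia)) one_pos
    (fun _ _ _ => Nat.zero_le _)

/-- A finite sum of fractions with denominators prime to `p` has a denominator prime to `p`. -/
theorem exists_sum_div_mul_eq_intCast {ι : Type*} {p : ℕ} (hp : p.Prime) (s : Finset ι)
    (a b : ι → ℤ) (hb : ∀ j ∈ s, ¬ (p : ℤ) ∣ b j) :
    ∃ n d : ℤ, ¬ (p : ℤ) ∣ d ∧ (∑ j ∈ s, (a j : ℝ) / (b j : ℝ)) * d = n := by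
  classical
  induction s using Finset.induction_on with
  | empty => exact ⟨0, 1, (Nat.prime_iff_prime_int.1 hp).not_dvd_one, by simp⟩
  | insert j s hj ih =>
    obtain ⟨n, d, hd, h⟩ := ih fun i hi => hb i (Finset.mem_insert_of_mem hi)
    have hbj := hb j (Finset.mem_insert_self j s)
    have hbj0 : (b j : ℝ) ≠ 0 := by
      intro h0
      exact hbj (by rw [Int.cast_eq_zero.1 h0]; exact dvd_zero _)
    refine ⟨a j * d + n * b j, d * b j, fun hdvd => ?_, ?_⟩
    · exact ((Nat.prime_iff_prime_int.1 hp).dvd_or_dvd hdvd).elim hd hbj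
    · rw [Finset.sum_insert hj]
      push_cast
      rw [← h]
      field_simp

/-- `V / σ(V) * ∏ (1 - 1/q)` written as a quotient of two integers. -/
theorem div_sigma_mul_prod_eq (v : ℕ) (T : Finset ℕ) (hT : ∀ q ∈ T, q.Prime) :
    (v : ℝ) / (sigma v : ℝ) * ∏ q ∈ T, (1 - 1 / (q : ℝ)) =
      ((v * ∏ q ∈ T, ((q : ℤ) - 1) : ℤ) : ℝ) / ((sigma v * ∏ q ∈ T, (q : ℤ) : ℤ) : ℝ) := by
  push_cast
  rw [mul_div_mul_comm, ← Finset.prod_div_distrib]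
  congr 1
  refine Finset.prod_congr rfl fun q hq => ?_
  have : (q : ℝ) ≠ 0 := by exact_mod_cast (hT q hq).ne_zero
  field_simp

theorem amicable_tuples_stmt10 (k : ℕ) (hk : 2 ≤ k) (M U V : Fin k → ℕ)
    (hpos : ∀ i, 0 < M i) (hdist : Function.Injective M)
    (hanarchy : ∀ i j, i ≠ j → Nat.gcd (M i) (M j * sigma (M j)) = 1)
    (hharm : ∑ i, (M i : ℝ) / (sigma (M i) : ℝ) = 1)
    (hdec : ∀ i, M i = U i * V i) (hUV : ∀ i, Nat.gcd (U i) (V i) = 1)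
    (hU : 1 < ∏ i, U i)
    (S : Finset ℕ) (hS : ∀ p ∈ S, p.Prime ∧ p ∣ ∏ i, U i) :
    ∑ i, (V i : ℝ) / (sigma (V i) : ℝ) *
        ∏ p ∈ S.filter (· ∣ U i), (1 - 1 / (p : ℝ)) ≠ 1 := by
  have hUpos : ∀ i, 0 < U i := fun i => Nat.pos_of_mul_pos_right (hdec i ▸ hpos i)
  have hVpos : ∀ i, 0 < V i := fun i => Nat.pos_of_mul_pos_left (hdec i ▸ hpos i)
  have hσ : ∀ i, sigma (M i) = sigma (U i) * sigma (V i) := fun i => by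
    rw [hdec i, sigma_mul_of_coprime (hUV i)]
  rcases S.eq_empty_or_nonempty with rfl | hne
  · obtain ⟨i, hi⟩ : ∃ i, U i ≠ 1 := by
      by_contra! h
      simp [h] at hU
    simp only [Finset.filter_empty, Finset.prod_empty, mul_one]
    refine (hharm.symm.trans_lt (Finset.sum_lt_sum (fun j _ => ?_)
      ⟨i, Finset.mem_univ i, ?_⟩)).ne'
    · have h1 : (U j : ℝ) ≤ sigma (U j) := by exact_mod_cast le_sigma (hUpos j)
      have h2 : (0 : ℝ) < sigma (U j) := by exact_mod_cast sigma_pos (hUpos j)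
      rw [hσ, hdec]
      push_cast
      rw [mul_div_mul_comm]
      exact mul_le_of_le_one_left (by positivity) ((div_le_one h2).2 h1)
    · have h1 : (U i : ℝ) < sigma (U i) := by
        exact_mod_cast lt_sigma (lt_of_le_of_ne (hUpos i) (Ne.symm hi))
      have h2 : (0 : ℝ) < sigma (U i) := by exact_mod_cast sigma_pos (hUpos i)
      have h3 : (0 : ℝ) < sigma (V i) := by exact_mod_cast sigma_pos (hVpos i)
      have h4 : (0 : ℝ) < V i := by exact_mod_cast hVpos i
      rw [hσ, hdec]
      push_cast
      rw [mul_div_mul_comm]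
      exact mul_lt_of_lt_one_left (by positivity) ((div_lt_one h2).2 h1)
  · intro hsum
    set p := S.max' hne
    have hpS : p ∈ S := S.max'_mem hne
    have hp : p.Prime := (hS p hpS).1
    have hp' : Prime (p : ℤ) := Nat.prime_iff_prime_int.1 hp
    obtain ⟨i, -, hpi⟩ := (hp.prime.dvd_finsetProd_iff U).1 (hS p hpS).2
    have hT : ∀ j, ∀ q ∈ S.filter (· ∣ U j), q.Prime := fun j q hq =>
      (hS q (Finset.mem_filter.1 hq).1).1
    simp only [div_sigma_mul_prod_eq _ _ (hT _)] at hsum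
    have hcop : ∀ j, j ≠ i → ¬ p ∣ M j * sigma (M j) := fun j hj h =>
      Nat.not_coprime_of_dvd_of_dvd hp.one_lt (hdec i ▸ hpi.mul_right _) h (hanarchy i j hj.symm)
    have hden : ∀ j ∈ Finset.univ.erase i,
        ¬ (p : ℤ) ∣ sigma (V j) * ∏ q ∈ S.filter (· ∣ U j), (q : ℤ) := by
      intro j hj h
      have hj := hcop j (Finset.ne_of_mem_erase hj)
      rcases hp'.dvd_or_dvd h with h | h
      · have hσV : sigma (V j) ∣ sigma (M j) := ⟨sigma (U j), by rw [hσ, mul_comm]⟩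
        exact hj (((Int.natCast_dvd_natCast.1 h).trans hσV).mul_left _)
      · obtain ⟨q, hq, hpq⟩ := (hp'.dvd_finsetProd_iff _).1 h
        have hqU := (Finset.mem_filter.1 hq).2
        exact hj ((((Int.natCast_dvd_natCast.1 hpq).trans hqU).trans ⟨V j, hdec j⟩).mul_right _)
    obtain ⟨n, d, hd, hnd⟩ := exists_sum_div_mul_eq_intCast hp (Finset.univ.erase i)
      (fun j => V j * ∏ q ∈ S.filter (· ∣ U j), ((q : ℤ) - 1))
      (fun j => sigma (V j) * ∏ q ∈ S.filter (· ∣ U j), (q : ℤ)) hden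
    rw [← Finset.add_sum_erase _ _ (Finset.mem_univ i)] at hsum
    set A : ℤ := V i * ∏ q ∈ S.filter (· ∣ U i), ((q : ℤ) - 1)
    set B : ℤ := sigma (V i) * ∏ q ∈ S.filter (· ∣ U i), (q : ℤ)
    have hB0 : (B : ℝ) ≠ 0 := by
      refine Int.cast_ne_zero.2 (mul_ne_zero ?_ (Finset.prod_ne_zero_iff.2 fun q hq => ?_))
      · exact_mod_cast (sigma_pos (hVpos i)).ne'
      · exact_mod_cast (hT i q hq).ne_zero
    have hAB : A * d = (d - n) * B := by
      rw [← eq_sub_iff_add_eq, div_eq_iff hB0] at hsum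
      have : (A : ℝ) * d = (d - n) * B := by
        rw [hsum, ← hnd]
        ring
      exact_mod_cast this
    have hpB : (p : ℤ) ∣ B := (Finset.dvd_prod_of_mem (fun q : ℕ => (q : ℤ))
      (Finset.mem_filter.2 ⟨hpS, hpi⟩)).mul_left _
    rcases hp'.dvd_or_dvd (hAB ▸ hpB.mul_left (d - n)) with h | h
    · rcases hp'.dvd_or_dvd h with h | h
      · exact Nat.not_coprime_of_dvd_of_dvd hp.one_lt hpi (Int.natCast_dvd_natCast.1 h) (hUV i)
      · obtain ⟨q, hq, hpq⟩ := (hp'.dvd_finsetProd_iff _).1 h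
        have hq1 := (hT i q hq).one_lt
        have hqp : q ≤ p := S.le_max' q (Finset.mem_filter.1 hq).1
        have := Int.le_of_dvd (by lia) hpq
        lia
    · exact hd h
end

section
/- Let k ≥ 2, let (M_1, …, M_k) be an anarchy harmonious k-tuple, and suppose decompositions M_i = U_i·V_i with gcd(U_i, V_i) = 1 are given such that U := U_1 ⋯ U_k > 1; set V := V_1 ⋯ V_k, and let S be a set of prime factors of U. Then there exist decompositions M_i = U_i'·V_i' with gcd(U_i', V_i') = 1 such that, with U' := U_1' ⋯ U_k' and V' := V_1' ⋯ V_k', one has V ∥ V', and there exists a set S' of prime factors of U' satisfying: (i) v := |P'| ≥ 1, where P' is the set of primes p with p ∣ V' and p ∤ V; (ii) σ(V')·Π(S')·Ψ(P') ≤ F_{v+w}(σ(V)·Π(S) + 1), where w := v + |S'| − |S|; and (iii) if w = 0 then moreover σ(V')·Π(S')·Ψ(P') ≤ F_{v+w}(σ(V)·Π(S)). -/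
/-- `PiS S = ∏_{m ∈ S} m`. -/
def PiS (S : Finset ℕ) : ℕ := ∏ m ∈ S, m

/-- `PhiS S = ∏_{m ∈ S} (m - 1)`. -/
def PhiS (S : Finset ℕ) : ℕ := ∏ m ∈ S, (m - 1)

/-- `PsiS S = PiS S * PhiS S`. -/
def PsiS (S : Finset ℕ) : ℕ := PiS S * PhiS S

/-- The concavity of `t ↦ log (1 - exp (-t))`, as a tangent line inequality at `t = log n`. -/
theorem log_sub_log_div_le {n y : ℝ} (hn : 1 < n) (hy : 1 < y) :
    (Real.log n - Real.log y) / (n - 1) ≤ Real.log (1 - 1 / n) - Real.log (1 - 1 / y) := by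
  have hn0 : 0 < n - 1 := by linarith
  have hy0 : 0 < y - 1 := by linarith
  have hn1 : 0 < n := by linarith
  have hy1 : 0 < y := by linarith
  rw [← Real.log_div hn1.ne' hy1.ne']
  have h1 : Real.log (n / y) ≤ n / y - 1 := Real.log_le_sub_one_of_pos (by positivity)
  have e1 : (1 : ℝ) - 1 / n = (n - 1) / n := by field_simp
  have e2 : (1 : ℝ) - 1 / y = (y - 1) / y := by field_simp
  have hx : 0 < ((y - 1) / y) / ((n - 1) / n) := by positivity
  have h2 := Real.log_le_sub_one_of_pos hx
  rw [Real.log_div (by positivity) (by positivity)] at h2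
  rw [e1, e2]
  have h3 : Real.log (n / y) / (n - 1) ≤ (n / y - 1) / (n - 1) := by gcongr
  have h4 : (n / y - 1) / (n - 1) = 1 - ((y - 1) / y) / ((n - 1) / n) := by
    field_simp
    ring
  linarith

/-- A majorization inequality: if `n` is increasing and its partial products dominate those of `y`,
then `∏ (1 - 1 / n i)` dominates `∏ (1 - 1 / y i)`. -/
theorem log_prod_majorization (n y : ℕ → ℝ) (hn : ∀ i, 1 < n i) (hy : ∀ i, 1 < y i) (r : ℕ)
    (hmono : ∀ i j, i ≤ j → j ≤ r → n i ≤ n j)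
    (hprod : ∀ j ≤ r, ∏ i ∈ Finset.range j, y i ≤ ∏ i ∈ Finset.range j, n i) :
    (Real.log (∏ i ∈ Finset.range (r + 1), n i) - Real.log (∏ i ∈ Finset.range (r + 1), y i)) /
        (n r - 1) ≤
      Real.log (∏ i ∈ Finset.range (r + 1), (1 - 1 / n i)) -
        Real.log (∏ i ∈ Finset.range (r + 1), (1 - 1 / y i)) := by
  have pos1 : ∀ {x : ℝ}, 1 < x → 0 < 1 - 1 / x := fun {x} hx => by
    have : 1 / x < 1 := by rw [div_lt_one (by linarith)]; exact hx
    linarith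
  have hn0 : ∀ i, n i ≠ 0 := fun i => by linarith [hn i]
  have hy0 : ∀ i, y i ≠ 0 := fun i => by linarith [hy i]
  have hn1 : ∀ i, 1 - 1 / n i ≠ 0 := fun i => (pos1 (hn i)).ne'
  have hy1 : ∀ i, 1 - 1 / y i ≠ 0 := fun i => (pos1 (hy i)).ne'
  induction r with
  | zero => simpa using log_sub_log_div_le (hn 0) (hy 0)
  | succ r ih =>
    have ih := ih (fun i j hij hj => hmono i j hij (by omega)) (fun j hj => hprod j (by omega))
    have hstep := log_sub_log_div_le (hn (r + 1)) (hy (r + 1))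
    have hle := hprod (r + 1) le_rfl
    have hypos : 0 < ∏ i ∈ Finset.range (r + 1), y i :=
      Finset.prod_pos fun i _ => by linarith [hy i]
    have hlog := Real.log_le_log hypos hle
    rw [Finset.prod_range_succ _ (r + 1), Finset.prod_range_succ _ (r + 1),
      Finset.prod_range_succ _ (r + 1), Finset.prod_range_succ _ (r + 1),
      Real.log_mul (Finset.prod_ne_zero_iff.2 fun i _ => hn0 i) (hn0 _),
      Real.log_mul (Finset.prod_ne_zero_iff.2 fun i _ => hy0 i) (hy0 _),
      Real.log_mul (Finset.prod_ne_zero_iff.2 fun i _ => hn1 i) (hn1 _),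
      Real.log_mul (Finset.prod_ne_zero_iff.2 fun i _ => hy1 i) (hy1 _)]
    have hdiv : (Real.log (∏ i ∈ Finset.range (r + 1), n i) -
          Real.log (∏ i ∈ Finset.range (r + 1), y i)) / (n (r + 1) - 1) ≤
        (Real.log (∏ i ∈ Finset.range (r + 1), n i) -
          Real.log (∏ i ∈ Finset.range (r + 1), y i)) / (n r - 1) := by
      apply div_le_div_of_nonneg_left (by linarith) (by linarith [hn r])
      linarith [hmono r (r + 1) (by omega) le_rfl]
    calc _ = (Real.log (∏ i ∈ Finset.range (r + 1), n i) -
          Real.log (∏ i ∈ Finset.range (r + 1), y i)) / (n (r + 1) - 1) +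
          (Real.log (n (r + 1)) - Real.log (y (r + 1))) / (n (r + 1) - 1) := by ring
      _ ≤ _ := by linarith

theorem sub_one_mul_prod_pow_two_pow_add_one (c : ℝ) (j : ℕ) :
    (c - 1) * ∏ i ∈ Finset.range j, (c ^ 2 ^ i + 1) = c ^ 2 ^ j - 1 := by
  induction j with
  | zero => simp
  | succ j ih => rw [Finset.prod_range_succ, ← mul_assoc, ih, pow_succ 2, pow_mul]; ring

theorem mul_prod_pow_two_pow (c : ℝ) (j : ℕ) :
    c * ∏ i ∈ Finset.range j, c ^ 2 ^ i = c ^ 2 ^ j := by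
  induction j with
  | zero => simp
  | succ j ih => rw [Finset.prod_range_succ, ← mul_assoc, ih, pow_succ 2, pow_mul]; ring

/-- The extremal case of the product bound: if no proper initial product is small and the full
product is large, then `∏ (1 - 1 / n i)` exceeds `a / (a + 1)`. -/
theorem div_lt_prod_one_sub_inv_s11 (n : ℕ → ℝ) (hn : ∀ i, 1 < n i) (r : ℕ)
    (hmono : ∀ i j, i ≤ j → j ≤ r → n i ≤ n j) (a : ℝ) (ha : 1 ≤ a)
    (hpart : ∀ j ≤ r, (a + 1) ^ 2 ^ j - 1 ≤ a * ∏ i ∈ Finset.range j, n i)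
    (hfull : (a + 1) ^ 2 ^ (r + 1) - (a + 1) ^ 2 ^ r < a * ∏ i ∈ Finset.range (r + 1), n i) :
    a / (a + 1) < ∏ i ∈ Finset.range (r + 1), (1 - 1 / n i) := by
  have hc : 1 < a + 1 := by linarith
  have ha0 : 0 < a := by linarith
  have hpow : ∀ j : ℕ, 1 < (a + 1) ^ 2 ^ j := fun j => one_lt_pow₀ hc (by positivity)
  let y : ℕ → ℝ := fun i => if i < r then (a + 1) ^ 2 ^ i + 1 else (a + 1) ^ 2 ^ r
  have hy : ∀ i, 1 < y i := by
    intro i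
    simp only [y]
    split_ifs
    · linarith [hpow i]
    · exact hpow r
  have hyr : y r = (a + 1) ^ 2 ^ r := by simp [y]
  have hyprod : ∀ j ≤ r, a * ∏ i ∈ Finset.range j, y i = (a + 1) ^ 2 ^ j - 1 := by
    intro j hj
    rw [← sub_one_mul_prod_pow_two_pow_add_one, add_sub_cancel_right]
    congr 1
    refine Finset.prod_congr rfl fun i hi => ?_
    have : i < r := by have := Finset.mem_range.1 hi; omega
    simp [y, this]
  have hyfull : a * ∏ i ∈ Finset.range (r + 1), y i = (a + 1) ^ 2 ^ (r + 1) - (a + 1) ^ 2 ^ r := by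
    rw [Finset.prod_range_succ, ← mul_assoc, hyprod r le_rfl, hyr, pow_succ 2, pow_mul]
    ring
  have key : (a + 1) * ∏ i ∈ Finset.range (r + 1), (1 - 1 / y i) = a := by
    have e : ∏ i ∈ Finset.range r, (1 - 1 / y i) =
        (∏ i ∈ Finset.range r, (a + 1) ^ 2 ^ i) / ∏ i ∈ Finset.range r, y i := by
      rw [← Finset.prod_div_distrib]
      refine Finset.prod_congr rfl fun i hi => ?_
      have : i < r := Finset.mem_range.1 hi
      have h0 : (a + 1) ^ 2 ^ i + 1 ≠ 0 := by positivity
      simp only [y, this, if_true]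
      field_simp
      ring
    have hY : ∏ i ∈ Finset.range r, y i = ((a + 1) ^ 2 ^ r - 1) / a := by
      rw [eq_div_iff ha0.ne', mul_comm, hyprod r le_rfl]
    have h1 : (a + 1) ^ 2 ^ r - 1 ≠ 0 := by linarith [hpow r]
    have h2 : (a + 1) ^ 2 ^ r ≠ 0 := by linarith [hpow r]
    rw [Finset.prod_range_succ, e, hyr, hY, ← mul_assoc, ← mul_div_assoc, mul_prod_pow_two_pow]
    field_simp
  have hmaj := log_prod_majorization n y hn hy r hmono (fun j hj => by
    have := hpart j hj
    rw [← hyprod j hj] at this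
    exact le_of_mul_le_mul_left this ha0)
  rw [← hyfull] at hfull
  have hlt := lt_of_mul_lt_mul_left hfull ha0.le
  have hlog := Real.log_lt_log (Finset.prod_pos fun i _ => by linarith [hy i]) hlt
  have hpos := div_pos (sub_pos.2 hlog) (sub_pos.2 (hn r))
  have hy1 : ∏ i ∈ Finset.range (r + 1), (1 - 1 / y i) = a / (a + 1) := by
    rw [eq_div_iff (by linarith), mul_comm, key]
  have hn1 : 0 < ∏ i ∈ Finset.range (r + 1), (1 - 1 / n i) := by
    refine Finset.prod_pos fun i _ => ?_
    have : 1 / n i < 1 := by rw [div_lt_one (by linarith [hn i])]; exact hn i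
    linarith
  rw [← hy1]
  exact (Real.log_lt_log_iff (by rw [hy1]; positivity) hn1).1 (by linarith)

theorem add_le_sq_of_le {A X Y : ℕ} (hX : 1 ≤ X) (hXY : X ≤ Y) (h : A + X ≤ X ^ 2) :
    A + Y ≤ Y ^ 2 := by
  nlinarith

/-- Nielsen's bound for the product of the terms of an increasing sequence `m i + 1` for which
`∏ m i / (m i + 1)` first drops to `a / b` or below at the last factor. -/
theorem mul_prod_add_pow_le_pow (r : ℕ) : ∀ (m : ℕ → ℕ) (a b : ℕ), (∀ i, 1 ≤ m i) →
    (∀ i j, i ≤ j → j < r → m i ≤ m j) → 1 ≤ a → a < b →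
    b * ∏ i ∈ Finset.range r, m i ≤ a * ∏ i ∈ Finset.range r, (m i + 1) →
    (∀ j < r, a * ∏ i ∈ Finset.range j, (m i + 1) < b * ∏ i ∈ Finset.range j, m i) →
    a * ∏ i ∈ Finset.range r, (m i + 1) + (a + 1) ^ 2 ^ (r - 1) ≤ (a + 1) ^ 2 ^ r := by
  induction r using Nat.strong_induction_on with
  | _ r ih =>
  intro m a b hm hmono ha hab hle hlt
  obtain rfl | ⟨s, rfl⟩ : r = 0 ∨ ∃ s, r = s + 1 := by cases r <;> simp
  · simp at hle; omega
  by_cases hex : ∃ j, 0 < j ∧ j < s + 1 ∧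
      a * ∏ i ∈ Finset.range j, (m i + 1) + 1 ≤ (a + 1) ^ 2 ^ j
  · obtain ⟨j, hj0, hj, hsmall⟩ := hex
    obtain ⟨t, rfl⟩ : ∃ t, s = j + t := ⟨s - j, by omega⟩
    have hsplit : ∀ (f : ℕ → ℕ) (x i : ℕ), x * ∏ l ∈ Finset.range (j + i), f l =
        x * (∏ l ∈ Finset.range j, f l) * ∏ l ∈ Finset.range i, f (j + l) := by
      intro f x i
      rw [Finset.prod_range_add, mul_assoc]
    have hpos : 0 < ∏ i ∈ Finset.range j, (m i + 1) := Finset.prod_pos fun i _ => by omega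
    have h := ih (t + 1) (by omega) (fun i => m (j + i)) (a * ∏ i ∈ Finset.range j, (m i + 1))
      (b * ∏ i ∈ Finset.range j, m i) (fun i => hm _)
      (fun i l hil hl => hmono _ _ (by omega) (by omega)) (Nat.mul_pos ha hpos) (hlt j hj)
      (by rw [← hsplit, ← hsplit (fun l => m l + 1)]; exact hle)
      (fun l hl => by
        rw [← hsplit m b l, ← hsplit (fun l => m l + 1) a l]
        exact hlt _ (by omega))
    rw [← hsplit (fun l => m l + 1)] at h
    set X := (a * ∏ i ∈ Finset.range j, (m i + 1) + 1) ^ 2 ^ t with hX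
    have hXY : X ≤ (a + 1) ^ 2 ^ (j + t) := by
      rw [pow_add, pow_mul]
      exact Nat.pow_le_pow_left hsmall _
    have hX1 : 1 ≤ X := Nat.one_le_pow _ _ (by omega)
    rw [add_tsub_cancel_right, pow_succ, pow_mul] at h
    rw [add_tsub_cancel_right, pow_succ 2 (j + t), pow_mul]
    exact add_le_sq_of_le hX1 hXY h
  · push Not at hex
    by_contra! hcon
    rw [add_tsub_cancel_right] at hcon
    have haR : (1 : ℝ) ≤ a := by exact_mod_cast ha
    have hfin := div_lt_prod_one_sub_inv_s11 (fun i => (m i : ℝ) + 1)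
      (fun i => by have : (1 : ℝ) ≤ m i := by exact_mod_cast hm i
                   linarith) s
      (fun i j hij hj => by
        have : (m i : ℝ) ≤ m j := by exact_mod_cast hmono i j hij (by omega)
        linarith) a haR
      (fun j hj => by
        rcases Nat.eq_zero_or_pos j with rfl | hj0
        · simp
        have : (a + 1) ^ 2 ^ j ≤ a * ∏ i ∈ Finset.range j, (m i + 1) + 1 :=
          (hex j hj0 (by omega)).le
        have : ((a : ℝ) + 1) ^ 2 ^ j ≤ a * ∏ i ∈ Finset.range j, ((m i : ℝ) + 1) + 1 := by
          exact_mod_cast this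
        linarith)
      (by
        have : ((a : ℝ) + 1) ^ 2 ^ (s + 1) <
            a * ∏ i ∈ Finset.range (s + 1), ((m i : ℝ) + 1) + ((a : ℝ) + 1) ^ 2 ^ s := by
          exact_mod_cast hcon
        linarith)
    have hP : (0 : ℝ) < ∏ i ∈ Finset.range (s + 1), ((m i : ℝ) + 1) :=
      Finset.prod_pos fun i _ => by positivity
    have e : ∏ i ∈ Finset.range (s + 1), (1 - 1 / ((m i : ℝ) + 1)) =
        (∏ i ∈ Finset.range (s + 1), (m i : ℝ)) / ∏ i ∈ Finset.range (s + 1), ((m i : ℝ) + 1) := by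
      rw [← Finset.prod_div_distrib]
      refine Finset.prod_congr rfl fun i _ => ?_
      field_simp
      ring
    rw [e, div_lt_div_iff₀ (by positivity) hP] at hfin
    have hle' : (a + 1) * ∏ i ∈ Finset.range (s + 1), m i ≤
        a * ∏ i ∈ Finset.range (s + 1), (m i + 1) :=
      (Nat.mul_le_mul_right _ hab).trans hle
    have : ((a : ℝ) + 1) * ∏ i ∈ Finset.range (s + 1), (m i : ℝ) ≤
        a * ∏ i ∈ Finset.range (s + 1), ((m i : ℝ) + 1) := by exact_mod_cast hle'
    linarith

theorem exists_monotone_enumeration {α : Type*} [DecidableEq α] [Inhabited α] (T : Finset α)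
    (h : α → ℕ) :
    ∃ e : ℕ → α, (Finset.range T.card).image e = T ∧ Set.InjOn e (Finset.range T.card) ∧
      ∀ i j, i ≤ j → j < T.card → h (e i) ≤ h (e j) := by
  induction T using Finset.induction_on_max_value h with
  | empty => exact ⟨fun _ => default, by simp⟩
  | insert x s hx hmax ih =>
    obtain ⟨e, he, hinj, hmono⟩ := ih
    have hmem : ∀ i < s.card, e i ∈ s := fun i hi => by
      have := Finset.mem_image_of_mem e (Finset.mem_range.2 hi)
      rwa [he] at this
    have hlt : ∀ i < s.card, Function.update e s.card x i = e i := fun i hi =>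
      Function.update_of_ne hi.ne _ _
    have himage : (Finset.range s.card).image (Function.update e s.card x) = s :=
      (Finset.image_congr fun i hi => hlt i (by simpa using hi)).trans he
    refine ⟨Function.update e s.card x, ?_, ?_, ?_⟩
    · rw [Finset.card_insert_of_notMem hx, Finset.range_add_one, Finset.image_insert,
        Function.update_self, himage]
    · rw [← Finset.card_image_iff, Finset.card_insert_of_notMem hx, Finset.range_add_one,
        Finset.image_insert, Function.update_self, himage, Finset.card_insert_of_notMem hx,
        Finset.card_insert_of_notMem (by simp), Finset.card_range]
    · intro i j hij hj
      rw [Finset.card_insert_of_notMem hx] at hj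
      rcases Nat.lt_succ_iff_lt_or_eq.1 hj with hj | rfl
      · rw [hlt i (by omega), hlt j hj]
        exact hmono i j hij hj
      · rw [Function.update_self]
        rcases hij.lt_or_eq with hi | rfl
        · rw [hlt i hi]
          exact hmax _ (hmem i hi)
        · rw [Function.update_self]

/-- From a finite family with `∏ m / (m + 1) ≤ a / b < 1` one can select a nonempty subfamily with
the same property and a small product. -/
theorem exists_subset_prod_bound {α : Type*} [DecidableEq α] [Inhabited α] (T : Finset α)
    (m : α → ℕ) (hm : ∀ x ∈ T, 1 ≤ m x) {a b : ℕ} (ha : 1 ≤ a) (hab : a < b)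
    (hT : b * ∏ x ∈ T, m x ≤ a * ∏ x ∈ T, (m x + 1)) :
    ∃ B ⊆ T, B.Nonempty ∧ b * ∏ x ∈ B, m x ≤ a * ∏ x ∈ B, (m x + 1) ∧
      a * ∏ x ∈ B, (m x + 1) + (a + 1) ^ 2 ^ (B.card - 1) ≤ (a + 1) ^ 2 ^ B.card := by
  obtain ⟨e, he, hinj, hmono⟩ := exists_monotone_enumeration T m
  have hmem : ∀ i < T.card, e i ∈ T := fun i hi => by
    have := Finset.mem_image_of_mem e (Finset.mem_range.2 hi)
    rwa [he] at this
  let f : ℕ → ℕ := fun i => max (m (e i)) 1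
  have hf : ∀ i < T.card, f i = m (e i) := fun i hi => max_eq_left (hm _ (hmem i hi))
  have hsub : ∀ r ≤ T.card, (Finset.range r : Set ℕ) ⊆ Finset.range T.card := fun r hr => by
    simpa using hr
  have hprod : ∀ r ≤ T.card, ∀ g : ℕ → ℕ,
      ∏ x ∈ (Finset.range r).image e, g (m x) = ∏ i ∈ Finset.range r, g (f i) := by
    intro r hr g
    rw [Finset.prod_image (hinj.mono (hsub r hr))]
    refine Finset.prod_congr rfl fun i hi => ?_
    rw [hf i ((Finset.mem_range.1 hi).trans_le hr)]
  have hex : ∃ r, b * ∏ i ∈ Finset.range r, f i ≤ a * ∏ i ∈ Finset.range r, (f i + 1) := by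
    refine ⟨T.card, ?_⟩
    rw [← hprod _ le_rfl fun x => x, ← hprod _ le_rfl fun x => x + 1, he]
    exact hT
  classical
  have hr : Nat.find hex ≤ T.card := by
    refine Nat.find_min' hex ?_
    rw [← hprod _ le_rfl fun x => x, ← hprod _ le_rfl fun x => x + 1, he]
    exact hT
  have hspec := Nat.find_spec hex
  have hmin := fun j (hj : j < Nat.find hex) => not_le.1 (Nat.find_min hex hj)
  set r := Nat.find hex
  have hcard : ((Finset.range r).image e).card = r := by
    rw [Finset.card_image_of_injOn (hinj.mono (hsub r hr)), Finset.card_range]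
  have hbound := mul_prod_add_pow_le_pow r f a b (fun i => le_max_right _ _)
    (fun i j hij hj => max_le_max_right _ (hmono i j hij (by omega))) ha hab hspec hmin
  refine ⟨(Finset.range r).image e, ?_, ?_, ?_, ?_⟩
  · intro x hx
    obtain ⟨i, hi, rfl⟩ := Finset.mem_image.1 hx
    exact hmem i ((Finset.mem_range.1 hi).trans_le hr)
  · rw [← Finset.card_pos, hcard]
    rcases Nat.eq_zero_or_pos r with h0 | h0
    · rw [h0] at hspec
      simp at hspec
      omega
    · exact h0
  · rw [hprod r hr fun x => x, hprod r hr fun x => x + 1]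
    exact hspec
  · rw [hprod r hr fun x => x + 1, hcard]
    exact hbound

/-- Enlarging a set `S` of primes until the numerator `N` drops below the denominator
`D = C * ∏ p`, with a controlled denominator. -/
theorem exists_superset_num_lt_den (Q : Finset ℕ) (hQ : ∀ p ∈ Q, 2 ≤ p) (C : ℕ) (hC : 0 < C)
    (N : Finset ℕ → ℕ) (hne : ∀ S ⊆ Q, N S ≠ C * PiS S) (hend : N Q < C * PiS Q)
    (hmul : ∀ S ⊆ Q, N S * ∏ p ∈ Q \ S, (p - 1) ≤ N Q) (S : Finset ℕ) (hS : S ⊆ Q) :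
    ∃ T, S ⊆ T ∧ T ⊆ Q ∧ N T < C * PiS T ∧
      C * PiS T + 1 ≤ (C * PiS S + 1) ^ 2 ^ (T.card - S.card) := by
  induction hk : (Q \ S).card using Nat.strong_induction_on generalizing S with
  | _ k ih =>
  rcases (hne S hS).lt_or_gt with hlt | hgt
  · exact ⟨S, Finset.Subset.refl _, hS, hlt, by simp⟩
  have hD : 0 < C * PiS S :=
    Nat.mul_pos hC (Finset.prod_pos fun p hp => by have := hQ p (hS hp); omega)
  have hpred : ∀ R ⊆ Q, ∏ p ∈ R, (p - 1 + 1) = ∏ p ∈ R, p := fun R hR =>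
    Finset.prod_congr rfl fun p hp => by have := hQ p (hR hp); omega
  have hcond : (C * PiS S + 1) * ∏ p ∈ Q \ S, (p - 1) ≤
      C * PiS S * ∏ p ∈ Q \ S, (p - 1 + 1) := by
    calc _ ≤ N S * ∏ p ∈ Q \ S, (p - 1) := Nat.mul_le_mul_right _ hgt
      _ ≤ N Q := hmul S hS
      _ ≤ C * PiS Q := hend.le
      _ = _ := by
        rw [hpred _ Finset.sdiff_subset, mul_assoc, PiS, PiS, mul_comm (∏ m ∈ S, m),
          Finset.prod_sdiff hS]
  obtain ⟨B, hBQ, hB, -, hbound⟩ := exists_subset_prod_bound (Q \ S) (fun p => p - 1)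
    (fun p hp => by have := hQ p (Finset.mem_sdiff.1 hp).1; omega) hD
    (Nat.lt_succ_self _) hcond
  have hBQ' : B ⊆ Q := hBQ.trans Finset.sdiff_subset
  have hdisj : Disjoint S B := (Finset.disjoint_sdiff).mono_right hBQ
  have hSB : S ∪ B ⊆ Q := Finset.union_subset hS hBQ'
  have hprod : C * PiS (S ∪ B) = C * PiS S * ∏ p ∈ B, p := by
    rw [PiS, Finset.prod_union hdisj, ← mul_assoc, PiS]
  rw [hpred B hBQ', ← hprod] at hbound
  have hsmall : (Q \ (S ∪ B)).card < k := by
    have e : Q \ (S ∪ B) = (Q \ S) \ B := by ext; simp; tauto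
    rw [← hk, e, Finset.card_sdiff_of_subset hBQ]
    have := Finset.card_le_card hBQ
    have := hB.card_pos
    omega
  obtain ⟨T, hST, hTQ, hT, hTbound⟩ := ih _ hsmall (S ∪ B) hSB rfl
  refine ⟨T, Finset.subset_union_left.trans hST, hTQ, hT, hTbound.trans ?_⟩
  have hpow : 1 ≤ (C * PiS S + 1) ^ 2 ^ (B.card - 1) := Nat.one_le_pow _ _ (by omega)
  have hcard := Finset.card_le_card hST
  rw [Finset.card_union_of_disjoint hdisj] at hcard ⊢
  calc _ ≤ ((C * PiS S + 1) ^ 2 ^ B.card) ^ 2 ^ (T.card - (S.card + B.card)) :=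
        Nat.pow_le_pow_left (by omega) _
    _ = _ := by
        rw [← pow_mul, ← pow_add]
        congr 2
        omega

theorem sigma_eq_arithmeticFunction (n : ℕ) : sigma n = ArithmeticFunction.sigma 1 n := by
  simp [sigma, ArithmeticFunction.sigma_apply]

theorem sigma_prime_pow_mul_add_one {p : ℕ} (hp : p.Prime) (e : ℕ) :
    sigma (p ^ e) * (p - 1) + 1 = p ^ (e + 1) := by
  rw [sigma_eq_arithmeticFunction, ArithmeticFunction.sigma_one_apply_prime_pow hp]
  have := geom_sum_mul_add (p - 1) (e + 1)
  rwa [Nat.sub_add_cancel hp.one_le] at this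

theorem sigma_prod {ι : Type*} (s : Finset ι) (f : ι → ℕ)
    (hf : (s : Set ι).Pairwise fun i j => (f i).Coprime (f j)) :
    sigma (∏ i ∈ s, f i) = ∏ i ∈ s, sigma (f i) := by
  simp only [sigma_eq_arithmeticFunction]
  exact ArithmeticFunction.isMultiplicative_sigma.map_prod f s hf

theorem div_sigma_eq_prod {n : ℕ} (hn : n ≠ 0) :
    (n : ℝ) / sigma n = ∏ p ∈ n.primeFactors,
      ((p ^ n.factorization p : ℕ) : ℝ) / sigma (p ^ n.factorization p) := by
  rw [Finset.prod_div_distrib, ← Nat.cast_prod, ← Nat.cast_prod]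
  congr 2
  · exact (Nat.prod_factorization_pow_eq_self hn).symm
  · simp only [sigma_eq_arithmeticFunction]
    exact ArithmeticFunction.isMultiplicative_sigma.multiplicative_factorization _ hn

theorem prime_pow_div_sigma_mul {p : ℕ} (hp : p.Prime) (e : ℕ) :
    ((p ^ e : ℕ) : ℝ) / sigma (p ^ e) * (((p ^ (e + 1) - 1 : ℕ) : ℝ) / (p ^ (e + 1) : ℕ)) =
      ((p - 1 : ℕ) : ℝ) / p := by
  have h := sigma_prime_pow_mul_add_one hp e
  have h1 : p ^ (e + 1) - 1 = sigma (p ^ e) * (p - 1) := by omega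
  have h2 : ((sigma (p ^ e) : ℕ) : ℝ) ≠ 0 := by
    exact_mod_cast (sigma_pos (Nat.pow_pos hp.pos)).ne'
  have h3 : (p : ℝ) ≠ 0 := by exact_mod_cast hp.ne_zero
  rw [h1]
  push_cast
  field_simp
  ring

theorem div_sigma_le_one (n : ℕ) : (n : ℝ) / sigma n ≤ 1 := by
  rcases Nat.eq_zero_or_pos n with rfl | hn
  · simp
  · rw [div_le_one (by exact_mod_cast sigma_pos hn)]
    exact_mod_cast Finset.single_le_sum (f := fun d => d) (fun _ _ => Nat.zero_le _)
      (Nat.mem_divisors_self n hn.ne')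

theorem div_sigma_lt_one {n : ℕ} (hn : 1 < n) : (n : ℝ) / sigma n < 1 := by
  rw [div_lt_one (by exact_mod_cast sigma_pos (by omega))]
  exact_mod_cast Finset.single_lt_sum (f := fun d => d) (i := n) (j := 1) hn.ne
    (Nat.mem_divisors_self n (by omega)) (by simp; omega) one_pos fun _ _ _ => Nat.zero_le _

theorem pred_div_lt_prime_pow_div_sigma {p : ℕ} (hp : p.Prime) (e : ℕ) :
    ((p - 1 : ℕ) : ℝ) / p < ((p ^ e : ℕ) : ℝ) / sigma (p ^ e) := by
  rw [← prime_pow_div_sigma_mul hp e]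
  have h1 : 0 < p ^ (e + 1) := Nat.pow_pos hp.pos
  have h2 : (0 : ℝ) < ((p ^ e : ℕ) : ℝ) / sigma (p ^ e) := by
    have := sigma_pos (Nat.pow_pos (n := e) hp.pos)
    have := Nat.pow_pos (n := e) hp.pos
    positivity
  refine mul_lt_of_lt_one_right h2 ?_
  rw [div_lt_one (by exact_mod_cast h1)]
  exact_mod_cast Nat.sub_lt h1 one_pos

theorem prod_pred_div_le_div_sigma {n : ℕ} (hn : n ≠ 0) :
    ∏ p ∈ n.primeFactors, ((p - 1 : ℕ) : ℝ) / p ≤ (n : ℝ) / sigma n := by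
  rw [div_sigma_eq_prod hn]
  exact Finset.prod_le_prod (fun p _ => by positivity) fun p hp =>
    (pred_div_lt_prime_pow_div_sigma (Nat.prime_of_mem_primeFactors hp) _).le

theorem prod_pred_div_lt_div_sigma {n : ℕ} (hn : 1 < n) :
    ∏ p ∈ n.primeFactors, ((p - 1 : ℕ) : ℝ) / p < (n : ℝ) / sigma n := by
  rw [div_sigma_eq_prod (by omega)]
  refine Finset.prod_lt_prod_of_nonempty (fun p hp => ?_) (fun p hp =>
    pred_div_lt_prime_pow_div_sigma (Nat.prime_of_mem_primeFactors hp) _)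
    (Nat.nonempty_primeFactors.2 hn)
  have := (Nat.prime_of_mem_primeFactors hp).one_lt
  have h1 : 0 < p - 1 := by omega
  positivity

theorem sum_div_mul_prod_eq_natCast {ι : Type*} [DecidableEq ι] (s : Finset ι) (a b : ι → ℕ)
    (hb : ∀ i ∈ s, b i ≠ 0) :
    (∑ i ∈ s, (a i : ℝ) / b i) * (∏ i ∈ s, b i : ℕ) =
      (∑ i ∈ s, a i * ∏ j ∈ s.erase i, b j : ℕ) := by
  rw [Finset.sum_mul]
  push_cast
  refine Finset.sum_congr rfl fun i hi => ?_
  rw [← Finset.mul_prod_erase s _ hi]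
  have : (b i : ℝ) ≠ 0 := by exact_mod_cast hb i hi
  field_simp

section

variable {ι : Type*} [Fintype ι]

/-- The sum `∑ V i / σ (V i) * ∏ (1 - 1 / p)`, the inner product being over the primes `p ∈ S`
dividing `U i`. -/
noncomputable def truncatedSum (U V : ι → ℕ) (S : Finset ℕ) : ℝ :=
  ∑ i, (V i : ℝ) / sigma (V i) * ∏ p ∈ S with p ∣ U i, ((p - 1 : ℕ) : ℝ) / p

theorem prod_prod_filter_dvd {R : Type*} [CommMonoid R] {U : ι → ℕ}
    (hU : Pairwise fun i j => (U i).Coprime (U j)) {S : Finset ℕ}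
    (hS : ∀ p ∈ S, p.Prime ∧ p ∣ ∏ i, U i) (g : ℕ → R) :
    ∏ i, ∏ p ∈ S with p ∣ U i, g p = ∏ p ∈ S, g p := by
  classical
  simp only [Finset.prod_filter]
  rw [Finset.prod_comm]
  refine Finset.prod_congr rfl fun p hp => ?_
  obtain ⟨hp, hdvd⟩ := hS p hp
  obtain ⟨i, -, hi⟩ := (hp.prime.dvd_finsetProd_iff _).1 hdvd
  rw [Finset.prod_eq_single i (fun j _ hj => if_neg fun h => ?_) (by simp), if_pos hi]
  exact Nat.not_coprime_of_dvd_of_dvd hp.one_lt h hi (hU hj)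

/-- A sum of fractions in which exactly one denominator is divisible by `p`, its numerator being
prime to `p`, is not equal to `1`. -/
theorem sum_div_ne_one [DecidableEq ι] {p : ℕ} (hp : p.Prime) (a b : ι → ℕ) (hb : ∀ i, b i ≠ 0)
    (i : ι) (hbi : p ∣ b i) (hai : ¬ p ∣ a i) (hbj : ∀ j, j ≠ i → ¬ p ∣ b j) :
    ∑ j, (a j : ℝ) / b j ≠ 1 := by
  intro h
  rw [← Finset.add_sum_erase _ _ (Finset.mem_univ i)] at h
  have hB := sum_div_mul_prod_eq_natCast (Finset.univ.erase i) a b fun j _ => hb j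
  set B := ∏ j ∈ Finset.univ.erase i, b j
  set Z := ∑ l ∈ Finset.univ.erase i, a l * ∏ j ∈ (Finset.univ.erase i).erase l, b j
  have hbi0 : (b i : ℝ) ≠ 0 := by exact_mod_cast hb i
  have e : (a i : ℝ) * B + b i * Z = b i * B := by
    rw [← hB]
    have : (a i : ℝ) = b i * ((a i : ℝ) / b i) := by field_simp
    rw [this]
    linear_combination (b i : ℝ) * B * h
  have e' : a i * B + b i * Z = b i * B := by exact_mod_cast e
  have hdvd : p ∣ a i * B :=
    (Nat.dvd_add_left (hbi.mul_right Z)).1 (e' ▸ hbi.mul_right B)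
  rcases hp.dvd_mul.1 hdvd with h' | h'
  · exact hai h'
  · obtain ⟨j, hj, hpj⟩ := (hp.prime.dvd_finsetProd_iff _).1 h'
    exact hbj j (Finset.ne_of_mem_erase hj) hpj

theorem truncatedSum_eq (U V : ι → ℕ) (S : Finset ℕ) :
    truncatedSum U V S = ∑ i, ((V i * ∏ p ∈ S with p ∣ U i, (p - 1) : ℕ) : ℝ) /
      (sigma (V i) * ∏ p ∈ S with p ∣ U i, p : ℕ) := by
  refine Finset.sum_congr rfl fun i _ => ?_
  rw [Finset.prod_div_distrib, div_mul_div_comm]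
  push_cast
  rfl

theorem truncatedSum_pos [Nonempty ι] {U V : ι → ℕ} (hV : ∀ i, 0 < V i) {S : Finset ℕ}
    (hS : ∀ p ∈ S, p.Prime) : 0 < truncatedSum U V S := by
  refine Finset.sum_pos (fun i _ => mul_pos ?_ (Finset.prod_pos fun p hp => ?_))
    Finset.univ_nonempty
  · have := sigma_pos (hV i)
    have := hV i
    positivity
  · have := (hS p (Finset.mem_filter.1 hp).1).one_lt
    have h1 : 0 < p - 1 := by omega
    positivity

theorem exists_truncatedSum_mul_eq_natCast {U V : ι → ℕ} (hV : ∀ i, 0 < V i)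
    (hUcop : Pairwise fun i j => (U i).Coprime (U j))
    (hVcop : Pairwise fun i j => (V i).Coprime (V j)) {S : Finset ℕ}
    (hS : ∀ p ∈ S, p.Prime ∧ p ∣ ∏ i, U i) :
    ∃ N : ℕ, truncatedSum U V S * (sigma (∏ i, V i) * PiS S : ℕ) = N := by
  classical
  have hb : ∀ i, sigma (V i) * ∏ p ∈ S with p ∣ U i, p ≠ 0 := fun i =>
    mul_ne_zero (sigma_pos (hV i)).ne' (Finset.prod_ne_zero_iff.2 fun p hp =>
      (hS p (Finset.mem_filter.1 hp).1).1.ne_zero)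
  have h := sum_div_mul_prod_eq_natCast Finset.univ
    (fun i => V i * ∏ p ∈ S with p ∣ U i, (p - 1)) _ fun i _ => hb i
  rw [← truncatedSum_eq, Finset.prod_mul_distrib, prod_prod_filter_dvd hUcop hS fun p => p,
    ← sigma_prod _ _ fun i _ j _ hij => hVcop hij] at h
  exact ⟨_, h⟩

theorem truncatedSum_mul_prod_le {U V : ι → ℕ} {S Q : Finset ℕ} (hSQ : S ⊆ Q) :
    truncatedSum U V S * ∏ p ∈ Q \ S, ((p - 1 : ℕ) : ℝ) / p ≤ truncatedSum U V Q := by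
  rw [truncatedSum, Finset.sum_mul]
  refine Finset.sum_le_sum fun i _ => ?_
  have hle1 : ∀ p : ℕ, ((p - 1 : ℕ) : ℝ) / p ≤ 1 := fun p =>
    div_le_one_of_le₀ (by exact_mod_cast Nat.sub_le p 1) (by positivity)
  have hQ : ∏ p ∈ Q with p ∣ U i, ((p - 1 : ℕ) : ℝ) / p =
      (∏ p ∈ S with p ∣ U i, ((p - 1 : ℕ) : ℝ) / p) *
        ∏ p ∈ Q \ S with p ∣ U i, ((p - 1 : ℕ) : ℝ) / p := by
    rw [← Finset.prod_sdiff (s₁ := S.filter (· ∣ U i)) (s₂ := Q.filter (· ∣ U i))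
      (Finset.filter_subset_filter _ hSQ), mul_comm]
    congr 1
    refine Finset.prod_congr ?_ fun _ _ => rfl
    ext p
    simp only [Finset.mem_filter, Finset.mem_sdiff]
    tauto
  rw [hQ, mul_assoc]
  refine mul_le_mul_of_nonneg_left (mul_le_mul_of_nonneg_left ?_
    (Finset.prod_nonneg fun p _ => by positivity)) (by positivity)
  exact Finset.prod_le_prod_of_subset_of_le_one (Finset.filter_subset _ _)
    (fun p _ => by positivity) fun p _ _ => hle1 p

theorem factorization_eq_of_dvd {U : ι → ℕ} (hUpos : ∀ i, 0 < U i)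
    (hU : Pairwise fun i j => (U i).Coprime (U j)) {p : ℕ} (hp : p.Prime) {i : ι}
    (hi : p ∣ U i) : (∏ j, U j).factorization p = (U i).factorization p := by
  classical
  rw [Nat.factorization_prod fun j _ => (hUpos j).ne', Finset.sum_apply',
    Finset.sum_eq_single i (fun j _ hj => ?_) (by simp)]
  exact Nat.factorization_eq_zero_of_not_dvd fun h =>
    Nat.not_coprime_of_dvd_of_dvd hp.one_lt h hi (hU hj)

theorem sum_div_sigma_mul_prod_le {U V : ι → ℕ} (hUpos : ∀ i, 0 < U i)
    (hUcop : Pairwise fun i j => (U i).Coprime (U j)) (hUV : ∀ i, (U i).Coprime (V i))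
    {S : Finset ℕ} (hS : ∀ p ∈ S, p.Prime ∧ p ∣ ∏ i, U i) :
    (∑ i, ((U i * V i : ℕ) : ℝ) / sigma (U i * V i)) *
        ∏ p ∈ S, (((p ^ ((∏ i, U i).factorization p + 1) - 1 : ℕ) : ℝ) /
          (p ^ ((∏ i, U i).factorization p + 1) : ℕ)) ≤ truncatedSum U V S := by
  set n : ℕ → ℝ := fun p => ((p ^ ((∏ i, U i).factorization p + 1) - 1 : ℕ) : ℝ) /
          (p ^ ((∏ i, U i).factorization p + 1) : ℕ) with hn
  have hn0 : ∀ p, 0 ≤ n p := fun p => by positivity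
  have hn1 : ∀ p, n p ≤ 1 := fun p =>
    div_le_one_of_le₀ (by exact_mod_cast Nat.sub_le _ 1) (by positivity)
  rw [Finset.sum_mul]
  refine Finset.sum_le_sum fun i _ => ?_
  rw [sigma_mul_of_coprime (hUV i), Nat.cast_mul, Nat.cast_mul, mul_div_mul_comm,
    mul_comm ((U i : ℝ) / _), mul_assoc]
  gcongr
  have hsub : (S.filter (· ∣ U i)) ⊆ (U i).primeFactors := fun p hp => by
    obtain ⟨hp, hi⟩ := Finset.mem_filter.1 hp
    exact Nat.mem_primeFactors.2 ⟨(hS p hp).1, hi, (hUpos i).ne'⟩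
  calc (U i : ℝ) / sigma (U i) * ∏ p ∈ S, n p
      ≤ (∏ p ∈ S with p ∣ U i, ((p ^ (U i).factorization p : ℕ) : ℝ) /
          sigma (p ^ (U i).factorization p)) * ∏ p ∈ S with p ∣ U i, n p := by
        refine mul_le_mul ?_ ?_ (Finset.prod_nonneg fun p _ => hn0 p)
          (Finset.prod_nonneg fun p _ => by positivity)
        · rw [div_sigma_eq_prod (hUpos i).ne']
          exact Finset.prod_le_prod_of_subset_of_le_one hsub (fun p _ => by positivity)
            fun p _ _ => div_sigma_le_one _
        · exact Finset.prod_le_prod_of_subset_of_le_one (Finset.filter_subset _ _)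
            (fun p _ => hn0 p) fun p _ _ => hn1 p
    _ = ∏ p ∈ S with p ∣ U i, ((p - 1 : ℕ) : ℝ) / p := by
        rw [← Finset.prod_mul_distrib]
        refine Finset.prod_congr rfl fun p hp => ?_
        obtain ⟨hp, hi⟩ := Finset.mem_filter.1 hp
        rw [hn]
        simp only
        rw [factorization_eq_of_dvd hUpos hUcop (hS p hp).1 hi]
        exact prime_pow_div_sigma_mul (hS p hp).1 _

theorem sum_mul_div_sigma_lt {U V : ι → ℕ} (hVpos : ∀ i, 0 < V i) {x y : ℕ → ℝ}
    (hxy : ∀ i, x (U i) ≤ y (U i)) {i : ι} (hi : x (U i) < y (U i)) :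
    ∑ i, (V i : ℝ) / sigma (V i) * x (U i) < ∑ i, (V i : ℝ) / sigma (V i) * y (U i) := by
  have hV : ∀ i, (0 : ℝ) < (V i : ℝ) / sigma (V i) := fun i => by
    have := sigma_pos (hVpos i)
    have := hVpos i
    positivity
  exact Finset.sum_lt_sum (fun j _ => mul_le_mul_of_nonneg_left (hxy j) (hV j).le)
    ⟨i, Finset.mem_univ i, mul_lt_mul_of_pos_left hi (hV i)⟩

theorem sum_div_sigma_mul_eq {U V : ι → ℕ} (hUV : ∀ i, (U i).Coprime (V i)) :
    ∑ i, ((U i * V i : ℕ) : ℝ) / sigma (U i * V i) =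
      ∑ i, (V i : ℝ) / sigma (V i) * ((U i : ℝ) / sigma (U i)) := by
  refine Finset.sum_congr rfl fun i _ => ?_
  rw [sigma_mul_of_coprime (hUV i), Nat.cast_mul, Nat.cast_mul, mul_div_mul_comm, mul_comm]

theorem exists_one_lt_of_one_lt_prod {U : ι → ℕ} (hU : 1 < ∏ i, U i) : ∃ i, 1 < U i := by
  by_contra! h
  exact hU.not_ge (Finset.prod_le_one' fun i _ => h i)

theorem truncatedSum_primeFactors_lt {U V : ι → ℕ} (hUpos : ∀ i, 0 < U i) (hVpos : ∀ i, 0 < V i)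
    (hUV : ∀ i, (U i).Coprime (V i)) (hU : 1 < ∏ i, U i) :
    truncatedSum U V (∏ i, U i).primeFactors < ∑ i, ((U i * V i : ℕ) : ℝ) / sigma (U i * V i) := by
  have hfilter : ∀ i, ((∏ i, U i).primeFactors.filter (· ∣ U i)) = (U i).primeFactors := by
    intro i
    ext p
    have := Finset.dvd_prod_of_mem U (Finset.mem_univ i)
    simp only [Finset.mem_filter, Nat.mem_primeFactors]
    exact ⟨fun h => ⟨h.1.1, h.2, (hUpos i).ne'⟩,
      fun h => ⟨⟨h.1, h.2.1.trans this, by omega⟩, h.2.1⟩⟩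
  obtain ⟨i, hi⟩ := exists_one_lt_of_one_lt_prod hU
  simp only [truncatedSum, hfilter]
  rw [sum_div_sigma_mul_eq hUV]
  exact sum_mul_div_sigma_lt (x := fun n => ∏ p ∈ n.primeFactors, ((p - 1 : ℕ) : ℝ) / p)
    (y := fun n => (n : ℝ) / sigma n) hVpos
    (fun j => prod_pred_div_le_div_sigma (hUpos j).ne') (prod_pred_div_lt_div_sigma hi)

theorem lt_truncatedSum_empty {U V : ι → ℕ} (hVpos : ∀ i, 0 < V i)
    (hUV : ∀ i, (U i).Coprime (V i)) (hU : 1 < ∏ i, U i) :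
    ∑ i, ((U i * V i : ℕ) : ℝ) / sigma (U i * V i) < truncatedSum U V ∅ := by
  obtain ⟨i, hi⟩ := exists_one_lt_of_one_lt_prod hU
  rw [sum_div_sigma_mul_eq hUV]
  simp only [truncatedSum, Finset.filter_empty, Finset.prod_empty]
  exact sum_mul_div_sigma_lt (x := fun n => (n : ℝ) / sigma n) (y := fun _ => 1) hVpos
    (fun j => div_sigma_le_one _) (div_sigma_lt_one hi)

theorem truncatedSum_ne_one {U V : ι → ℕ} (hVpos : ∀ i, 0 < V i)
    (hUV : ∀ i, (U i).Coprime (V i)) (hU : 1 < ∏ i, U i)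
    (hanarchy : Pairwise fun i j => (U i * V i).Coprime (U j * V j * sigma (U j * V j)))
    (hharm : ∑ i, ((U i * V i : ℕ) : ℝ) / sigma (U i * V i) = 1)
    {S : Finset ℕ} (hS : ∀ p ∈ S, p.Prime ∧ p ∣ ∏ i, U i) : truncatedSum U V S ≠ 1 := by
  classical
  rcases S.eq_empty_or_nonempty with rfl | hne
  · rw [← hharm]
    exact (lt_truncatedSum_empty hVpos hUV hU).ne'
  obtain ⟨p, hpS, hmax⟩ := S.exists_max_image id hne
  obtain ⟨hp, hdvd⟩ := hS p hpS
  obtain ⟨i, -, hi⟩ := (hp.prime.dvd_finsetProd_iff _).1 hdvd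
  have hiM : p ∣ U i * V i := hi.mul_right _
  rw [truncatedSum_eq]
  refine sum_div_ne_one hp _ _ (fun j => ?_) i ?_ ?_ fun j hj hpj => ?_
  · exact mul_ne_zero (sigma_pos (hVpos j)).ne' (Finset.prod_ne_zero_iff.2 fun q hq =>
      (hS q (Finset.mem_filter.1 hq).1).1.ne_zero)
  · exact (Finset.dvd_prod_of_mem (fun q => q) (Finset.mem_filter.2 ⟨hpS, hi⟩)).mul_left _
  · intro h
    rcases hp.dvd_mul.1 h with h | h
    · exact Nat.not_coprime_of_dvd_of_dvd hp.one_lt hi h (hUV i)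
    · obtain ⟨q, hq, hpq⟩ := (hp.prime.dvd_finsetProd_iff _).1 h
      have hqS := (Finset.mem_filter.1 hq).1
      have h1 := (hS q hqS).1.one_lt
      have h2 : q ≤ p := hmax q hqS
      have := Nat.le_of_dvd (by omega) hpq
      omega
  · have hcop := hanarchy hj.symm
    refine Nat.not_coprime_of_dvd_of_dvd hp.one_lt hiM ?_ hcop
    rcases hp.dvd_mul.1 hpj with h | h
    · rw [sigma_mul_of_coprime (hUV j)]
      exact (h.mul_left _).mul_left _
    · obtain ⟨q, hq, hpq⟩ := (hp.prime.dvd_finsetProd_iff _).1 h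
      obtain ⟨hqS, hqj⟩ := Finset.mem_filter.1 hq
      exact ((hpq.trans hqj).mul_right _).mul_right _

/-- For a set `B` of primes, split off the `B`-part of each of the pairwise coprime `U i`. -/
theorem exists_split_prime_powers {U : ι → ℕ} (hUpos : ∀ i, 0 < U i)
    (hUcop : Pairwise fun i j => (U i).Coprime (U j)) {B : Finset ℕ}
    (hB : ∀ p ∈ B, p.Prime ∧ p ∣ ∏ i, U i) :
    ∃ U' W : ι → ℕ, (∀ i, U i = U' i * W i) ∧ (∀ i, (U' i).Coprime (W i)) ∧
      ∏ i, W i = ∏ p ∈ B, p ^ (∏ i, U i).factorization p := by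
  refine ⟨fun i => ∏ p ∈ (U i).primeFactors \ B, p ^ (U i).factorization p,
    fun i => ∏ p ∈ B with p ∣ U i, p ^ (∏ i, U i).factorization p, fun i => ?_, fun i => ?_,
    prod_prod_filter_dvd hUcop hB _⟩
  · have hinter : (U i).primeFactors \ ((U i).primeFactors \ B) = B.filter (· ∣ U i) := by
      ext p
      have := hUpos i
      simp only [Finset.mem_sdiff, Finset.mem_filter, Nat.mem_primeFactors]
      constructor
      · tauto
      · exact fun h => ⟨⟨(hB p h.1).1, h.2, this.ne'⟩, fun h' => h'.2 h.1⟩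
    have hcongr : ∏ p ∈ B with p ∣ U i, p ^ (∏ i, U i).factorization p =
        ∏ p ∈ B with p ∣ U i, p ^ (U i).factorization p :=
      Finset.prod_congr rfl fun p hp => by
        obtain ⟨hp, hi⟩ := Finset.mem_filter.1 hp
        rw [factorization_eq_of_dvd hUpos hUcop (hB p hp).1 hi]
    simp only
    rw [hcongr, ← hinter, mul_comm, Finset.prod_sdiff Finset.sdiff_subset]
    exact (Nat.prod_factorization_pow_eq_self (hUpos i).ne').symm
  · refine Nat.Coprime.prod_left fun p hp => Nat.Coprime.prod_right fun q hq => ?_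
    obtain ⟨hp, hpB⟩ := Finset.mem_sdiff.1 hp
    have hqB := (Finset.mem_filter.1 hq).1
    exact Nat.coprime_pow_primes _ _ (Nat.prime_of_mem_primeFactors hp) (hB q hqB).1
      fun h => hpB (h ▸ hqB)

theorem primeFactors_prod_prime_pow {B : Finset ℕ} (hB : ∀ p ∈ B, p.Prime) {e : ℕ → ℕ}
    (he : ∀ p ∈ B, e p ≠ 0) : (∏ p ∈ B, p ^ e p).primeFactors = B := by
  ext p
  have h0 : ∏ p ∈ B, p ^ e p ≠ 0 :=
    Finset.prod_ne_zero_iff.2 fun q hq => pow_ne_zero _ (hB q hq).ne_zero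
  rw [Nat.mem_primeFactors]
  constructor
  · rintro ⟨hp, hdvd, -⟩
    obtain ⟨q, hq, hpq⟩ := (hp.prime.dvd_finsetProd_iff _).1 hdvd
    rwa [(Nat.prime_dvd_prime_iff_eq hp (hB q hq)).1 (hp.dvd_of_dvd_pow hpq)]
  · exact fun hp => ⟨hB p hp,
      (dvd_pow_self p (he p hp)).trans (Finset.dvd_prod_of_mem (fun q => q ^ e q) hp), h0⟩

theorem sigma_prod_prime_pow_mul_PhiS {B : Finset ℕ} (hB : ∀ p ∈ B, p.Prime) (e : ℕ → ℕ) :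
    sigma (∏ p ∈ B, p ^ e p) * PhiS B = ∏ p ∈ B, (p ^ (e p + 1) - 1) := by
  rw [sigma_prod _ _ fun p hp q hq hpq => Nat.coprime_pow_primes _ _ (hB p hp) (hB q hq) hpq,
    PhiS, ← Finset.prod_mul_distrib]
  exact Finset.prod_congr rfl fun p hp => by
    rw [← sigma_prime_pow_mul_add_one (hB p hp), Nat.add_sub_cancel]

/-- If the truncated sum over `T` is less than `1`, then some of the prime powers at primes of `T`
are small. -/
theorem exists_small_prime_powers [Nonempty ι] {U V : ι → ℕ} (hUpos : ∀ i, 0 < U i)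
    (hVpos : ∀ i, 0 < V i) (hUcop : Pairwise fun i j => (U i).Coprime (U j))
    (hUV : ∀ i, (U i).Coprime (V i))
    (hharm : ∑ i, ((U i * V i : ℕ) : ℝ) / sigma (U i * V i) = 1)
    {T : Finset ℕ} (hT : ∀ p ∈ T, p.Prime ∧ p ∣ ∏ i, U i) {N D : ℕ}
    (hN : truncatedSum U V T * D = N) (hND : N < D) :
    ∃ B ⊆ T, B.Nonempty ∧
      D * ∏ p ∈ B, (p ^ ((∏ i, U i).factorization p + 1) - 1) + D ^ 2 ^ (B.card - 1) ≤
        D ^ 2 ^ B.card := by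
  have hN0 : 0 < N := by
    have hD0 : (0 : ℝ) < D := by exact_mod_cast (Nat.zero_le N).trans_lt hND
    have := mul_pos (truncatedSum_pos (U := U) hVpos fun p hp => (hT p hp).1) hD0
    rw [hN] at this
    exact_mod_cast this
  obtain ⟨a, rfl⟩ : ∃ a, D = a + 1 := ⟨D - 1, by omega⟩
  set n : ℕ → ℕ := fun p => p ^ ((∏ i, U i).factorization p + 1) with hn
  have hn2 : ∀ p ∈ T, 2 ≤ n p := fun p hp =>
    (hT p hp).1.two_le.trans (Nat.le_self_pow (by omega) p)
  have hpred : ∀ R ⊆ T, ∏ p ∈ R, (n p - 1 + 1) = ∏ p ∈ R, n p := fun R hR =>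
    Finset.prod_congr rfl fun p hp => by have := hn2 p (hR hp); omega
  have hmul := sum_div_sigma_mul_prod_le hUpos hUcop hUV hT
  rw [hharm, one_mul, Finset.prod_div_distrib, ← Nat.cast_prod, ← Nat.cast_prod] at hmul
  have hcond : (a + 1) * ∏ p ∈ T, (n p - 1) ≤ a * ∏ p ∈ T, (n p - 1 + 1) := by
    rw [hpred T subset_rfl]
    refine le_trans ?_ (Nat.mul_le_mul_right _ (Nat.lt_succ_iff.1 hND))
    have hpos : (0 : ℝ) < (∏ p ∈ T, n p : ℕ) := by
      exact_mod_cast Finset.prod_pos fun p hp => by have := hn2 p hp; omega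
    rw [div_le_iff₀ hpos] at hmul
    have : ((a + 1 : ℕ) : ℝ) * (∏ p ∈ T, (n p - 1) : ℕ) ≤ N * (∏ p ∈ T, n p : ℕ) := by
      rw [← hN]
      nlinarith [mul_le_mul_of_nonneg_left hmul (Nat.cast_nonneg (α := ℝ) (a + 1))]
    exact_mod_cast this
  obtain ⟨B, hBT, hB, hle, hbound⟩ := exists_subset_prod_bound T (fun p => n p - 1)
    (fun p hp => by have := hn2 p hp; omega) (by omega) (Nat.lt_succ_self a) hcond
  exact ⟨B, hBT, hB, (Nat.add_le_add_right hle _).trans hbound⟩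

end

theorem cast_le_F {A x r : ℕ} (hr : r ≠ 0) (h : A + x ^ 2 ^ (r - 1) ≤ x ^ 2 ^ r) :
    (A : ℝ) ≤ F r x := by
  rw [F, if_neg hr]
  have : (A : ℝ) + (x : ℝ) ^ 2 ^ (r - 1) ≤ (x : ℝ) ^ 2 ^ r := by exact_mod_cast h
  linarith

theorem amicable_tuples_stmt11 (k : ℕ) (hk : 2 ≤ k) (M U V : Fin k → ℕ)
    (hpos : ∀ i, 0 < M i) (hdist : Function.Injective M)
    (hanarchy : ∀ i j, i ≠ j → Nat.gcd (M i) (M j * sigma (M j)) = 1)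
    (hharm : ∑ i, (M i : ℝ) / (sigma (M i) : ℝ) = 1)
    (hdec : ∀ i, M i = U i * V i) (hUV : ∀ i, Nat.gcd (U i) (V i) = 1)
    (hU : 1 < ∏ i, U i)
    (S : Finset ℕ) (hS : ∀ p ∈ S, p.Prime ∧ p ∣ ∏ i, U i) :
    ∃ U' V' : Fin k → ℕ,
      (∀ i, M i = U' i * V' i) ∧ (∀ i, Nat.gcd (U' i) (V' i) = 1) ∧
      (∏ i, V i) ∣ (∏ i, V' i) ∧
      Nat.gcd (∏ i, V i) ((∏ i, V' i) / ∏ i, V i) = 1 ∧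
      ∃ S' : Finset ℕ, (∀ p ∈ S', p.Prime ∧ p ∣ ∏ i, U' i) ∧
        letI P' : Finset ℕ := (∏ i, V' i).primeFactors \ (∏ i, V i).primeFactors
        letI v : ℕ := P'.card
        1 ≤ v ∧
        ∃ w : ℕ, (w : ℤ) = (v : ℤ) + (S'.card : ℤ) - (S.card : ℤ) ∧
          ((sigma (∏ i, V' i) * PiS S' * PsiS P' : ℕ) : ℝ) ≤
            F (v + w) (((sigma (∏ i, V i) * PiS S : ℕ) : ℝ) + 1) ∧
          (w = 0 →
            ((sigma (∏ i, V' i) * PiS S' * PsiS P' : ℕ) : ℝ) ≤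
              F (v + w) ((sigma (∏ i, V i) * PiS S : ℕ) : ℝ)) := by
  have : Nonempty (Fin k) := ⟨⟨0, by omega⟩⟩
  have hUpos : ∀ i, 0 < U i := fun i => Nat.pos_of_mul_pos_right (hdec i ▸ hpos i)
  have hVpos : ∀ i, 0 < V i := fun i => Nat.pos_of_mul_pos_left (hdec i ▸ hpos i)
  obtain rfl : M = fun i => U i * V i := funext hdec
  have hMcop : Pairwise fun i j => (U i * V i).Coprime (U j * V j * sigma (U j * V j)) :=
    fun i j hij => hanarchy i j hij
  have hcop : Pairwise fun i j => (U i * V i).Coprime (U j * V j) := fun i j hij =>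
    (hMcop hij).coprime_mul_right_right
  have hUcop : Pairwise fun i j => (U i).Coprime (U j) := fun i j hij =>
    (hcop hij).coprime_mul_right.coprime_mul_right_right
  have hVcop : Pairwise fun i j => (V i).Coprime (V j) := fun i j hij =>
    (hcop hij).coprime_mul_left.coprime_mul_left_right
  have hUVcop : (∏ i, U i).Coprime (∏ i, V i) :=
    Nat.Coprime.prod_left fun i _ => Nat.Coprime.prod_right fun j _ => by
      rcases eq_or_ne i j with rfl | hij
      · exact hUV i
      · exact (hcop hij).coprime_mul_right.coprime_mul_left_right
  have hQ : ∀ {S}, S ⊆ (∏ i, U i).primeFactors → ∀ p ∈ S, p.Prime ∧ p ∣ ∏ i, U i :=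
    fun h p hp => ⟨Nat.prime_of_mem_primeFactors (h hp), Nat.dvd_of_mem_primeFactors (h hp)⟩
  have hU0 : ∏ i, U i ≠ 0 := by omega
  have hSQ : S ⊆ (∏ i, U i).primeFactors := fun p hp =>
    Nat.mem_primeFactors.2 ⟨(hS p hp).1, (hS p hp).2, hU0⟩
  have hC : 0 < sigma (∏ i, V i) := sigma_pos (Finset.prod_pos fun i _ => hVpos i)
  have hPiS : ∀ S ⊆ (∏ i, U i).primeFactors, 0 < PiS S := fun S hS =>
    Finset.prod_pos fun p hp => (hQ hS p hp).1.pos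
  have hD : ∀ S ⊆ (∏ i, U i).primeFactors, (0 : ℝ) < (sigma (∏ i, V i) * PiS S : ℕ) :=
    fun S hS => by exact_mod_cast Nat.mul_pos hC (hPiS S hS)
  have hex : ∀ S, ∃ N : ℕ, S ⊆ (∏ i, U i).primeFactors →
      truncatedSum U V S * (sigma (∏ i, V i) * PiS S : ℕ) = N := fun S => by
    by_cases h : S ⊆ (∏ i, U i).primeFactors
    · obtain ⟨N, hN⟩ := exists_truncatedSum_mul_eq_natCast hVpos hUcop hVcop (hQ h)
      exact ⟨N, fun _ => hN⟩
    · exact ⟨0, fun h' => absurd h' h⟩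
  choose N hN using hex
  obtain ⟨T, hST, hTQ, hNT, hDT⟩ := exists_superset_num_lt_den (∏ i, U i).primeFactors
    (fun p hp => (Nat.prime_of_mem_primeFactors hp).two_le) _ hC N
    (fun R hR h => by
      have h1 := hN R hR
      rw [h] at h1
      exact truncatedSum_ne_one hVpos hUV hU hMcop hharm (hQ hR)
        (mul_right_cancel₀ (hD R hR).ne' (h1.trans (one_mul _).symm)))
    (by
      have h1 := truncatedSum_primeFactors_lt hUpos hVpos hUV hU
      rw [hharm] at h1
      have h2 := mul_lt_mul_of_pos_right h1 (hD _ subset_rfl)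
      rw [hN _ subset_rfl, one_mul] at h2
      exact_mod_cast h2)
    (fun R hR => by
      have h1 := truncatedSum_mul_prod_le (U := U) (V := V) hR
      have h2 := mul_le_mul_of_nonneg_right h1 (hD _ subset_rfl).le
      rw [hN _ subset_rfl, Finset.prod_div_distrib] at h2
      have h3 : (PiS (∏ i, U i).primeFactors : ℝ) =
          (∏ p ∈ (∏ i, U i).primeFactors \ R, (p : ℝ)) * PiS R := by
        rw [PiS, ← Finset.prod_sdiff hR, PiS]
        push_cast
        rfl
      have h4 : ∏ p ∈ (∏ i, U i).primeFactors \ R, (p : ℝ) ≠ 0 :=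
        Finset.prod_ne_zero_iff.2 fun p hp => by
          exact_mod_cast (hQ Finset.sdiff_subset p hp).1.ne_zero
      have h5 : (N R : ℝ) * ∏ p ∈ (∏ i, U i).primeFactors \ R, ((p - 1 : ℕ) : ℝ) ≤
          N (∏ i, U i).primeFactors := by
        refine le_of_eq_of_le ?_ h2
        rw [← hN R hR, Nat.cast_mul, Nat.cast_mul, h3]
        field_simp
      exact_mod_cast h5) S hSQ
  obtain ⟨B, hBT, hB, hBbound⟩ := exists_small_prime_powers hUpos hVpos hUcop hUV hharm (hQ hTQ)
    (hN T hTQ) hNT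
  have hBQ := hQ (hBT.trans hTQ)
  obtain ⟨U', W, hUW, hUWcop, hW⟩ := exists_split_prime_powers hUpos hUcop hBQ
  have hWfactors : (∏ i, W i).primeFactors = B := by
    rw [hW]
    exact primeFactors_prod_prime_pow (fun p hp => (hBQ p hp).1) fun p hp =>
      ((hBQ p hp).1.factorization_pos_of_dvd hU0 (hBQ p hp).2).ne'
  have hUprod : ∏ i, U i = (∏ i, U' i) * ∏ i, W i := by
    rw [← Finset.prod_mul_distrib]
    exact Finset.prod_congr rfl fun i _ => hUW i
  have hWV : (∏ i, W i).Coprime (∏ i, V i) :=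
    hUVcop.coprime_dvd_left (hUprod ▸ Dvd.intro_left _ rfl)
  have hV'prod : ∏ i, W i * V i = (∏ i, W i) * ∏ i, V i := Finset.prod_mul_distrib
  have hVprod0 : 0 < ∏ i, V i := Finset.prod_pos fun i _ => hVpos i
  have hP : (∏ i, W i * V i).primeFactors \ (∏ i, V i).primeFactors = B := by
    rw [hV'prod, hWV.primeFactors_mul, Finset.union_sdiff_right, hWfactors, ← hWfactors]
    exact Finset.sdiff_eq_self_of_disjoint hWV.disjoint_primeFactors
  have hvalue : sigma (∏ i, W i * V i) * PiS (T \ B) * PsiS B = sigma (∏ i, V i) * PiS T *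
      ∏ p ∈ B, (p ^ ((∏ i, U i).factorization p + 1) - 1) := by
    have h1 : PiS T = PiS (T \ B) * PiS B := (Finset.prod_sdiff hBT).symm
    rw [← sigma_prod_prime_pow_mul_PhiS (fun p hp => (hBQ p hp).1), ← hW, hV'prod,
      sigma_mul_of_coprime hWV, h1, PsiS]
    ring
  have hcardST := Finset.card_le_card hST
  have hcardBT := Finset.card_le_card hBT
  have hcardB := hB.card_pos
  refine ⟨U', fun i => W i * V i, fun i => ?_, fun i => ?_, ?_, ?_, T \ B, fun p hp => ?_, ?_⟩
  · simp only
    rw [hUW i, mul_assoc]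
  · exact Nat.Coprime.mul_right (hUWcop i)
      (Nat.Coprime.coprime_dvd_left (hUW i ▸ Dvd.intro _ rfl) (hUV i))
  · exact hV'prod ▸ Dvd.intro_left _ rfl
  · rw [hV'prod, Nat.mul_div_cancel _ hVprod0]
    exact hWV.symm
  · obtain ⟨hpT, hpB⟩ := Finset.mem_sdiff.1 hp
    obtain ⟨hp, hdvd⟩ := hQ hTQ p hpT
    refine ⟨hp, ?_⟩
    rw [hUprod] at hdvd
    rcases hp.dvd_mul.1 hdvd with h | h
    · exact h
    · refine absurd ?_ hpB
      rw [← hWfactors]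
      exact Nat.mem_primeFactors.2 ⟨hp, h, fun h0 => by simp [h0] at hUprod; omega⟩
  · rw [hP, hvalue]
    refine ⟨hcardB, T.card - S.card, ?_, ?_, fun hw => ?_⟩
    · rw [Finset.card_sdiff_of_subset hBT]
      omega
    · rw [← Nat.cast_add_one]
      refine cast_le_F (by omega) ?_
      obtain ⟨v, hv⟩ : ∃ v, B.card = v + 1 := ⟨B.card - 1, by omega⟩
      rw [hv, Nat.add_sub_cancel, pow_succ 2 v, pow_mul] at hBbound
      have hexp : v + 1 + (T.card - S.card) = v + (T.card - S.card) + 1 := by omega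
      rw [hv, hexp, Nat.add_sub_cancel, pow_succ 2 (v + _), pow_mul]
      refine add_le_sq_of_le (Nat.one_le_pow _ _ (Nat.mul_pos hC (hPiS T hTQ))) ?_ hBbound
      rw [add_comm v, pow_add, pow_mul]
      exact Nat.pow_le_pow_left (by omega) _
    · obtain rfl : S = T := Finset.eq_of_subset_of_card_le hST (by omega)
      rw [hw, add_zero]
      exact cast_le_F hcardB.ne' hBbound
end

section
/- Let k ≥ 2 and let (M_1, …, M_k) be an anarchy harmonious k-tuple with K = ω(M_1 ⋯ M_k), and let P be the set of all prime factors of M_1 ⋯ M_k. Then σ(M_1 ⋯ M_k) · Φ(P)/Π(P) ≤ F_{2K}(2) · Π(P)^{−2}. -/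
/-- The step `n ↦ n (n + 1)` of Sylvester's recursion. -/
def sylvesterStep (n : ℕ) : ℕ := n * (n + 1)

lemma sylvesterStep_mono : Monotone sylvesterStep := fun _ _ h =>
  Nat.mul_le_mul h (Nat.succ_le_succ h)

lemma iterate_sylvesterStep_pos {D : ℕ} (hD : 0 < D) (n : ℕ) : 0 < sylvesterStep^[n] D := by
  induction n with
  | zero => simpa
  | succ n ih =>
    rw [Function.iterate_succ_apply']
    exact Nat.mul_pos ih (Nat.succ_pos _)

lemma iterate_sylvesterStep_one_lt (n : ℕ) : sylvesterStep^[n] 1 + 1 ≤ 2 ^ 2 ^ n := by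
  induction n with
  | zero => simp
  | succ n ih =>
    rw [Function.iterate_succ_apply', pow_succ, pow_mul, sylvesterStep]
    nlinarith

lemma iterate_sylvesterStep_one_le_F (n : ℕ) : ((sylvesterStep^[n] 1 : ℕ) : ℝ) ≤ F n 2 := by
  rcases n with _ | m
  · norm_num [F]
  have h : ((sylvesterStep^[m] 1 : ℕ) : ℝ) + 1 ≤ 2 ^ 2 ^ m := by
    exact_mod_cast iterate_sylvesterStep_one_lt m
  have h0 : (0 : ℝ) ≤ ((sylvesterStep^[m] 1 : ℕ) : ℝ) := Nat.cast_nonneg _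
  rw [F, if_neg (Nat.succ_ne_zero m), Function.iterate_succ_apply', sylvesterStep,
    Nat.add_sub_cancel, pow_succ 2 m, pow_mul]
  push_cast
  nlinarith

lemma prod_iterate_sylvesterStep_succ (D n : ℕ) :
    D * ∏ i ∈ Finset.range n, (sylvesterStep^[i] D + 1) = sylvesterStep^[n] D := by
  induction n with
  | zero => simp
  | succ n ih =>
    rw [Finset.prod_range_succ, ← mul_assoc, ih, Function.iterate_succ_apply', sylvesterStep]

lemma sum_inv_iterate_sylvesterStep_lt {D : ℕ} (hD : 0 < D) (n : ℕ) :
    ∑ i ∈ Finset.range n, ((sylvesterStep^[i] D + 1 : ℕ) : ℝ)⁻¹ < (D : ℝ)⁻¹ := by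
  have h : ∑ i ∈ Finset.range n, ((sylvesterStep^[i] D + 1 : ℕ) : ℝ)⁻¹ =
      (D : ℝ)⁻¹ - ((sylvesterStep^[n] D : ℕ) : ℝ)⁻¹ := by
    induction n with
    | zero => simp
    | succ n ih =>
      have h0 : (0 : ℝ) < (sylvesterStep^[n] D : ℕ) := by
        exact_mod_cast iterate_sylvesterStep_pos hD n
      rw [Finset.sum_range_succ, ih, Function.iterate_succ_apply', sylvesterStep]
      push_cast
      field_simp
      ring
  rw [h]
  have h0 : (0 : ℝ) < (sylvesterStep^[n] D : ℕ) := by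
    exact_mod_cast iterate_sylvesterStep_pos hD n
  linarith [inv_pos.2 h0]

lemma Finset.sum_inv_le_sum_inv_of_prod_le {ι : Type*} [DecidableEq ι] (J : Finset ι) (f : ι → ℝ)
    (z : ℕ → ℝ) (hf : ∀ j ∈ J, 0 < f j) (hz : ∀ i, 0 < z i)
    (h : ∀ I ⊆ J, ∏ i ∈ Finset.range I.card, z i ≤ ∏ j ∈ I, f j) :
    ∑ j ∈ J, (f j)⁻¹ ≤ ∑ i ∈ Finset.range J.card, (z i)⁻¹ := by
  suffices H : ∀ m : ℝ, 0 < m → (∀ j ∈ J, f j ≤ m) →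
      m⁻¹ * (∑ j ∈ J, Real.log (f j) - ∑ i ∈ Finset.range J.card, Real.log (z i)) ≤
        ∑ i ∈ Finset.range J.card, (z i)⁻¹ - ∑ j ∈ J, (f j)⁻¹ by
    obtain ⟨m, hm⟩ := (J.image f).bddAbove
    have hl := h J subset_rfl
    have hlog := Real.log_le_log (Finset.prod_pos fun i _ => hz i) hl
    rw [Real.log_prod (fun i _ => (hz i).ne'), Real.log_prod (fun j hj => (hf j hj).ne')] at hlog
    have := H (max m 1) (by positivity)
      fun j hj => le_max_of_le_left (hm (by simpa using ⟨j, hj, rfl⟩))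
    have h2 := mul_nonneg (inv_nonneg.2 (show (0 : ℝ) ≤ max m 1 by positivity)) (sub_nonneg.2 hlog)
    linarith
  induction J using Finset.induction_on_max_value f with
  | empty => simp
  | insert a s has hmax ih =>
    intro m hm hle
    have hfa : 0 < f a := hf a (Finset.mem_insert_self a s)
    have hs := ih (fun j hj => hf j (Finset.mem_insert_of_mem hj))
      (fun I hI => h I (hI.trans (Finset.subset_insert a s))) (f a) hfa hmax
    have hlog := Real.log_le_log (Finset.prod_pos fun i _ => hz i) (h (insert a s) subset_rfl)
    rw [Real.log_prod (fun i _ => (hz i).ne'), Real.log_prod (fun j hj => (hf j hj).ne')] at hlog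
    rw [Finset.card_insert_of_notMem has, Finset.sum_range_succ, Finset.sum_insert has] at hlog ⊢
    rw [Finset.sum_range_succ, Finset.sum_insert has]
    have hzs := hz s.card
    have hstep : (f a)⁻¹ * (Real.log (f a) - Real.log (z s.card)) ≤ (z s.card)⁻¹ - (f a)⁻¹ := by
      rw [← Real.log_div hfa.ne' hzs.ne']
      have := Real.log_le_sub_one_of_pos (div_pos hfa hzs)
      calc _ ≤ (f a)⁻¹ * (f a / z s.card - 1) := by gcongr
        _ = _ := by field_simp
    have hma : m⁻¹ ≤ (f a)⁻¹ := inv_anti₀ hfa (hle a (Finset.mem_insert_self a s))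
    have := mul_le_mul_of_nonneg_right hma (sub_nonneg.2 hlog)
    linarith

lemma exists_subset_mul_prod_le_iterate_sylvesterStep {ι : Type*} [DecidableEq ι] {D : ℕ}
    (hD : 0 < D) (J : Finset ι) (x : ι → ℕ) (hx : ∀ j ∈ J, 0 < x j)
    (h : (D : ℚ)⁻¹ ≤ ∑ j ∈ J, (x j : ℚ)⁻¹) :
    ∃ I ⊆ J, I.Nonempty ∧ D * ∏ j ∈ I, x j ≤ sylvesterStep^[I.card] D := by
  by_contra! hcon
  have h' : (D : ℝ)⁻¹ ≤ ∑ j ∈ J, (x j : ℝ)⁻¹ := by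
    have := (Rat.cast_le (K := ℝ)).2 h
    push_cast at this
    exact this
  refine absurd ((h'.trans (Finset.sum_inv_le_sum_inv_of_prod_le J (fun j => (x j : ℝ))
    (fun i => ((sylvesterStep^[i] D + 1 : ℕ) : ℝ)) (fun j hj => by exact_mod_cast hx j hj)
    (fun i => by positivity) fun I hI => ?_)).trans_lt
      (sum_inv_iterate_sylvesterStep_lt hD _)) (lt_irrefl _)
  rcases I.eq_empty_or_nonempty with rfl | hne
  · simp
  · have := (hcon I hI hne).le
    rw [← prod_iterate_sylvesterStep_succ] at this
    exact_mod_cast Nat.le_of_mul_le_mul_left this hD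

lemma Finset.one_sub_sum_le_prod_one_sub {ι : Type*} (s : Finset ι) (h : ι → ℚ)
    (h0 : ∀ i ∈ s, 0 ≤ h i) (h1 : ∀ i ∈ s, h i ≤ 1) :
    1 - ∑ i ∈ s, h i ≤ ∏ i ∈ s, (1 - h i) := by
  classical
  induction s using Finset.induction_on with
  | empty => simp
  | insert a s ha ih =>
    rw [Finset.sum_insert ha, Finset.prod_insert ha]
    have h2 := ih (fun i hi => h0 i (Finset.mem_insert_of_mem hi))
      (fun i hi => h1 i (Finset.mem_insert_of_mem hi))
    have h3 := h0 a (Finset.mem_insert_self a s)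
    have h4 := h1 a (Finset.mem_insert_self a s)
    have h5 : ∏ i ∈ s, (1 - h i) ≤ 1 := Finset.prod_le_one
      (fun i hi => sub_nonneg.2 (h1 i (Finset.mem_insert_of_mem hi)))
      (fun i hi => by linarith [h0 i (Finset.mem_insert_of_mem hi)])
    nlinarith

lemma padicNorm_prod (p : ℕ) [Fact p.Prime] {ι : Type*} (s : Finset ι) (f : ι → ℚ) :
    padicNorm p (∏ i ∈ s, f i) = ∏ i ∈ s, padicNorm p (f i) :=
  map_prod (IsAbsoluteValue.toAbsoluteValue (padicNorm p)) f s

/-- A family of disjoint blocks of primes `q`, with exponents `e q` and the divisor sums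
`s q = σ (q ^ e q)`, abstracting an anarchy harmonious tuple. -/
structure HarmoniousBlocks (ι : Type*) [Fintype ι] where
  primes : Finset ℕ
  block : ι → Finset ℕ
  e : ℕ → ℕ
  s : ℕ → ℕ
  prime : ∀ q ∈ primes, q.Prime
  block_subset : ∀ i, block i ⊆ primes
  exists_block : ∀ q ∈ primes, ∃ i, q ∈ block i
  disjoint : ∀ i j, i ≠ j → Disjoint (block i) (block j)
  e_pos : ∀ q ∈ primes, 0 < e q
  s_mul : ∀ q ∈ primes, s q * (q - 1) + 1 = q ^ (e q + 1)
  not_dvd : ∀ i j, i ≠ j → ∀ p ∈ block i, ∀ q ∈ block j, ¬ p ∣ s q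
  sum_eq : ∑ i, ∏ q ∈ block i, ((q : ℚ) ^ e q / s q) = 1

namespace HarmoniousBlocks

variable {ι : Type*} [Fintype ι] (H : HarmoniousBlocks ι)

/-- The factor at `q` when `q` is known for `q ∈ A` and the exponent is known for `q ∈ B`. -/
def factor (A B : Finset ℕ) (q : ℕ) : ℚ :=
  if q ∈ B then (q : ℚ) ^ H.e q / H.s q else if q ∈ A then ((q : ℚ) - 1) / q else 1

/-- The partial evaluation of the harmonious sum. -/
def partialSum (A B : Finset ℕ) : ℚ := ∑ i, ∏ q ∈ H.block i, H.factor A B q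

/-- A common denominator of `partialSum A B`. -/
def denom (A B : Finset ℕ) : ℕ := (∏ q ∈ A, q) * ∏ q ∈ B, (q ^ (H.e q + 1) - 1)

variable {H}

lemma two_le {q : ℕ} (hq : q ∈ H.primes) : (2 : ℚ) ≤ q := by
  exact_mod_cast (H.prime q hq).two_le

lemma s_mul_cast {q : ℕ} (hq : q ∈ H.primes) :
    (H.s q : ℚ) * (q - 1) + 1 = q ^ (H.e q + 1) := by
  have h := H.s_mul q hq
  have h1 := (H.prime q hq).one_le
  zify [h1] at h
  exact_mod_cast h

lemma s_pos {q : ℕ} (hq : q ∈ H.primes) : (0 : ℚ) < H.s q := by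
  have h := s_mul_cast hq
  have h2 := two_le hq
  have h3 : (1 : ℚ) < q ^ (H.e q + 1) := one_lt_pow₀ (by linarith) (by lia)
  by_contra! hs
  nlinarith

lemma pow_div_s_lt_one {q : ℕ} (hq : q ∈ H.primes) : (q : ℚ) ^ H.e q / H.s q < 1 := by
  have h := s_mul_cast hq
  have h2 := two_le hq
  have h3 : (1 : ℚ) < q ^ H.e q := one_lt_pow₀ (by linarith) (H.e_pos q hq).ne'
  rw [div_lt_one (s_pos hq)]
  rw [pow_succ] at h
  by_contra! hs
  nlinarith

lemma pow_div_s_mul {q : ℕ} (hq : q ∈ H.primes) :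
    (q : ℚ) ^ H.e q / H.s q * (1 - ((q : ℚ) ^ (H.e q + 1))⁻¹) = (q - 1) / q := by
  have h := s_mul_cast hq
  have h2 := two_le hq
  have h3 := s_pos hq
  have h4 : (0 : ℚ) < q := by linarith
  have h5 : (0 : ℚ) < q ^ H.e q := by positivity
  rw [pow_succ] at h ⊢
  field_simp
  linarith

lemma pow_div_s_pos {q : ℕ} (hq : q ∈ H.primes) : 0 < (q : ℚ) ^ H.e q / H.s q := by
  have h2 := two_le hq
  have h3 := s_pos hq
  have h4 : (0 : ℚ) < q := by linarith
  positivity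

lemma sub_one_div_pos {q : ℕ} (hq : q ∈ H.primes) : 0 < ((q : ℚ) - 1) / q := by
  have h2 := two_le hq
  exact div_pos (by linarith) (by linarith)

lemma inv_pow_pos {q : ℕ} (hq : q ∈ H.primes) : 0 < ((q : ℚ) ^ (H.e q + 1))⁻¹ := by
  have h2 := two_le hq
  have h4 : (0 : ℚ) < q := by linarith
  positivity

lemma sub_one_div_le {q : ℕ} (hq : q ∈ H.primes) :
    ((q : ℚ) - 1) / q ≤ (q : ℚ) ^ H.e q / H.s q := by
  rw [← pow_div_s_mul hq]
  nlinarith [mul_pos (pow_div_s_pos hq) (inv_pow_pos hq)]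

lemma factor_pos (A B : Finset ℕ) {q : ℕ} (hq : q ∈ H.primes) : 0 < H.factor A B q := by
  unfold factor
  split_ifs
  · exact pow_div_s_pos hq
  · exact sub_one_div_pos hq
  · exact one_pos

lemma factor_le_one (A B : Finset ℕ) {q : ℕ} (hq : q ∈ H.primes) : H.factor A B q ≤ 1 := by
  unfold factor
  split_ifs
  · exact (pow_div_s_lt_one hq).le
  · exact (sub_one_div_le hq).trans (pow_div_s_lt_one hq).le
  · exact le_rfl

lemma partialSum_le_partialSum {A B A' B' : Finset ℕ}
    (h : ∀ q ∈ H.primes, H.factor A B q ≤ H.factor A' B' q) :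
    H.partialSum A B ≤ H.partialSum A' B' :=
  Finset.sum_le_sum fun i _ => Finset.prod_le_prod
    (fun _ hq => (factor_pos A B (H.block_subset i hq)).le)
    (fun q hq => h q (H.block_subset i hq))

lemma partialSum_primes : H.partialSum H.primes H.primes = 1 := by
  rw [← H.sum_eq]
  refine Finset.sum_congr rfl fun i _ => Finset.prod_congr rfl fun q hq => ?_
  rw [factor, if_pos (H.block_subset i hq)]

lemma partialSum_sub_le {A B A' B' J : Finset ℕ} (hJ : J ⊆ H.primes) (f : ℕ → ℚ)
    (h0 : ∀ q ∈ J, 0 ≤ f q) (h1 : ∀ q ∈ J, f q ≤ 1)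
    (h : ∀ q ∈ H.primes, H.factor A' B' q = H.factor A B q * (1 - if q ∈ J then f q else 0)) :
    H.partialSum A B - H.partialSum A' B' ≤ ∑ q ∈ J, f q := by
  set g : ℕ → ℚ := fun q => if q ∈ J then f q else 0 with hg
  have hg0 : ∀ q, 0 ≤ g q := fun q => by
    by_cases hq : q ∈ J
    · simpa [hg, hq] using h0 q hq
    · simp [hg, hq]
  have hg1 : ∀ q, g q ≤ 1 := fun q => by
    by_cases hq : q ∈ J
    · simpa [hg, hq] using h1 q hq
    · simp [hg, hq]
  have hsum : ∑ i, ∑ q ∈ H.block i, g q = ∑ q ∈ J, f q := by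
    rw [← Finset.sum_biUnion (fun i _ j _ hij => H.disjoint i j hij), Finset.sum_ite_mem]
    congr 1
    ext q
    simp only [Finset.mem_inter, Finset.mem_biUnion, Finset.mem_univ, true_and]
    exact ⟨fun hq => hq.2, fun hq => ⟨H.exists_block q (hJ hq), hq⟩⟩
  rw [← hsum, partialSum, partialSum, ← Finset.sum_sub_distrib]
  refine Finset.sum_le_sum fun i _ => ?_
  rw [Finset.prod_congr rfl fun q hq => h q (H.block_subset i hq), Finset.prod_mul_distrib]
  have hA1 : ∏ q ∈ H.block i, H.factor A B q ≤ 1 := Finset.prod_le_one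
    (fun q hq => (factor_pos A B (H.block_subset i hq)).le)
    (fun q hq => factor_le_one A B (H.block_subset i hq))
  have hA0 : 0 ≤ ∏ q ∈ H.block i, H.factor A B q := Finset.prod_nonneg
    (fun q hq => (factor_pos A B (H.block_subset i hq)).le)
  have h2 := Finset.one_sub_sum_le_prod_one_sub (H.block i) g (fun q _ => hg0 q) (fun q _ => hg1 q)
  have h3 : 0 ≤ ∑ q ∈ H.block i, g q := Finset.sum_nonneg fun q _ => hg0 q
  change _ - _ * ∏ q ∈ H.block i, (1 - g q) ≤ _
  nlinarith

lemma pow_sub_one_pos {q : ℕ} (hq : q ∈ H.primes) : 0 < q ^ (H.e q + 1) - 1 :=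
  Nat.sub_pos_of_lt (Nat.one_lt_pow (by lia) (H.prime q hq).one_lt)

lemma denom_pos {A B : Finset ℕ} (hA : A ⊆ H.primes) (hB : B ⊆ H.primes) :
    0 < H.denom A B :=
  Nat.mul_pos (Finset.prod_pos fun q hq => (H.prime q (hA hq)).pos)
    (Finset.prod_pos fun _ hq => pow_sub_one_pos (hB hq))

lemma exists_int_eq_partialSum_mul_denom {A B : Finset ℕ} (hBA : B ⊆ A) (hA : A ⊆ H.primes) :
    ∃ z : ℤ, (z : ℚ) = H.partialSum A B * H.denom A B := by
  set d : ℕ → ℚ := fun q => (if q ∈ A then (q : ℚ) else 1) *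
    (if q ∈ B then (q : ℚ) ^ (H.e q + 1) - 1 else 1) with hd
  have hcast : ∀ q ∈ H.primes, ((q ^ (H.e q + 1) - 1 : ℕ) : ℚ) = (q : ℚ) ^ (H.e q + 1) - 1 :=
    fun q hq => by
      rw [Nat.cast_sub (Nat.one_le_pow _ _ (H.prime q hq).pos)]
      push_cast
      rfl
  have hden : (H.denom A B : ℚ) = ∏ q ∈ H.primes, d q := by
    rw [Finset.prod_mul_distrib, Finset.prod_ite_mem, Finset.prod_ite_mem,
      Finset.inter_eq_right.2 hA, Finset.inter_eq_right.2 (hBA.trans hA), denom]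
    push_cast
    congr 1
    exact Finset.prod_congr rfl fun q hq => hcast q (hA (hBA hq))
  have hdint : ∀ q, d q ∈ (Int.castRingHom ℚ).range := fun q => by
    refine ⟨(if q ∈ A then (q : ℤ) else 1) * (if q ∈ B then (q : ℤ) ^ (H.e q + 1) - 1 else 1), ?_⟩
    simp only [hd]
    split_ifs <;> simp
  have hfint : ∀ q ∈ H.primes, H.factor A B q * d q ∈ (Int.castRingHom ℚ).range := fun q hq => by
    have hq0 : (q : ℚ) ≠ 0 := by exact_mod_cast (H.prime q hq).ne_zero
    have hs0 := (s_pos hq).ne'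
    by_cases hqB : q ∈ B
    · refine ⟨(q : ℤ) ^ H.e q * q * (q - 1), ?_⟩
      simp only [hd, factor, if_pos hqB, if_pos (hBA hqB), ← s_mul_cast hq]
      simp
      field_simp
    · by_cases hqA : q ∈ A
      · refine ⟨(q : ℤ) - 1, ?_⟩
        simp only [hd, factor, if_neg hqB, if_pos hqA]
        simp
        field_simp
      · exact ⟨1, by simp [hd, factor, hqA, hqB]⟩
  suffices hmem : H.partialSum A B * H.denom A B ∈ (Int.castRingHom ℚ).range by
    obtain ⟨z, hz⟩ := hmem
    exact ⟨z, by simpa using hz⟩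
  rw [hden, partialSum, Finset.sum_mul]
  refine Subring.sum_mem _ fun i _ => ?_
  rw [← Finset.prod_sdiff (H.block_subset i), mul_comm (∏ q ∈ _ \ _, d q), ← mul_assoc,
    ← Finset.prod_mul_distrib]
  exact Subring.mul_mem _ (Subring.prod_mem _ fun q hq => hfint q (H.block_subset i hq))
    (Subring.prod_mem _ fun q _ => hdint q)

lemma partialSum_ne_one {A B : Finset ℕ} (hBA : B ⊂ A) (hA : A ⊆ H.primes) :
    H.partialSum A B ≠ 1 := by
  intro hone
  obtain ⟨p, hp, hmax⟩ := (A \ B).exists_max_image id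
    (Finset.sdiff_nonempty.2 hBA.2)
  obtain ⟨hpA, hpB⟩ := Finset.mem_sdiff.1 hp
  have hpp := H.prime p (hA hpA)
  have : Fact p.Prime := ⟨hpp⟩
  obtain ⟨i, hpi⟩ := H.exists_block p (hA hpA)
  have hnorm_pow : ∀ q ∈ H.primes, q ≠ p → padicNorm p ((q : ℚ) ^ H.e q) = 1 :=
    fun q hq hqp => by
      have := (padicNorm.nat_eq_one_iff (p := p) (q ^ H.e q)).2 fun h =>
        hqp ((Nat.prime_dvd_prime_iff_eq hpp (H.prime q hq)).1 (hpp.dvd_of_dvd_pow h)).symm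
      simpa using this
  have hnorm_self : ∀ q ∈ H.primes, q ≠ p → padicNorm p (q : ℚ) = 1 := fun q hq hqp =>
    (padicNorm.nat_eq_one_iff q).2 fun h =>
      hqp ((Nat.prime_dvd_prime_iff_eq hpp (H.prime q hq)).1 h).symm
  have hcast : ∀ q ∈ H.primes, (q : ℚ) - 1 = ((q - 1 : ℕ) : ℚ) := fun q hq => by
    rw [Nat.cast_sub (H.prime q hq).one_le, Nat.cast_one]
  have hfac : ∀ q ∈ H.primes, q ≠ p → (q ∈ B → ¬ p ∣ H.s q) →
      padicNorm p (H.factor A B q) ≤ 1 := by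
    intro q hq hqp hs
    unfold factor
    split_ifs with h1 h2
    · rw [padicNorm.div, hnorm_pow q hq hqp, (padicNorm.nat_eq_one_iff _).2 (hs h1), div_one]
    · rw [padicNorm.div, hnorm_self q hq hqp, div_one, hcast q hq]
      exact padicNorm.of_nat _
    · simp
  have hother : ∀ j, j ≠ i → padicNorm p (∏ q ∈ H.block j, H.factor A B q) ≤ 1 := by
    intro j hj
    rw [padicNorm_prod]
    refine Finset.prod_le_one (fun _ _ => padicNorm.nonneg _) fun q hq => ?_
    refine hfac q (H.block_subset j hq) ?_ fun _ => H.not_dvd i j hj.symm p hpi q hq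
    rintro rfl
    exact Finset.disjoint_left.1 (H.disjoint j i hj) hq hpi
  have hself : 1 < padicNorm p (∏ q ∈ H.block i, H.factor A B q) := by
    have hnorm_sub : ∀ q ∈ H.primes, q ≤ p → padicNorm p ((q : ℚ) - 1) = 1 := fun q hq hqp => by
      rw [hcast q hq, padicNorm.nat_eq_one_iff]
      have := (H.prime q hq).two_le
      exact fun h => absurd (Nat.le_of_dvd (by lia) h) (by lia)
    rw [padicNorm_prod, ← Finset.mul_prod_erase _ _ hpi]
    have hp1 : 1 < padicNorm p (H.factor A B p) := by
      rw [factor, if_neg hpB, if_pos hpA, padicNorm.div, hnorm_sub p (hA hpA) le_rfl,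
        padicNorm.padicNorm_p_of_prime, one_div, inv_inv]
      exact_mod_cast hpp.one_lt
    refine one_lt_mul_of_lt_of_le hp1 (le_of_eq_of_le Finset.prod_const_one.symm
      (Finset.prod_le_prod (fun _ _ => zero_le_one) fun q hq => ?_))
    obtain ⟨hqp, hqi⟩ := Finset.mem_erase.1 hq
    have hqP := H.block_subset i hqi
    unfold factor
    split_ifs with h1 h2
    · rw [padicNorm.div, hnorm_pow q hqP hqp]
      have h0 : 0 < padicNorm p (H.s q : ℚ) :=
        (padicNorm.nonneg _).lt_of_ne' (padicNorm.nonzero (s_pos hqP).ne')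
      exact (one_le_div h0).2 (padicNorm.of_nat _)
    · rw [padicNorm.div, hnorm_self q hqP hqp,
        hnorm_sub q hqP (hmax q (Finset.mem_sdiff.2 ⟨h2, h1⟩)), div_one]
    · simp
  classical
  have hsum : ∏ q ∈ H.block i, H.factor A B q =
      1 - ∑ j ∈ Finset.univ.erase i, ∏ q ∈ H.block j, H.factor A B q := by
    rw [← hone, partialSum, ← Finset.add_sum_erase _ _ (Finset.mem_univ i), add_sub_cancel_right]
  rw [hsum] at hself
  refine absurd hself (not_lt.2 (padicNorm.sub.trans (max_le (by simp) ?_)))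
  exact padicNorm.sum_le' (fun j hj => hother j (Finset.ne_of_mem_erase hj)) zero_le_one

lemma one_lt_partialSum_self {A : Finset ℕ} (hA : A ⊂ H.primes) : 1 < H.partialSum A A := by
  obtain ⟨p, hp, hpA⟩ := Finset.exists_of_ssubset hA
  obtain ⟨i, hpi⟩ := H.exists_block p hp
  have hle : ∀ q ∈ H.primes, H.factor H.primes H.primes q ≤ H.factor A A q := fun q hq => by
    unfold factor
    rw [if_pos hq]
    split_ifs
    · exact le_rfl
    · exact (pow_div_s_lt_one hq).le
  rw [← H.partialSum_primes]
  refine Finset.sum_lt_sum (fun j _ => Finset.prod_le_prod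
    (fun q hq => (factor_pos _ _ (H.block_subset j hq)).le)
    (fun q hq => hle q (H.block_subset j hq))) ⟨i, Finset.mem_univ i, ?_⟩
  refine Finset.prod_lt_prod (fun q hq => factor_pos _ _ (H.block_subset i hq))
    (fun q hq => hle q (H.block_subset i hq)) ⟨p, hpi, ?_⟩
  simpa [factor, hp, hpA] using pow_div_s_lt_one hp

lemma inv_denom_le_abs {A B : Finset ℕ} (hBA : B ⊆ A) (hA : A ⊆ H.primes)
    (hne : H.partialSum A B ≠ 1) : (H.denom A B : ℚ)⁻¹ ≤ |H.partialSum A B - 1| := by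
  obtain ⟨z, hz⟩ := exists_int_eq_partialSum_mul_denom hBA hA
  have hD : (0 : ℚ) < H.denom A B := by exact_mod_cast denom_pos hA (hBA.trans hA)
  have hcast : ((z - H.denom A B : ℤ) : ℚ) = (H.partialSum A B - 1) * H.denom A B := by
    push_cast
    rw [hz]
    ring
  have hne' : z - H.denom A B ≠ 0 := fun h => by
    rw [h, Int.cast_zero] at hcast
    exact (mul_ne_zero (sub_ne_zero.2 hne) hD.ne') hcast.symm
  have h1 : (1 : ℚ) ≤ |((z - H.denom A B : ℤ) : ℚ)| := by
    exact_mod_cast Int.one_le_abs hne'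
  rw [hcast, abs_mul, abs_of_pos hD] at h1
  rwa [inv_le_iff_one_le_mul₀ hD]

lemma exists_denom_le {A B : Finset ℕ} (hBA : B ⊆ A) (hA : A ⊆ H.primes)
    (hne : ¬ (A = H.primes ∧ B = H.primes)) :
    ∃ A' B' : Finset ℕ, ∃ n, 0 < n ∧ B' ⊆ A' ∧ A' ⊆ H.primes ∧
      A'.card + B'.card = A.card + B.card + n ∧
      H.denom A' B' ≤ sylvesterStep^[n] (H.denom A B) := by
  have hB := hBA.trans hA
  have hne1 : H.partialSum A B ≠ 1 := by
    rcases hBA.eq_or_ssubset with rfl | hss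
    · refine (one_lt_partialSum_self (hA.ssubset_of_ne fun h => hne ⟨h, h⟩)).ne'
    · exact partialSum_ne_one hss hA
  have hgap := inv_denom_le_abs hBA hA hne1
  rcases hne1.lt_or_gt with hlt | hgt
  · rw [abs_of_neg (sub_neg.2 hlt)] at hgap
    have hJ : A \ B ⊆ H.primes := Finset.sdiff_subset.trans hA
    have hone : 1 ≤ H.partialSum A A := by
      rw [← H.partialSum_primes]
      refine partialSum_le_partialSum fun q hq => ?_
      unfold factor
      rw [if_pos hq]
      split_ifs
      · exact le_rfl
      · exact (pow_div_s_lt_one hq).le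
    have hdiff := partialSum_sub_le (H := H) (A := A) (B := A) (A' := A) (B' := B) hJ
      (fun q => ((q : ℚ) ^ (H.e q + 1))⁻¹) (fun q hq => (inv_pow_pos (hJ hq)).le)
      (fun q hq => inv_le_one_of_one_le₀ (one_le_pow₀ (by linarith [two_le (hJ hq)])))
      (fun q hq => by
        by_cases h1 : q ∈ B
        · simp [factor, h1, hBA h1]
        · by_cases h2 : q ∈ A
          · simp only [factor, h1, h2, if_true, if_false, Finset.mem_sdiff, not_false_eq_true,
              and_self]
            exact (pow_div_s_mul hq).symm
          · simp [factor, h1, h2])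
    obtain ⟨I, hI, hIne, hIle⟩ := exists_subset_mul_prod_le_iterate_sylvesterStep
      (denom_pos hA hB) (A \ B) (fun q => q ^ (H.e q + 1))
      (fun q hq => pow_pos (H.prime q (hJ hq)).pos _)
      (by push_cast; linarith)
    have hdisj : Disjoint B I := Finset.disjoint_sdiff.mono_right hI
    refine ⟨A, B ∪ I, I.card, hIne.card_pos,
      Finset.union_subset hBA (hI.trans Finset.sdiff_subset), hA, ?_, ?_⟩
    · rw [Finset.card_union_of_disjoint hdisj]
      ring
    · refine le_trans ?_ hIle
      rw [denom, denom, Finset.prod_union hdisj, ← mul_assoc]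
      exact Nat.mul_le_mul_left _ (Finset.prod_le_prod' fun q _ => Nat.sub_le _ _)
  · rw [abs_of_pos (sub_pos.2 hgt)] at hgap
    have hJ : H.primes \ A ⊆ H.primes := Finset.sdiff_subset
    have hone : H.partialSum H.primes B ≤ 1 := by
      rw [← H.partialSum_primes]
      refine partialSum_le_partialSum fun q hq => ?_
      unfold factor
      rw [if_pos hq, if_pos hq]
      split_ifs
      · exact le_rfl
      · exact sub_one_div_le hq
    have hdiff := partialSum_sub_le (H := H) (A := A) (B := B) (A' := H.primes) (B' := B) hJ
      (fun q => (q : ℚ)⁻¹) (fun q _ => by positivity)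
      (fun q hq => inv_le_one_of_one_le₀ (by linarith [two_le (hJ hq)]))
      (fun q hq => by
        by_cases h1 : q ∈ B
        · simp [factor, h1, hBA h1]
        · have hq0 : (q : ℚ) ≠ 0 := by linarith [two_le hq]
          by_cases h2 : q ∈ A
          · simp [factor, h1, h2, hq]
          · simp [factor, h1, h2, hq]
            field_simp)
    obtain ⟨I, hI, hIne, hIle⟩ := exists_subset_mul_prod_le_iterate_sylvesterStep
      (denom_pos hA hB) (H.primes \ A) (fun q => q)
      (fun q hq => (H.prime q (hJ hq)).pos) (by linarith)
    have hdisj : Disjoint A I := Finset.disjoint_sdiff.mono_right hI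
    refine ⟨A ∪ I, B, I.card, hIne.card_pos, hBA.trans Finset.subset_union_left,
      Finset.union_subset hA (hI.trans hJ), ?_, ?_⟩
    · rw [Finset.card_union_of_disjoint hdisj]
      ring
    · refine le_of_eq_of_le ?_ hIle
      rw [denom, denom, Finset.prod_union hdisj]
      ring

variable (H)

theorem denom_primes_le :
    H.denom H.primes H.primes ≤ sylvesterStep^[2 * H.primes.card] 1 := by
  suffices h : ∀ n (A B : Finset ℕ), B ⊆ A → A ⊆ H.primes →
      2 * H.primes.card - (A.card + B.card) = n →
      H.denom A B ≤ sylvesterStep^[A.card + B.card] 1 →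
      H.denom H.primes H.primes ≤ sylvesterStep^[2 * H.primes.card] 1 from
    h _ ∅ ∅ subset_rfl (Finset.empty_subset _) rfl (by simp [denom])
  intro n
  induction n using Nat.strong_induction_on with
  | _ n ih =>
    intro A B hBA hA hn hle
    by_cases hfin : A = H.primes ∧ B = H.primes
    · rwa [hfin.1, hfin.2, ← two_mul] at hle
    · obtain ⟨A', B', m, hm, hBA', hA', hcard, hden⟩ := exists_denom_le hBA hA hfin
      have h1 := Finset.card_le_card hA'
      have h2 := Finset.card_le_card (hBA'.trans hA')
      refine ih _ (by lia) A' B' hBA' hA' rfl (hden.trans ?_)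
      rw [hcard, add_comm, Function.iterate_add_apply]
      exact sylvesterStep_mono.iterate m hle

end HarmoniousBlocks

lemma sigma_eq_prod_primeFactors {n : ℕ} (hn : n ≠ 0) :
    sigma n = ∏ q ∈ n.primeFactors, sigma (q ^ n.factorization q) := by
  have h (m : ℕ) : sigma m = ArithmeticFunction.sigma 1 m :=
    (ArithmeticFunction.sigma_one_apply m).symm
  simp only [h]
  exact ArithmeticFunction.isMultiplicative_sigma.multiplicative_factorization _ hn

lemma sigma_prime_pow_mul {q : ℕ} (hq : q.Prime) (e : ℕ) :
    sigma (q ^ e) * (q - 1) + 1 = q ^ (e + 1) := by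
  rw [sigma, Nat.sum_divisors_prime_pow hq]
  have h := geom_sum_mul (q : ℤ) (e + 1)
  zify [hq.one_le]
  linarith

theorem amicable_tuples_stmt12 (k : ℕ) (hk : 2 ≤ k) (M : Fin k → ℕ)
    (hpos : ∀ i, 0 < M i) (hdist : Function.Injective M)
    (hanarchy : ∀ i j, i ≠ j → Nat.gcd (M i) (M j * sigma (M j)) = 1)
    (hharm : ∑ i, (M i : ℝ) / (sigma (M i) : ℝ) = 1)
    (K : ℕ) (hK : K = (∏ i, M i).primeFactors.card) :
    (sigma (∏ i, M i) : ℝ) * (PhiS (∏ i, M i).primeFactors : ℝ) /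
        (PiS (∏ i, M i).primeFactors : ℝ) ≤
      F (2 * K) 2 * ((PiS (∏ i, M i).primeFactors : ℝ)) ^ (-2 : ℤ) := by
  have hN : ∏ i, M i ≠ 0 := Finset.prod_ne_zero_iff.2 fun i _ => (hpos i).ne'
  have hcop : ∀ i j, i ≠ j → Nat.Coprime (M i) (M j) := fun i j hij =>
    Nat.Coprime.coprime_mul_right_right (hanarchy i j hij)
  have hcops : ∀ i j, i ≠ j → Nat.Coprime (M i) (sigma (M j)) := fun i j hij =>
    Nat.Coprime.coprime_mul_left_right (hanarchy i j hij)
  have hsub : ∀ i, (M i).primeFactors ⊆ (∏ i, M i).primeFactors := fun i =>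
    Nat.primeFactors_mono (Finset.dvd_prod_of_mem M (Finset.mem_univ i)) hN
  have hfact : ∀ i, ∀ q ∈ (M i).primeFactors,
      (∏ i, M i).factorization q = (M i).factorization q := by
    intro i q hq
    rw [Nat.factorization_prod fun j _ => (hpos j).ne', Finsupp.finsetSum_apply]
    refine Finset.sum_eq_single i (fun j _ hji => ?_) (by simp)
    refine Nat.factorization_eq_zero_of_not_dvd fun h => ?_
    exact Nat.not_coprime_of_dvd_of_dvd (Nat.prime_of_mem_primeFactors hq).one_lt h
      (Nat.dvd_of_mem_primeFactors hq) (hcop j i hji)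
  have hsigma : ∀ i, sigma (M i) =
      ∏ q ∈ (M i).primeFactors, sigma (q ^ (∏ i, M i).factorization q) := fun i => by
    rw [sigma_eq_prod_primeFactors (hpos i).ne']
    exact Finset.prod_congr rfl fun q hq => by rw [hfact i q hq]
  let H : HarmoniousBlocks (Fin k) :=
    { primes := (∏ i, M i).primeFactors
      block := fun i => (M i).primeFactors
      e := (∏ i, M i).factorization
      s := fun q => sigma (q ^ (∏ i, M i).factorization q)
      prime := fun q hq => Nat.prime_of_mem_primeFactors hq
      block_subset := hsub
      exists_block := fun q hq => by
        have hqp := Nat.prime_of_mem_primeFactors hq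
        obtain ⟨i, _, hi⟩ := (hqp.prime.dvd_finsetProd_iff M).1 (Nat.dvd_of_mem_primeFactors hq)
        exact ⟨i, Nat.mem_primeFactors.2 ⟨hqp, hi, (hpos i).ne'⟩⟩
      disjoint := fun i j hij => (hcop i j hij).disjoint_primeFactors
      e_pos := fun q hq => (Nat.prime_of_mem_primeFactors hq).factorization_pos_of_dvd hN
        (Nat.dvd_of_mem_primeFactors hq)
      s_mul := fun q hq => sigma_prime_pow_mul (Nat.prime_of_mem_primeFactors hq) _
      not_dvd := fun i j hij p hp q hq h => by
        refine Nat.not_coprime_of_dvd_of_dvd (Nat.prime_of_mem_primeFactors hp).one_lt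
          (Nat.dvd_of_mem_primeFactors hp) ?_ (hcops i j hij)
        rw [hsigma j]
        exact h.trans (Finset.dvd_prod_of_mem
          (fun q => sigma (q ^ (∏ i, M i).factorization q)) hq)
      sum_eq := by
        have hharm' : ∑ i, (M i : ℚ) / (sigma (M i) : ℚ) = 1 := by
          have h : ((∑ i, (M i : ℚ) / (sigma (M i) : ℚ) : ℚ) : ℝ) = 1 := by
            push_cast
            exact hharm
          exact_mod_cast h
        rw [← hharm']
        refine Finset.sum_congr rfl fun i _ => ?_
        rw [Finset.prod_div_distrib, hsigma i]
        push_cast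
        congr 1
        have h := Nat.prod_factorization_pow_eq_self (hpos i).ne'
        rw [Finsupp.prod, Nat.support_factorization] at h
        rw [← Nat.cast_inj (R := ℚ)] at h
        push_cast at h
        rw [← h]
        refine Finset.prod_congr rfl fun q hq => ?_
        rw [hfact i q hq] }
  have hmain := H.denom_primes_le
  have hden : H.denom H.primes H.primes = PiS (∏ i, M i).primeFactors *
      (sigma (∏ i, M i) * PhiS (∏ i, M i).primeFactors) := by
    rw [HarmoniousBlocks.denom, sigma_eq_prod_primeFactors hN, PhiS, PiS,
      ← Finset.prod_mul_distrib (f := fun q => sigma (q ^ (∏ i, M i).factorization q))]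
    refine congrArg _ (Finset.prod_congr rfl fun q hq => ?_)
    rw [← H.s_mul q hq, Nat.add_sub_cancel]
  have hF : ((PiS (∏ i, M i).primeFactors *
      (sigma (∏ i, M i) * PhiS (∏ i, M i).primeFactors) : ℕ) : ℝ) ≤ F (2 * K) 2 := by
    rw [← hden, hK]
    exact (Nat.cast_le.2 hmain).trans (iterate_sylvesterStep_one_le_F _)
  have hPi : (0 : ℝ) < PiS (∏ i, M i).primeFactors := by
    exact_mod_cast Finset.prod_pos fun q hq => (Nat.prime_of_mem_primeFactors hq).pos
  push_cast at hF
  rw [zpow_neg, zpow_ofNat, ← div_eq_mul_inv, div_le_div_iff₀ hPi (by positivity)]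
  nlinarith
end
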